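/- There exist real numbers θ_0, θ_∞ ∈ [0, 2π) with the following properties: (a) for every θ ∈ (θ_0 − π/8, θ_0 + π/8) there exist a sequence (t_n) in [2,∞) with t_n → ∞ and a sequence (r_n) of positive real numbers with r_n → 0 such that ζ(1/2 + i·t_n) = r_n · exp(i·θ) for every n; (b) for every θ ∈ (θ_∞ − π/8, θ_∞ + π/8) there exist a sequence (t_n) in [2,∞) with t_n → ∞ and a sequence (r_n) of positive real numbers with r_n → ∞ such that ζ(1/2 + i·t_n) = r_n · exp(i·θ) for every n. -/

import Mathlib

open Complex Filter Set Topology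

section

lemma deriv_tendsto_of_bdd {F : ℕ → ℂ → ℂ} {G : ℂ → ℂ} {U : Set ℂ} (hU : IsOpen U) {c : ℂ} {r M : ℝ}
    (hr : 0 < r) (hc : Metric.closedBall c r ⊆ U)
    (hF : ∀ᶠ n in atTop, DifferentiableOn ℂ (F n) U) (hG : DifferentiableOn ℂ G U)
    (hM : ∀ᶠ n in atTop, ∀ w ∈ Metric.closedBall c r, ‖F n w‖ ≤ M)
    (hlim : ∀ w ∈ U, Tendsto (fun n => F n w) atTop (𝓝 (G w))) :
    Tendsto (fun n => deriv (F n) c) atTop (𝓝 (deriv G c)) := by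
  rw [← cderiv_eq_deriv hU hG hr hc]
  have h1 : ∀ᶠ n in atTop, cderiv r (F n) c = deriv (F n) c := by
    filter_upwards [hF] with n hn
    exact cderiv_eq_deriv hU hn hr hc
  refine Tendsto.congr' h1 ?_
  unfold cderiv
  refine Tendsto.const_smul ?_ _
  unfold circleIntegral
  have hmem : ∀ θ : ℝ, circleMap c r θ ∈ Metric.closedBall c r := fun θ =>
    circleMap_mem_closedBall c hr.le θ
  refine intervalIntegral.tendsto_integral_filter_of_dominated_convergence
    (fun _ => r * ((r^2)⁻¹ * M)) ?_ ?_ ?_ ?_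
  · filter_upwards [hF] with n hn
    refine (Continuous.aestronglyMeasurable ?_)
    have : Continuous fun θ : ℝ => F n (circleMap c r θ) := by
      refine hn.continuousOn.comp_continuous (continuous_circleMap c r) fun θ => hc (hmem θ)
    have h2 : Continuous fun θ : ℝ => ((circleMap c r θ - c)^2)⁻¹ := by
      refine Continuous.inv₀ (by fun_prop) fun θ => ?_
      simp [circleMap, hr.ne']
    have h3 : Continuous fun θ : ℝ => deriv (circleMap c r) θ := by
      simp only [deriv_circleMap]; fun_prop
    exact h3.smul (h2.smul this)
  · filter_upwards [hM] with n hn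
    refine Eventually.of_forall fun θ _ => ?_
    have := hn _ (hmem θ)
    simp only [deriv_circleMap, norm_smul, norm_mul, norm_inv, norm_pow]
    simp only [circleMap, add_sub_cancel_left, norm_mul, norm_exp_ofReal_mul_I, zero_add, Complex.norm_I, mul_one, Complex.norm_real, Real.norm_eq_abs, abs_of_pos hr]
    simp only [circleMap] at this
    gcongr
  · simp
  · refine Eventually.of_forall fun θ _ => ?_
    exact ((hlim _ (hc (hmem θ))).const_smul _).const_smul _

lemma norm_GammaSeq_le {a b : ℝ} (ha : 0 < a) {s : ℂ} (h1 : a ≤ s.re) (h2 : s.re ≤ b) {n : ℕ}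
    (hn : n ≠ 0) : ‖GammaSeq s n‖ ≤ ‖GammaSeq a n‖ + ‖GammaSeq b n‖ := by
  have hb : 0 < b := lt_of_lt_of_le ha (h1.trans h2)
  have hs : 0 < s.re := lt_of_lt_of_le ha h1
  have key : ∀ c : ℝ, 0 < c → GammaSeq c n = ((∫ x : ℝ in 0..n, (1 - x / n) ^ n * x ^ (c - 1) : ℝ) : ℂ) := by
    intro c hc
    rw [GammaSeq_eq_approx_Gamma_integral (by simpa using hc) hn, ← intervalIntegral.integral_ofReal]
    refine intervalIntegral.integral_congr fun x hx => ?_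
    rw [uIcc_of_le (by positivity)] at hx
    have := Complex.ofReal_cpow hx.1 (c - 1)
    push_cast at this ⊢
    rw [this]
  have hIntb : ∀ c : ℝ, 0 < c → IntervalIntegrable (fun x : ℝ => (1 - x / n) ^ n * x ^ (c - 1)) MeasureTheory.volume 0 n := by
    intro c hc
    refine IntervalIntegrable.continuousOn_mul (intervalIntegral.intervalIntegrable_rpow' (by linarith)) ?_
    fun_prop
  rw [key a ha, key b hb, GammaSeq_eq_approx_Gamma_integral hs hn]
  have hle : ‖∫ (x : ℝ) in (0:ℝ)..n, ((1 - x / n : ℝ) ^ n : ℝ) * (x:ℂ) ^ (s - 1)‖ ≤ ∫ x : ℝ in (0:ℝ)..n, ((1 - x / n) ^ n * x ^ (a - 1) + (1 - x / n) ^ n * x ^ (b - 1)) := by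
    refine intervalIntegral.norm_integral_le_of_norm_le (by positivity) ?_ ((hIntb a ha).add (hIntb b hb))
    refine Eventually.of_forall fun x hx => ?_
    have hx0 : 0 < x := hx.1
    have h1x : 0 ≤ 1 - x / n := by
      rw [sub_nonneg, div_le_one (by positivity)]; exact hx.2
    rw [norm_mul, Complex.norm_real, Complex.norm_cpow_eq_rpow_re_of_pos hx0, ← mul_add,
      Real.norm_of_nonneg (by positivity)]
    refine mul_le_mul_of_nonneg_left ?_ (by positivity)
    simp only [sub_re, one_re]
    rcases le_total x 1 with hx1 | hx1
    · have := Real.rpow_le_rpow_of_exponent_ge hx0 hx1 (sub_le_sub_right h1 1)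
      have := Real.rpow_nonneg hx0.le (b-1); linarith
    · have := Real.rpow_le_rpow_of_exponent_le hx1 (sub_le_sub_right h2 1)
      have := Real.rpow_nonneg hx0.le (a-1); linarith
  rw [intervalIntegral.integral_add (hIntb a ha) (hIntb b hb)] at hle
  refine hle.trans ?_
  rw [Complex.norm_real, Complex.norm_real]
  exact add_le_add (le_abs_self _) (le_abs_self _)

lemma logDeriv_GammaSeq {s : ℂ} (hs : 0 < s.re) {n : ℕ} (hn : n ≠ 0) :
    deriv (fun z => GammaSeq z n) s = GammaSeq s n * (Real.log n - ∑ j ∈ Finset.range (n+1), 1 / (s + j))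
    ∧ DifferentiableAt ℂ (fun z => GammaSeq z n) s := by
  have hne : ∀ j : ℕ, s + j ≠ 0 := fun j h => by
    have := congrArg Complex.re h; simp at this
    have : (0:ℝ) ≤ j := by positivity
    linarith
  have hprod : HasDerivAt (fun z : ℂ => ∏ j ∈ Finset.range (n+1), (z + j))
      ((∏ j ∈ Finset.range (n+1), (s + j)) * ∑ j ∈ Finset.range (n+1), 1 / (s + j)) s := by
    have := HasDerivAt.fun_finsetProd (u := Finset.range (n+1)) (f := fun (j:ℕ) (z:ℂ) => z + j) (f' := fun _ => 1) (x := s)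
      (fun j _ => (hasDerivAt_id s).add_const _)
    refine this.congr_deriv ?_
    rw [Finset.mul_sum]
    refine Finset.sum_congr rfl fun j hj => ?_
    rw [← Finset.mul_prod_erase _ _ hj]
    have := hne j
    rw [smul_eq_mul]
    field_simp
  have hn0 : (n:ℂ) ≠ 0 := by exact_mod_cast hn
  have hpow : HasDerivAt (fun z : ℂ => (n:ℂ) ^ z) ((n:ℂ) ^ s * Complex.log n) s := by
    simpa using (hasDerivAt_id s).const_cpow (Or.inl hn0)
  have hP : (∏ j ∈ Finset.range (n+1), (s + j)) ≠ 0 := Finset.prod_ne_zero_iff.mpr fun j _ => hne j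
  have := (hpow.mul_const (n.factorial : ℂ)).div hprod hP
  have h2 : HasDerivAt (fun z => GammaSeq z n) (GammaSeq s n * (Real.log n - ∑ j ∈ Finset.range (n+1), 1 / (s + j))) s := by
    refine this.congr_deriv ?_
    unfold GammaSeq
    rw [← Complex.natCast_log]
    field_simp
  exact ⟨h2.deriv, h2.differentiableAt⟩

lemma digamma_tendsto {s : ℂ} (hs : 0 < s.re) :
    Tendsto (fun n : ℕ => (Real.log n - ∑ j ∈ Finset.range (n+1), 1 / (s + j) : ℂ)) atTop
      (𝓝 (deriv Gamma s / Gamma s)) := by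
  have hU : IsOpen {z : ℂ | 0 < z.re} := isOpen_lt continuous_const Complex.continuous_re
  have hball : Metric.closedBall s (s.re/2) ⊆ {z : ℂ | 0 < z.re} := by
    intro w hw
    have h1 : |(w - s).re| ≤ s.re/2 := (Complex.abs_re_le_norm _).trans (by simpa [dist_eq_norm] using hw)
    have := (abs_le.mp h1).1
    simp only [sub_re] at this
    simp only [mem_ofPred_eq]; linarith
  have ha := (GammaSeq_tendsto_Gamma ((s.re/2:ℝ):ℂ)).norm.eventually (ge_mem_nhds (lt_add_one _))
  have hb := (GammaSeq_tendsto_Gamma ((2*s.re:ℝ):ℂ)).norm.eventually (ge_mem_nhds (lt_add_one _))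
  have key := deriv_tendsto_of_bdd (F := fun n z => GammaSeq z n) (G := Gamma) (c := s) (r := s.re/2)
    (M := (‖Gamma ((s.re/2:ℝ):ℂ)‖ + 1) + (‖Gamma ((2*s.re:ℝ):ℂ)‖ + 1)) hU (by linarith) hball ?_ ?_ ?_
    (fun w _ => GammaSeq_tendsto_Gamma w)
  · have := key.div (GammaSeq_tendsto_Gamma s) (Gamma_ne_zero_of_re_pos hs)
    refine this.congr' ?_
    filter_upwards [eventually_ne_atTop 0, (GammaSeq_tendsto_Gamma s).eventually_ne (Gamma_ne_zero_of_re_pos hs)] with n hn hne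
    simp only [Pi.div_apply]
    rw [(logDeriv_GammaSeq hs hn).1]
    field_simp
  · filter_upwards [eventually_ne_atTop 0] with n hn z hz
    exact (logDeriv_GammaSeq hz hn).2.differentiableWithinAt
  · intro z hz
    refine (differentiableAt_Gamma _ fun m h => ?_).differentiableWithinAt
    have : 0 < z.re := hz
    rw [h] at this; simp at this
    have h0 : (0:ℝ) ≤ m := by positivity
    linarith
  · filter_upwards [ha, hb, eventually_ne_atTop 0] with n h1 h2 hn w hw
    have h3 : |(w - s).re| ≤ s.re/2 := (Complex.abs_re_le_norm _).trans (by simpa [dist_eq_norm] using hw)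
    have := (abs_le.mp h3).1
    have := (abs_le.mp h3).2
    simp only [sub_re] at *
    refine (norm_GammaSeq_le (a := s.re/2) (b := 2*s.re) (by linarith) (by linarith) (by linarith) hn).trans (add_le_add h1 h2)

lemma frac_diff_le {a b t j : ℝ} (hj : 0 ≤ j) (ha : j ≤ a) (ha' : a ≤ j+1) (hb : j ≤ b) (hb' : b ≤ j+1) (ht : 1 ≤ t) :
    |a/(a^2+t^2) - b/(b^2+t^2)| ≤ 1/(j^2+1) := by
  have hA : 0 < a^2+t^2 := by positivity
  have hB : 0 < b^2+t^2 := by positivity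
  have e : a/(a^2+t^2) - b/(b^2+t^2) = (t^2-a*b)*(a-b)/((a^2+t^2)*(b^2+t^2)) := by
    field_simp; ring
  rw [e, abs_div, abs_mul, abs_of_pos (mul_pos hA hB), div_le_div_iff₀ (mul_pos hA hB) (by positivity)]
  have h1 : |a-b| ≤ 1 := abs_le.mpr ⟨by linarith, by linarith⟩
  have h2 : |t^2-a*b| ≤ t^2+a*b := abs_le.mpr ⟨by nlinarith [mul_nonneg (hj.trans ha) (hj.trans hb)], by nlinarith [mul_nonneg (hj.trans ha) (hj.trans hb)]⟩
  have h3 : j^2+1 ≤ t^2 + a*b := by nlinarith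
  have h4 : (t^2+a*b)*(t^2+a*b) ≤ (a^2+t^2)*(b^2+t^2) := by nlinarith [mul_nonneg (sq_nonneg t) (sq_nonneg (a-b))]
  calc |t^2-a*b| * |a-b| * (j^2+1) ≤ (t^2+a*b)*1*(t^2+a*b) := by
        have h5 : 0 ≤ t^2+a*b := by nlinarith
        refine mul_le_mul (mul_le_mul h2 h1 (abs_nonneg _) h5) h3 (by positivity) (by simpa using h5)
    _ ≤ _ := by linarith

lemma digamma_re_bound : ∃ C : ℝ, ∀ σ t : ℝ, 0 < σ → σ ≤ 1 → 1 ≤ t →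
    |(deriv Gamma (σ + t * I) / Gamma (σ + t * I)).re - Real.log t| ≤ C := by
  have hsum : Summable fun j : ℕ => 1/((j:ℝ)^2+1) := by
    refine Summable.of_nonneg_of_le (fun j => by positivity) (fun j => ?_) ((summable_nat_add_iff 1).mpr (Real.summable_one_div_nat_pow.mpr one_lt_two)|>.mul_left 2)
    rw [mul_one_div, div_le_div_iff₀ (by positivity) (by positivity)]
    push_cast; nlinarith [sq_nonneg ((j:ℝ)-1)]
  refine ⟨∑' j : ℕ, 1/((j:ℝ)^2+1), fun σ t hσ hσ1 ht => ?_⟩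
  have hlim := digamma_tendsto (s := σ + t*I) (by simpa using hσ)
  have hlim2 := (Complex.continuous_re.tendsto _).comp hlim
  have hphi : Tendsto (fun n : ℕ => Real.log n - (1/2)*Real.log (((n:ℝ)+1)^2+t^2)) atTop (𝓝 0) := by
    have h1 : Tendsto (fun n : ℕ => (-(1/2:ℝ)) * Real.log ((1+1/(n:ℝ))^2 + t^2*(1/(n:ℝ))^2)) atTop (𝓝 0) := by
      have h0 := tendsto_one_div_atTop_nhds_zero_nat (𝕜 := ℝ)
      have : Tendsto (fun n : ℕ => ((1+1/(n:ℝ))^2 + t^2*(1/(n:ℝ))^2)) atTop (𝓝 ((1+0)^2+t^2*0^2)) := 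
        ((h0.const_add 1).pow 2).add ((h0.pow 2).const_mul _)
      have h2 := (this.log (by norm_num)).const_mul (-(1/2:ℝ))
      simpa using h2
    refine h1.congr' ?_
    filter_upwards [eventually_gt_atTop 0] with n hn
    have hn' : (0:ℝ) < n := by exact_mod_cast hn
    have : ((1+1/(n:ℝ))^2 + t^2*(1/(n:ℝ))^2) = (((n:ℝ)+1)^2+t^2)/(n:ℝ)^2 := by field_simp
    rw [this, Real.log_div (by positivity) (by positivity), Real.log_pow]; push_cast; ring
  have hd := (hlim2.sub hphi).sub_const (Real.log t)
  rw [sub_zero] at hd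
  refine le_of_tendsto hd.abs (Eventually.of_forall fun n => ?_)
  have hre : ∀ j : ℕ, (1/((σ:ℂ) + t*I + j)).re = (σ+j)/((σ+j)^2+t^2) := by
    intro j
    rw [one_div, Complex.inv_re]
    simp [Complex.normSq_apply]; ring
  have e1 : ((Complex.re ∘ fun n : ℕ => (Real.log n - ∑ j ∈ Finset.range (n+1), 1 / ((σ:ℂ) + t*I + j) : ℂ)) n) = Real.log n - ∑ j ∈ Finset.range (n+1), (σ+j)/((σ+j)^2+t^2) := by
    simp only [Function.comp, sub_re, ofReal_re, Complex.re_sum, hre]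
  rw [e1]
  set φ : ℕ → ℝ := fun j => (1/2)*Real.log ((j:ℝ)^2+t^2) with hφ
  have htel : ∑ j ∈ Finset.range (n+1), (φ (j+1) - φ j) = φ (n+1) - φ 0 := Finset.sum_range_sub φ (n+1)
  have hφ0 : φ 0 = Real.log t := by
    simp [hφ, Real.log_pow]
  have e2 : Real.log n - ∑ j ∈ Finset.range (n+1), (σ+j)/((σ+j)^2+t^2) - (Real.log n - (1/2)*Real.log (((n:ℝ)+1)^2+t^2)) - Real.log t
     = ∑ j ∈ Finset.range (n+1), ((φ (j+1) - φ j) - (σ+j)/((σ+j)^2+t^2)) := by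
    rw [Finset.sum_sub_distrib, htel, hφ0]; simp [hφ]; ring
  rw [e2]
  refine (Finset.abs_sum_le_sum_abs _ _).trans (le_trans ?_ (hsum.sum_le_tsum (Finset.range (n+1)) fun j _ => by positivity))
  refine Finset.sum_le_sum fun j _ => ?_
  have hder : ∀ x : ℝ, HasDerivAt (fun x : ℝ => (1/2)*Real.log (x^2+t^2)) (x/(x^2+t^2)) x := by
    intro x
    have := (((hasDerivAt_id x).pow 2).add_const (t^2)).log (by simp; positivity)
    refine (this.const_mul (1/2)).congr_deriv ?_
    simp only [id_eq, Nat.cast_ofNat]; field_simp; norm_num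
    exact mul_div_cancel_right₀ _ (by positivity)
  obtain ⟨ξ, hξ, hξe⟩ := exists_hasDerivAt_eq_slope (fun x : ℝ => (1/2)*Real.log (x^2+t^2)) (fun x => x/(x^2+t^2)) (a := (j:ℝ)) (b := j+1) (by linarith)
    (fun x _ => (hder x).continuousAt.continuousWithinAt) (fun x _ => hder x)
  have : φ (j+1) - φ j = ξ/(ξ^2+t^2) := by
    rw [hξe]; simp [hφ]
  rw [this]
  exact frac_diff_le (by positivity) hξ.1.le hξ.2.le (by linarith) (by linarith) ht

end

section

/-- The alternating zeta function. -/
noncomputable def eZ (s : ℂ) : ℂ := - HurwitzZeta.expZeta (((1/2:ℝ)) : UnitAddCircle) s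

lemma eZ_diff : Differentiable ℂ eZ := by
  refine (HurwitzZeta.differentiable_expZeta_of_ne_zero ?_).neg
  intro h
  rw [AddCircle.coe_eq_zero_iff] at h
  obtain ⟨n, hn⟩ := h
  simp only [zsmul_eq_mul, mul_one] at hn
  have h2 : ((2 * n : ℤ) : ℝ) = ((1 : ℤ) : ℝ) := by push_cast; rw [hn]; norm_num
  have := Int.cast_injective h2
  omega

lemma eZ_hasSum {s : ℂ} (hs : 1 < s.re) :
    HasSum (fun n : ℕ => (-1:ℂ)^(n+1) * (n:ℂ)^(-s)) (eZ s) := by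
  have h := (HurwitzZeta.hasSum_expZeta_of_one_lt_re (1/2) hs).neg
  refine h.congr_fun fun n => ?_
  have : cexp (2 * Real.pi * I * ((1/2:ℝ):ℂ) * n) = (-1)^n := by
    rw [← Complex.exp_pi_mul_I, ← Complex.exp_nat_mul]
    congr 1; push_cast; ring
  rw [this, Complex.cpow_neg, pow_succ]
  ring

lemma cpow_diff_le {a : ℝ} (ha : 0 < a) {s : ℂ} (hs : 0 < s.re) :
    ‖((a:ℝ):ℂ)^(-s) - ((a+1:ℝ):ℂ)^(-s)‖ ≤ ‖s‖ * a^(-s.re-1) := by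
  have hd : ∀ x ∈ Icc a (a+1), HasDerivWithinAt (fun x : ℝ => (x:ℂ)^(-s)) (-s * (x:ℂ)^(-s-1)) (Icc a (a+1)) x := by
    intro x hx
    have hx0 : 0 < x := lt_of_lt_of_le ha hx.1
    have := hasDerivAt_ofReal_cpow_const' (x := x) (r := -s-1) hx0.ne' (by
      intro h; have := congrArg Complex.re h; simp at this; linarith)
    have hne : -s-1+1 ≠ 0 := by
      intro h; have := congrArg Complex.re h; simp at this; linarith
    have h2 := this.const_mul (-s-1+1)
    have e : (fun y : ℝ => (-s-1+1) * ((y:ℂ)^(-s-1+1) / (-s-1+1))) = fun y : ℝ => (y:ℂ)^(-s) := by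
      funext y; rw [mul_div_cancel₀ _ hne]; congr 1; ring
    rw [e] at h2
    refine h2.hasDerivWithinAt.congr_deriv ?_
    ring
  have := Convex.norm_image_sub_le_of_norm_hasDerivWithin_le (C := ‖s‖ * a^(-s.re-1)) hd ?_ (convex_Icc a (a+1))
    (right_mem_Icc.mpr (by linarith)) (left_mem_Icc.mpr (by linarith))
  · simpa using this
  · intro x hx
    have hx0 : 0 < x := lt_of_lt_of_le ha hx.1
    rw [norm_mul, norm_neg, Complex.norm_cpow_eq_rpow_re_of_pos hx0]
    refine mul_le_mul_of_nonneg_left ?_ (norm_nonneg _)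
    simp only [sub_re, neg_re, one_re]
    exact Real.rpow_le_rpow_of_nonpos ha hx.1 (by linarith)

/-- grouped terms -/
noncomputable def eT (k : ℕ) (s : ℂ) : ℂ := ((2*k+1:ℝ):ℂ)^(-s) - ((2*k+2:ℝ):ℂ)^(-s)

lemma eT_norm (k : ℕ) {s : ℂ} (hs : 0 < s.re) : ‖eT k s‖ ≤ ‖s‖ * ((k:ℝ)+1)^(-s.re-1) := by
  have := cpow_diff_le (a := 2*k+1) (by positivity) hs
  have e : (2*(k:ℝ)+1+1) = 2*k+2 := by ring
  rw [e] at this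
  refine this.trans (mul_le_mul_of_nonneg_left ?_ (norm_nonneg _))
  refine Real.rpow_le_rpow_of_nonpos (by positivity) ?_ (by linarith)
  have : (0:ℝ) ≤ k := by positivity
  linarith

lemma summable_shift_rpow {σ : ℝ} (hσ : 0 < σ) : Summable fun k : ℕ => ((k:ℝ)+1)^(-σ-1) := by
  have := (summable_nat_add_iff 1).mpr (Real.summable_nat_rpow (p := -σ-1) |>.mpr (by linarith))
  simpa using this

lemma eT_diff (k : ℕ) : Differentiable ℂ (eT k) := by
  intro s
  unfold eT
  have h1 : ((2*k+1:ℝ):ℂ) ≠ 0 := by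
    have : (2*k+1:ℝ) ≠ 0 := by positivity
    exact_mod_cast this
  have h2 : ((2*k+2:ℝ):ℂ) ≠ 0 := by
    have : (2*k+2:ℝ) ≠ 0 := by positivity
    exact_mod_cast this
  exact (differentiableAt_id.neg.const_cpow (Or.inl h1)).sub (differentiableAt_id.neg.const_cpow (Or.inl h2))

lemma eTsum_diff : DifferentiableOn ℂ (fun s => ∑' k, eT k s) {s | 0 < s.re} := by
  intro s hs
  have hs' : 0 < s.re := hs
  set U : Set ℂ := {w | s.re/2 < w.re} ∩ Metric.ball 0 (‖s‖+1) with hU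
  have hUo : IsOpen U := (isOpen_lt continuous_const Complex.continuous_re).inter Metric.isOpen_ball
  have hsU : s ∈ U := ⟨by simp; linarith, by simp⟩
  have := differentiableOn_tsum_of_summable_norm (u := fun k : ℕ => (‖s‖+1) * ((k:ℝ)+1)^(-(s.re/2)-1))
    ((summable_shift_rpow (by linarith)).mul_left _) (F := eT) (U := U)
    (fun k => (eT_diff k).differentiableOn) hUo ?_
  · exact (this.differentiableAt (hUo.mem_nhds hsU)).differentiableWithinAt
  · intro k w hw
    have h1 : s.re/2 < w.re := hw.1
    have h2 : ‖w‖ < ‖s‖+1 := by simpa using hw.2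
    refine (eT_norm k (by linarith)).trans ?_
    have : ((k:ℝ)+1)^(-w.re-1) ≤ ((k:ℝ)+1)^(-(s.re/2)-1) :=
      Real.rpow_le_rpow_of_exponent_le (by simp) (by linarith)
    gcongr

lemma partial_group (K : ℕ) {s : ℂ} (hs : s ≠ 0) :
    ∑ n ∈ Finset.range (2*K+1), (-1:ℂ)^(n+1) * (n:ℂ)^(-s) = ∑ k ∈ Finset.range K, eT k s := by
  induction K with
  | zero => simp [hs]
  | succ K ih =>
    rw [show 2*(K+1)+1 = (2*K+1)+1+1 by ring, Finset.sum_range_succ, Finset.sum_range_succ, ih, Finset.sum_range_succ, add_assoc]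
    congr 1
    unfold eT
    push_cast
    have : (-1:ℂ)^(2*K+1+1) = 1 := by rw [show 2*K+1+1=2*(K+1) by ring, pow_mul]; simp
    have h2 : (-1:ℂ)^(2*K+1+1+1) = -1 := by rw [pow_succ, this]; simp
    rw [this, h2]; ring

lemma eT_summable {s : ℂ} (hs : 0 < s.re) : Summable fun k => eT k s :=
  Summable.of_norm_bounded ((summable_shift_rpow hs).mul_left ‖s‖) fun k => eT_norm k hs

lemma eZ_eq_of_one_lt {s : ℂ} (hs : 1 < s.re) : eZ s = ∑' k, eT k s := by
  have hs0 : s ≠ 0 := by rintro rfl; simp at hs; linarith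
  have h1 := (eZ_hasSum hs).tendsto_sum_nat
  have h2 : Tendsto (fun K : ℕ => 2*K+1) atTop atTop :=
    tendsto_atTop_mono (fun K => by simp only [id]; omega) tendsto_id
  have h3 := h1.comp h2
  have h4 : Tendsto (fun K : ℕ => ∑ k ∈ Finset.range K, eT k s) atTop (𝓝 (eZ s)) :=
    h3.congr fun K => partial_group K hs0
  exact tendsto_nhds_unique h4 (eT_summable (by linarith)).hasSum.tendsto_sum_nat

lemma isOpen_rhp : IsOpen {s : ℂ | 0 < s.re} := isOpen_lt continuous_const Complex.continuous_re

lemma eZ_eq {s : ℂ} (hs : 0 < s.re) : eZ s = ∑' k, eT k s := by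
  have hA : AnalyticOnNhd ℂ eZ {s | 0 < s.re} := eZ_diff.differentiableOn.analyticOnNhd isOpen_rhp
  have hB : AnalyticOnNhd ℂ (fun s => ∑' k, eT k s) {s | 0 < s.re} := eTsum_diff.analyticOnNhd isOpen_rhp
  refine hA.eqOn_of_preconnected_of_eventuallyEq hB (convex_halfSpace_re_gt 0).isPreconnected (z₀ := 2) (by simp) ?_ hs
  have : {s : ℂ | 1 < s.re} ∈ 𝓝 (2:ℂ) := (isOpen_lt continuous_const Complex.continuous_re).mem_nhds (by simp)
  filter_upwards [this] with w hw
  exact eZ_eq_of_one_lt hw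

lemma eZ_approx : ∃ C : ℝ, 1 ≤ C ∧ ∀ (K : ℕ) (s : ℂ), 1/2 ≤ s.re →
    ‖eZ s - ∑ n ∈ Finset.range (2*K+1), (-1:ℂ)^(n+1) * (n:ℂ)^(-s)‖ ≤ C * ‖s‖ * ((K:ℝ)+1)^(-(1/4):ℝ) := by
  have hS := summable_shift_rpow (σ := 1/4) (by norm_num)
  refine ⟨max 1 (∑' k : ℕ, ((k:ℝ)+1)^(-(1/4)-1:ℝ)), le_max_left _ _, fun K s hs => ?_⟩
  have hs0 : s ≠ 0 := by rintro rfl; simp at hs; linarith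
  have hsum := eT_summable (s := s) (by linarith)
  rw [partial_group K hs0, eZ_eq (by linarith), ← hsum.sum_add_tsum_nat_add K, add_sub_cancel_left]
  have hb : ∀ k : ℕ, ‖eT (k+K) s‖ ≤ (‖s‖ * ((K:ℝ)+1)^(-(1/4):ℝ)) * ((k:ℝ)+1)^(-(1/4)-1:ℝ) := by
    intro k
    refine (eT_norm (k+K) (by linarith)).trans ?_
    rw [mul_assoc]
    refine mul_le_mul_of_nonneg_left ?_ (norm_nonneg _)
    push_cast
    have hk : (0:ℝ) ≤ k := by positivity
    have hK : (0:ℝ) ≤ K := by positivity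
    calc ((k:ℝ)+K+1)^(-s.re-1) ≤ ((k:ℝ)+K+1)^(-(1/4) + (-(1/4)-1):ℝ) :=
          Real.rpow_le_rpow_of_exponent_le (by linarith) (by linarith)
      _ = ((k:ℝ)+K+1)^(-(1/4):ℝ) * ((k:ℝ)+K+1)^(-(1/4)-1:ℝ) := Real.rpow_add (by positivity) _ _
      _ ≤ _ := by
        refine mul_le_mul (Real.rpow_le_rpow_of_nonpos (by positivity) (by linarith) (by norm_num))
          (Real.rpow_le_rpow_of_nonpos (by positivity) (by linarith) (by norm_num)) (by positivity) (by positivity)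
  refine (tsum_of_norm_bounded (hS.mul_left _).hasSum hb).trans ?_
  rw [tsum_mul_left]
  have := le_max_right 1 (∑' k : ℕ, ((k:ℝ)+1)^(-(1/4)-1:ℝ))
  calc ‖s‖ * ((K:ℝ)+1)^(-(1/4):ℝ) * (∑' k : ℕ, ((k:ℝ)+1)^(-(1/4)-1:ℝ)) ≤ ‖s‖ * ((K:ℝ)+1)^(-(1/4):ℝ) * max 1 (∑' k : ℕ, ((k:ℝ)+1)^(-(1/4)-1:ℝ)) := by gcongr
    _ = _ := by ring

lemma eZ_growth : ∃ C : ℝ, 1 ≤ C ∧ ∀ (s : ℂ), 1/2 ≤ s.re → ‖eZ s‖ ≤ C * ‖s‖ := by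
  obtain ⟨C, hC, h⟩ := eZ_approx
  refine ⟨C, hC, fun s hs => ?_⟩
  have hs0 : s ≠ 0 := by rintro rfl; simp at hs; linarith
  have := h 0 s hs
  simpa [hs0] using this

lemma eZ_zeta_of_one_lt {s : ℂ} (hs : 1 < s.re) : eZ s = (1 - 2^(1-s)) * riemannZeta s := by
  have hs0 : s ≠ 0 := by rintro rfl; simp at hs; linarith
  have hz : HasSum (fun n : ℕ => (n:ℂ)^(-s)) (riemannZeta s) := by
    have h0 : Summable fun n : ℕ => (n:ℂ)^(-s) := by
      have := Complex.summable_one_div_nat_cpow.mpr hs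
      refine this.congr fun n => ?_
      rw [cpow_neg, one_div]
    have := h0.hasSum
    rwa [show ∑' n : ℕ, (n:ℂ)^(-s) = riemannZeta s by
      rw [zeta_eq_tsum_one_div_nat_cpow hs]; congr 1; funext n; rw [cpow_neg, one_div]] at this
  -- even/odd decomposition
  have heven : HasSum (fun k : ℕ => ((2*k:ℕ):ℂ)^(-s)) (2^(-s) * riemannZeta s) := by
    refine (hz.mul_left (2^(-s))).congr_fun fun k => ?_
    have := Complex.mul_cpow_ofReal_nonneg (a := 2) (b := k) (by norm_num) (by positivity) (-s)
    push_cast at this ⊢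
    exact this
  have hinj : Function.Injective (fun k : ℕ => 2*k) := fun a b h => by simpa using h
  have hodd : ∑' k : ℕ, ((2*k+1:ℕ):ℂ)^(-s) + 2^(-s) * riemannZeta s = riemannZeta s := by
    have := tsum_even_add_odd (f := fun n : ℕ => (n:ℂ)^(-s)) heven.summable
      (hz.summable.comp_injective (i := fun k : ℕ => 2*k+1) fun a b h => by simpa using h)
    rw [heven.tsum_eq, hz.tsum_eq] at this
    rw [add_comm]; exact this
  have h2 := eZ_hasSum hs
  have e2 := tsum_even_add_odd (f := fun n : ℕ => (-1:ℂ)^(n+1) * (n:ℂ)^(-s))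
      (h2.summable.comp_injective (i := fun k : ℕ => 2*k) hinj)
      (h2.summable.comp_injective (i := fun k : ℕ => 2*k+1) fun a b h => by simpa using h)
  rw [h2.tsum_eq] at e2
  have e3 : ∑' k : ℕ, (-1:ℂ)^(2*k+1) * ((2*k:ℕ):ℂ)^(-s) = - (2^(-s) * riemannZeta s) := by
    rw [← heven.tsum_eq, ← tsum_neg]
    congr 1; funext k
    rw [pow_succ, pow_mul]; simp
  have e4 : ∑' k : ℕ, (-1:ℂ)^(2*k+1+1) * ((2*k+1:ℕ):ℂ)^(-s) = ∑' k : ℕ, ((2*k+1:ℕ):ℂ)^(-s) := by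
    congr 1; funext k
    rw [show 2*k+1+1=2*(k+1) by ring, pow_mul]; simp
  rw [e3, e4] at e2
  have e5 : (2:ℂ)^(1-s) = 2 * 2^(-s) := by
    rw [sub_eq_add_neg, cpow_add _ _ two_ne_zero, cpow_one]
  rw [e5, ← e2]
  linear_combination hodd

lemma eZ_zeta {s : ℂ} (hs : s ≠ 1) : eZ s = (1 - 2^(1-s)) * riemannZeta s := by
  have hA : AnalyticOnNhd ℂ (fun s => (s-1) * eZ s) univ :=
    (((differentiable_id.sub_const 1).mul eZ_diff).differentiableOn).analyticOnNhd isOpen_univ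
  have hB : AnalyticOnNhd ℂ (fun s => (1 - 2^(1-s)) * riemannZeta₁ s) univ := by
    refine DifferentiableOn.analyticOnNhd (Differentiable.differentiableOn ?_) isOpen_univ
    refine Differentiable.mul ?_ differentiable_riemannZeta₁
    exact fun z => ((differentiableAt_id.const_sub 1).const_cpow (Or.inl two_ne_zero)).const_sub 1
  have := hA.eqOn_of_preconnected_of_eventuallyEq hB isPreconnected_univ (z₀ := 2) (by simp) ?_ (mem_univ s)
  · have h1 : s - 1 ≠ 0 := sub_ne_zero.mpr hs
    simp only at this
    rw [riemannZeta_eq_inv_sub_mul hs]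
    field_simp
    linear_combination this
  · have : {s : ℂ | 1 < s.re} ∈ 𝓝 (2:ℂ) := (isOpen_lt continuous_const Complex.continuous_re).mem_nhds (by simp)
    filter_upwards [this] with w hw
    have hw1 : w ≠ 1 := by rintro rfl; simp at hw
    have h1 : w - 1 ≠ 0 := sub_ne_zero.mpr hw1
    rw [eZ_zeta_of_one_lt hw, riemannZeta_eq_inv_sub_mul hw1]
    field_simp

end

section

open scoped ComplexConjugate

noncomputable def gP (s : ℂ) : ℂ := deriv Gammaℝ s / Gammaℝ s

lemma Gammaℝ_diffAt {s : ℂ} (hs : 0 < s.re) : DifferentiableAt ℂ Gammaℝ s := by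
  have := differentiable_Gammaℝ_inv.differentiableAt (x := s)
  have h2 := this.inv (by simpa using Gammaℝ_ne_zero_of_re_pos hs)
  have e : (fun s => (Gammaℝ s)⁻¹)⁻¹ = Gammaℝ := by funext z; simp
  rwa [e] at h2

lemma gP_eq {s : ℂ} (hs : 0 < s.re) :
    gP s = -(1/2) * Real.log Real.pi + (1/2) * (deriv Gamma (s/2) / Gamma (s/2)) := by
  have hpi : (Real.pi:ℂ) ≠ 0 := by exact_mod_cast Real.pi_ne_zero
  have hG : Gamma (s/2) ≠ 0 := Gamma_ne_zero_of_re_pos (by simpa using hs)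
  have h1 : HasDerivAt (fun z : ℂ => (Real.pi:ℂ)^(-z/2)) ((Real.pi:ℂ)^(-s/2) * Complex.log Real.pi * (-1/2)) s :=
    ((hasDerivAt_id s).neg.div_const 2).const_cpow (Or.inl hpi)
  have h2 : HasDerivAt Gamma (deriv Gamma (s/2)) (s/2) := by
    refine (differentiableAt_Gamma _ fun m h => ?_).hasDerivAt
    have : 0 < (s/2).re := by simpa using hs
    rw [h] at this; simp at this
    have h0 : (0:ℝ) ≤ m := by positivity
    linarith
  have h3 : HasDerivAt (fun z : ℂ => Gamma (z/2)) (deriv Gamma (s/2) * (1/2)) s := by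
    have := HasDerivAt.comp s h2 ((hasDerivAt_id s).div_const 2)
    exact this
  have h4 : HasDerivAt Gammaℝ _ s := h1.mul h3
  unfold gP
  rw [h4.deriv, Gammaℝ_def, Complex.ofReal_log Real.pi_pos.le]
  have : (Real.pi:ℂ)^(-s/2) ≠ 0 := by simp [cpow_eq_zero_iff, hpi]
  field_simp

lemma gP_re_bound : ∃ C : ℝ, 1 ≤ C ∧ ∀ σ t : ℝ, 0 < σ → σ ≤ 2 → 2 ≤ t →
    |(gP (σ + t * I)).re - (1/2) * Real.log t| ≤ C := by
  obtain ⟨C, hC⟩ := digamma_re_bound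
  refine ⟨1 + |C| + |Real.log Real.pi| + |Real.log 2|, by
    linarith [abs_nonneg C, abs_nonneg (Real.log Real.pi), abs_nonneg (Real.log 2)], fun σ t h1 h2 ht => ?_⟩
  have := hC (σ/2) (t/2) (by linarith) (by linarith) (by linarith)
  rw [gP_eq (by simpa using h1)]
  rw [show ((σ:ℂ) + t*I)/2 = ((σ/2:ℝ):ℂ) + ((t/2:ℝ):ℂ)*I by push_cast; ring]
  rw [Real.log_div (by linarith) (by norm_num)] at this
  set D := deriv Gamma (((σ/2:ℝ):ℂ) + ((t/2:ℝ):ℂ)*I) / Gamma (((σ/2:ℝ):ℂ) + ((t/2:ℝ):ℂ)*I)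
  have e : (-(1/2) * (Real.log Real.pi:ℂ) + (1/2) * D).re = -(1/2) * Real.log Real.pi + (1/2) * D.re := by
    have : (-(1/2) * (Real.log Real.pi:ℂ) + (1/2) * D) = ((-(1/2) * Real.log Real.pi : ℝ):ℂ) + ((1/2:ℝ):ℂ) * D := by push_cast; ring
    rw [this, add_re, re_ofReal_mul, ofReal_re]
  rw [e]
  have h5 := abs_le.mp this
  have h6 := neg_abs_le (Real.log Real.pi)
  have h7 := le_abs_self (Real.log Real.pi)
  have h8 := neg_abs_le (Real.log 2)
  have h9 := le_abs_self (Real.log 2)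
  have h10 := le_abs_self C
  have h11 := neg_abs_le C
  rw [abs_le]; constructor <;> linarith [h5.1, h5.2]

lemma gP_cont : ContinuousOn gP {s | 0 < s.re} := by
  have hd : DifferentiableOn ℂ Gammaℝ {s | 0 < s.re} := fun s hs => (Gammaℝ_diffAt hs).differentiableWithinAt
  exact (hd.deriv isOpen_rhp).continuousOn.div hd.continuousOn fun s hs => Gammaℝ_ne_zero_of_re_pos hs

/-- transport along a segment -/
lemma Gammaℝ_segment {s d : ℂ} {J : Set ℝ} (hJ : Convex ℝ J) (hJo : IsOpen J) (h0 : 0 ∈ J)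
    (h : ∀ v ∈ J, 0 < (s + v * d).re) {u : ℝ} (hu : u ∈ J) :
    Gammaℝ (s + u * d) = Gammaℝ s * cexp (∫ v in (0:ℝ)..u, d * gP (s + v * d)) := by
  have hc : ContinuousOn (fun v : ℝ => d * gP (s + v * d)) J :=
    continuousOn_const.mul (gP_cont.comp (by fun_prop) h)
  have hsub : ∀ {v}, v ∈ J → uIcc 0 v ⊆ J := fun hv => hJ.ordConnected.uIcc_subset h0 hv
  have hder : ∀ v ∈ J, HasDerivAt (fun v : ℝ => Gammaℝ (s + v * d) * cexp (-∫ w in (0:ℝ)..v, d * gP (s + w * d))) 0 v := by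
    intro v hv
    have h1 : HasDerivAt (fun v : ℝ => ∫ w in (0:ℝ)..v, d * gP (s + w * d)) (d * gP (s + v * d)) v := by
      refine intervalIntegral.integral_hasDerivAt_right (ContinuousOn.intervalIntegrable (hc.mono (hsub hv))) ?_ (hc.continuousAt (hJo.mem_nhds hv))
      exact hc.stronglyMeasurableAtFilter hJo v hv
    have h2 : HasDerivAt (fun v : ℝ => Gammaℝ (s + v * d)) (deriv Gammaℝ (s + v*d) * d) v := by
      have ha : HasDerivAt (fun v : ℝ => s + v * d) d v := by
        have := ((Complex.ofRealCLM.hasDerivAt (x := v)).mul_const d).const_add s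
        simpa using this
      exact HasDerivAt.comp v (Gammaℝ_diffAt (h v hv)).hasDerivAt ha
    refine (h2.mul h1.neg.cexp).congr_deriv ?_
    have := Gammaℝ_ne_zero_of_re_pos (h v hv)
    unfold gP
    simp only [Pi.neg_apply]
    field_simp
    ring
  have hconst := hJ.is_const_of_fderivWithin_eq_zero (𝕜 := ℝ) (f := fun v : ℝ => Gammaℝ (s + v * d) * cexp (-∫ w in (0:ℝ)..v, d * gP (s + w * d)))
    (fun v hv => (hder v hv).differentiableAt.differentiableWithinAt) (fun v hv => by
      rw [fderivWithin_of_isOpen hJo hv, (hder v hv).hasFDerivAt.fderiv]; ext; simp) hu h0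
  simp only [ofReal_zero, zero_mul, add_zero, intervalIntegral.integral_same, neg_zero, Complex.exp_zero, mul_one] at hconst
  rw [← hconst, mul_assoc, ← Complex.exp_add]
  simp

lemma Gammaℝ_ratio : ∃ C : ℝ, 1 ≤ C ∧ ∀ x t : ℝ, 0 ≤ x → x ≤ 1/4 → 2 ≤ t →
    ‖Gammaℝ ((1/2 + x : ℝ) + t * I)‖ ≤ Real.exp (x * (Real.log t + C)) * ‖Gammaℝ ((1/2 - x : ℝ) + t * I)‖ := by
  obtain ⟨C, hC, h⟩ := gP_re_bound
  refine ⟨2*C, by linarith, fun x t hx0 hx ht => ?_⟩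
  have hs := Gammaℝ_segment (s := ((1/2 - x : ℝ):ℂ) + t * I) (d := 1) (J := Ioo (-1/4) 1) (convex_Ioo _ _) isOpen_Ioo (by constructor <;> norm_num)
    (fun v hv => by simp at hv ⊢; linarith [hv.1]) (u := 2*x) (by constructor <;> linarith)
  have e : ((1/2 - x : ℝ):ℂ) + t * I + ((2*x:ℝ):ℂ) * 1 = ((1/2 + x : ℝ):ℂ) + t * I := by push_cast; ring
  rw [e] at hs
  rw [hs, norm_mul, mul_comm, Complex.norm_exp]
  refine mul_le_mul_of_nonneg_right ?_ (norm_nonneg _)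
  rw [Real.exp_le_exp]
  have hcont : ContinuousOn (fun v : ℝ => (1:ℂ) * gP (((1/2 - x : ℝ):ℂ) + t * I + v * 1)) (uIcc 0 (2*x)) := by
    refine continuousOn_const.mul (gP_cont.comp (by fun_prop) fun v hv => ?_)
    rw [uIcc_of_le (by linarith)] at hv
    simp; linarith [hv.1]
  have hI := hcont.intervalIntegrable (μ := MeasureTheory.volume)
  have hcomm := Complex.reCLM.intervalIntegral_comp_comm hI
  simp only [Complex.reCLM_apply] at hcomm
  rw [← hcomm]
  have h2 : IntervalIntegrable (fun v : ℝ => ((1:ℂ) * gP (((1/2 - x : ℝ):ℂ) + t * I + v * 1)).re) MeasureTheory.volume 0 (2*x) :=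
    (Complex.continuous_re.comp_continuousOn hcont).intervalIntegrable
  have := intervalIntegral.integral_mono_on (by linarith) h2 (intervalIntegrable_const (c := 1/2 * Real.log t + C)) (fun v hv => by
    have := (abs_le.mp (h (1/2 - x + v) t (by linarith [hv.1]) (by linarith [hv.2]) ht)).2
    have e : ((1/2 - x : ℝ):ℂ) + t * I + v * 1 = ((1/2 - x + v : ℝ):ℂ) + t * I := by push_cast; ring
    rw [one_mul, e]; linarith)
  refine this.trans ?_
  rw [intervalIntegral.integral_const, smul_eq_mul]
  linarith

lemma Gammaℝ_phase : ∃ C : ℝ, 1 ≤ C ∧ ∀ p : ℝ, 4 ≤ p → ∃ φ : ℝ → ℝ, ContinuousOn φ (Icc (-1) 1) ∧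
    (∀ y ∈ Icc (0:ℝ) 1, y * (1/2 * Real.log p - C) ≤ φ y) ∧
    (∀ y ∈ Icc (0:ℝ) 1, φ (-y) ≤ - (y * (1/2 * Real.log p - C))) ∧
    ∀ y ∈ Icc (-1:ℝ) 1, ∃ ρ : ℝ, 0 < ρ ∧
      Gammaℝ (1/2 + ((p + y : ℝ):ℂ) * I) = Gammaℝ (1/2 + (p:ℂ) * I) * (ρ * cexp (φ y * I)) := by
  obtain ⟨C, hC, h⟩ := gP_re_bound
  refine ⟨C + 1, by linarith, fun p hp => ?_⟩
  have hc : Continuous (fun v : ℝ => I * gP (1/2 + (p:ℂ) * I + v * I)) := by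
    refine continuous_const.mul (gP_cont.comp_continuous (by fun_prop) fun v => ?_)
    simp
  have him : ∀ v : ℝ, (I * gP (1/2 + (p:ℂ) * I + v * I)).im = (gP (((1/2:ℝ):ℂ) + ((p+v:ℝ):ℂ) * I)).re := by
    intro v
    rw [show (1/2 + (p:ℂ) * I + v * I) = (((1/2:ℝ):ℂ) + ((p+v:ℝ):ℂ) * I) by push_cast; ring]
    simp
  have hci : Continuous (fun v : ℝ => (I * gP (1/2 + (p:ℂ) * I + v * I)).im) := Complex.continuous_im.comp hc
  have hlow : ∀ v ∈ Icc (-1:ℝ) 1, 1/2 * Real.log p - (C+1) ≤ (I * gP (1/2 + (p:ℂ) * I + v * I)).im := by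
    intro v hv
    rw [him]
    have h1 := (abs_le.mp (h (1/2) (p+v) (by norm_num) (by norm_num) (by linarith [hv.1]))).1
    have h2 : Real.log (p/2) ≤ Real.log (p+v) := Real.log_le_log (by linarith) (by linarith [hv.1])
    rw [Real.log_div (by linarith) (by norm_num)] at h2
    have h3 := Real.log_two_lt_d9
    linarith
  have hcomm : ∀ y : ℝ, (∫ v in (0:ℝ)..y, I * gP (1/2 + (p:ℂ) * I + v * I)).im = ∫ v in (0:ℝ)..y, (I * gP (1/2 + (p:ℂ) * I + v * I)).im := by
    intro y
    have := Complex.imCLM.intervalIntegral_comp_comm (hc.intervalIntegrable (μ := MeasureTheory.volume) 0 y)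
    simp only [Complex.imCLM_apply] at this
    exact this.symm
  refine ⟨fun y => (∫ v in (0:ℝ)..y, I * gP (1/2 + (p:ℂ) * I + v * I)).im, ?_, ?_, ?_, ?_⟩
  · refine (Complex.continuous_im.comp ?_).continuousOn
    exact intervalIntegral.continuous_primitive (fun a b => hc.intervalIntegrable a b) 0
  · intro y hy
    simp only [hcomm]
    have := intervalIntegral.integral_mono_on hy.1 (intervalIntegrable_const (μ := MeasureTheory.volume) (c := 1/2 * Real.log p - (C+1))) (hci.intervalIntegrable 0 y)
      (fun v hv => hlow v ⟨by linarith [hv.1], by linarith [hv.2, hy.2]⟩)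
    refine le_trans (le_of_eq ?_) this
    rw [intervalIntegral.integral_const, smul_eq_mul]; ring
  · intro y hy
    simp only [hcomm]
    have := intervalIntegral.integral_mono_on (a := -y) (b := 0) (by linarith [hy.1]) (intervalIntegrable_const (μ := MeasureTheory.volume) (c := 1/2 * Real.log p - (C+1))) (hci.intervalIntegrable (-y) 0)
      (fun v hv => hlow v ⟨by linarith [hv.1, hy.2], by linarith [hv.2, hy.2]⟩)
    rw [intervalIntegral.integral_symm, neg_le_neg_iff]
    refine le_trans (le_of_eq ?_) this
    rw [intervalIntegral.integral_const, smul_eq_mul]; ring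
  · intro y hy
    refine ⟨Real.exp (∫ v in (0:ℝ)..y, I * gP (1/2 + (p:ℂ) * I + v * I)).re, Real.exp_pos _, ?_⟩
    have hs := Gammaℝ_segment (s := 1/2 + (p:ℂ) * I) (d := I) (J := univ) convex_univ isOpen_univ (mem_univ _)
      (fun v hv => by simp) (u := y) (mem_univ _)
    rw [show (1/2 + ((p+y:ℝ):ℂ) * I) = 1/2 + (p:ℂ) * I + y * I by push_cast; ring, hs]
    congr 1
    push_cast
    rw [← Complex.exp_add, Complex.re_add_im]

lemma Gammaℝ_conj' (s : ℂ) : Gammaℝ (conj s) = conj (Gammaℝ s) := by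
  rw [Gammaℝ_def, Gammaℝ_def, map_mul, ← Gamma_conj]
  congr 1
  · have := Complex.cpow_conj (Real.pi:ℂ) (-s/2) (by
      rw [Complex.arg_ofReal_of_nonneg Real.pi_pos.le]; exact Real.pi_pos.ne)
    rw [Complex.conj_ofReal] at this
    rw [← this, map_div₀, Complex.conj_ofNat, map_neg]
  · rw [map_div₀, Complex.conj_ofNat]

lemma completed_eq {s : ℂ} (hs : 0 < s.re) : completedRiemannZeta s = riemannZeta s * Gammaℝ s := by
  have h0 : s ≠ 0 := by rintro rfl; simp at hs
  rw [riemannZeta_def_of_ne_zero h0, div_mul_cancel₀ _ (Gammaℝ_ne_zero_of_re_pos hs)]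

lemma completed_symm {x t : ℝ} (hx : |x| < 1/2) :
    completedRiemannZeta ((1/2 - x : ℝ) + t * I) = conj (completedRiemannZeta ((1/2 + x : ℝ) + t * I)) := by
  have h := abs_lt.mp hx
  rw [← completedRiemannZeta_one_sub]
  have e : (1 - (((1/2 - x : ℝ):ℂ) + t * I)) = conj (((1/2 + x : ℝ):ℂ) + t * I) := by
    apply Complex.ext <;> simp
    ring
  rw [e, completed_eq (by simp; linarith), completed_eq (by simp; linarith), map_mul, riemannZeta_conj, Gammaℝ_conj']

lemma zeta_left : ∃ C : ℝ, 1 ≤ C ∧ ∀ x t : ℝ, 0 ≤ x → x ≤ 1/4 → 2 ≤ t →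
    ‖riemannZeta ((1/2 - x : ℝ) + t * I)‖ ≤ Real.exp (x * (Real.log t + C)) * ‖riemannZeta ((1/2 + x : ℝ) + t * I)‖ := by
  obtain ⟨C, hC, h⟩ := Gammaℝ_ratio
  refine ⟨C, hC, fun x t h0 hx ht => ?_⟩
  have h1 := completed_symm (x := x) (t := t) (by rw [abs_of_nonneg h0]; linarith)
  have h2 := congrArg norm h1
  rw [completed_eq (by simp; linarith), completed_eq (by simp; linarith), RCLike.norm_conj, norm_mul, norm_mul] at h2
  have h3 := h x t h0 hx ht
  have hG : 0 < ‖Gammaℝ ((1/2 - x : ℝ) + t * I)‖ := norm_pos_iff.mpr (Gammaℝ_ne_zero_of_re_pos (by simp; linarith))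
  refine le_of_mul_le_mul_right ?_ hG
  rw [h2]
  calc _ ≤ ‖riemannZeta ((1/2 + x : ℝ) + t * I)‖ * (Real.exp (x * (Real.log t + C)) * ‖Gammaℝ ((1/2 - x : ℝ) + t * I)‖) := by gcongr
    _ = _ := by ring

lemma arc_lemma : ∃ C : ℝ, 1 ≤ C ∧ ∀ p δ : ℝ, 4 ≤ p → 0 < δ → δ ≤ 1 →
    Real.pi / 8 ≤ δ * (1/2 * Real.log p - C) →
    (∀ y ∈ Icc (-δ) δ, riemannZeta (1/2 + ((p+y:ℝ):ℂ) * I) ≠ 0) →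
    ∀ θ : ℝ, |θ - arg (riemannZeta (1/2 + (p:ℂ) * I))| < Real.pi/8 →
    ∃ y ∈ Icc (-δ) δ, ∃ r : ℝ, 0 < r ∧ riemannZeta (1/2 + ((p+y:ℝ):ℂ) * I) = r * cexp (I * θ) := by
  obtain ⟨C, hC, h⟩ := Gammaℝ_phase
  refine ⟨C, hC, fun p δ hp hδ hδ1 hbig hne θ hθ => ?_⟩
  obtain ⟨φ, hφc, hφ1, hφ2, hφ⟩ := h p hp
  set α := arg (riemannZeta (1/2 + (p:ℂ) * I)) with hα
  have hθ' := abs_lt.mp hθ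
  have hsub : Icc (-δ) δ ⊆ Icc (-1:ℝ) 1 := Icc_subset_Icc (by linarith) hδ1
  -- choose y
  have hivt := intermediate_value_Icc (f := φ) (a := -δ) (b := δ) (by linarith) (hφc.mono hsub)
  obtain ⟨y, hy, hye⟩ := hivt (show α - θ ∈ Icc (φ (-δ)) (φ δ) from
    ⟨by linarith [hφ2 δ ⟨hδ.le, hδ1⟩], by linarith [hφ1 δ ⟨hδ.le, hδ1⟩]⟩)
  refine ⟨y, hy, ?_⟩
  -- real function
  have hL : ∀ v : ℝ, (completedRiemannZeta (1/2 + ((p+v:ℝ):ℂ) * I)).im = 0 := by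
    intro v
    have := completed_symm (x := 0) (t := p+v) (by norm_num)
    rw [sub_zero, add_zero] at this
    have h2 := Complex.conj_eq_iff_im.mp this.symm
    rw [← h2]; congr 2; push_cast; rfl
  have hLne : ∀ v ∈ Icc (-δ) δ, (completedRiemannZeta (1/2 + ((p+v:ℝ):ℂ) * I)).re ≠ 0 := by
    intro v hv h0
    have : completedRiemannZeta (1/2 + ((p+v:ℝ):ℂ) * I) = 0 := Complex.ext h0 (hL v)
    rw [completed_eq (by simp), mul_eq_zero] at this
    exact this.elim (hne v hv) (Gammaℝ_ne_zero_of_re_pos (by simp))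
  have hLc : ContinuousOn (fun v : ℝ => (completedRiemannZeta (1/2 + ((p+v:ℝ):ℂ) * I)).re) (Icc (-δ) δ) := by
    refine Complex.continuous_re.comp_continuousOn fun v hv => ?_
    have h1 : v ∈ Icc (-1:ℝ) 1 := hsub hv
    have hd : DifferentiableAt ℂ completedRiemannZeta (1/2 + ((p+v:ℝ):ℂ) * I) := by
      refine differentiableAt_completedZeta ?_ ?_
      · intro h; have := congrArg Complex.re h; simp at this
      · intro h; have := congrArg Complex.re h; norm_num at this
    refine ContinuousAt.continuousWithinAt ?_
    exact ContinuousAt.comp (f := fun v : ℝ => 1/2 + ((p+v:ℝ):ℂ) * I) hd.continuousAt (by fun_prop)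
  have h0mem : (0:ℝ) ∈ Icc (-δ) δ := ⟨by linarith, hδ.le⟩
  have hpos : 0 < (completedRiemannZeta (1/2 + ((p+y:ℝ):ℂ) * I)).re / (completedRiemannZeta (1/2 + ((p+0:ℝ):ℂ) * I)).re := by
    by_contra hneg
    have hpc := isPreconnected_Icc (a := -δ) (b := δ)
    have hA := hLne y hy
    have hB := hLne 0 h0mem
    have hprod : (completedRiemannZeta (1/2 + ((p+y:ℝ):ℂ) * I)).re * (completedRiemannZeta (1/2 + ((p+0:ℝ):ℂ) * I)).re < 0 := by
      rcases lt_or_gt_of_ne hA with ha | ha <;> rcases lt_or_gt_of_ne hB with hb | hb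
      · exact absurd (div_pos_of_neg_of_neg ha hb) hneg
      · exact mul_neg_of_neg_of_pos ha hb
      · exact mul_neg_of_pos_of_neg ha hb
      · exact absurd (div_pos ha hb) hneg
    rcases mul_neg_iff.mp hprod with ⟨ha, hb⟩ | ⟨ha, hb⟩
    · obtain ⟨v, hv, hv0⟩ := hpc.intermediate_value h0mem hy hLc ⟨hb.le, ha.le⟩
      exact hLne v hv hv0
    · obtain ⟨v, hv, hv0⟩ := hpc.intermediate_value hy h0mem hLc ⟨ha.le, hb.le⟩
      exact hLne v hv hv0
  set ℓ := (completedRiemannZeta (1/2 + ((p+y:ℝ):ℂ) * I)).re with hℓ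
  set ℓ0 := (completedRiemannZeta (1/2 + ((p+0:ℝ):ℂ) * I)).re with hℓ0
  have hℓe : completedRiemannZeta (1/2 + ((p+y:ℝ):ℂ) * I) = (ℓ:ℂ) := Complex.ext rfl (by rw [hL]; simp)
  have hℓ0e : completedRiemannZeta (1/2 + (p:ℂ) * I) = (ℓ0:ℂ) := by
    have : completedRiemannZeta (1/2 + ((p+0:ℝ):ℂ) * I) = (ℓ0:ℂ) := Complex.ext rfl (by rw [hL]; simp)
    rwa [add_zero] at this
  rw [completed_eq (by simp)] at hℓe hℓ0e
  obtain ⟨ρ, hρ, hρe⟩ := hφ y (hsub hy)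
  rw [hρe, hye] at hℓe
  have hz := Complex.norm_mul_exp_arg_mul_I (riemannZeta (1/2 + (p:ℂ) * I))
  rw [← hα] at hz
  have hG : Gammaℝ (1/2 + (p:ℂ) * I) ≠ 0 := Gammaℝ_ne_zero_of_re_pos (by simp)
  have hz0 : riemannZeta (1/2 + (p:ℂ) * I) ≠ 0 := by
    have := hne 0 h0mem; rwa [add_zero] at this
  have hℓ00 : (ℓ0:ℂ) ≠ 0 := by rw [← hℓ0e]; exact mul_ne_zero hz0 hG
  have hρ0 : (ρ:ℂ) ≠ 0 := by exact_mod_cast hρ.ne'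
  refine ⟨ℓ/ℓ0 * ‖riemannZeta (1/2 + (p:ℂ) * I)‖ / ρ, by have := norm_pos_iff.mpr hz0; positivity, ?_⟩
  have hE : cexp (((α - θ:ℝ):ℂ) * I) * cexp (I * θ) = cexp (α * I) := by
    rw [← Complex.exp_add]; congr 1; push_cast; ring
  have hEne : cexp (((α - θ:ℝ):ℂ) * I) ≠ 0 := Complex.exp_ne_zero _
  push_cast
  set Zy := riemannZeta (1/2 + ((p:ℂ)+y) * I)
  set Z0 := riemannZeta (1/2 + (p:ℂ) * I)
  set Gp := Gammaℝ (1/2 + (p:ℂ) * I)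
  have hℓe' : Zy * (Gp * (ρ * cexp (((α - θ:ℝ):ℂ) * I))) = ℓ := by
    rw [← hℓe]; push_cast; rfl
  have hm : Gp * ℓ0 * ρ * cexp (((α - θ:ℝ):ℂ) * I) ≠ 0 := by
    refine mul_ne_zero (mul_ne_zero (mul_ne_zero hG hℓ00) hρ0) hEne
  refine mul_right_cancel₀ hm ?_
  have e1 : (ℓ:ℂ) / ℓ0 * ‖Z0‖ / ρ * cexp (I * θ) * (Gp * ℓ0 * ρ * cexp (((α - θ:ℝ):ℂ) * I)) = ℓ * (‖Z0‖ * (cexp (((α - θ:ℝ):ℂ) * I) * cexp (I * θ))) * Gp := by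
    field_simp
  rw [e1, hE, hz]
  linear_combination ℓ0 * hℓe' - ℓ * hℓ0e

end

section

noncomputable def RR (P : Finset ℕ) (c : ℝ) (s : ℂ) : ℂ := ∏ p ∈ P, (1 + (c:ℂ) * (p:ℂ)^(1/2 - s))
noncomputable def ZP (P : Finset ℕ) : ℝ := ∑ p ∈ P, Real.log p

lemma ZP_nonneg (P : Finset ℕ) : 0 ≤ ZP P := Finset.sum_nonneg fun p _ => Real.log_natCast_nonneg p

lemma RR_diff {P : Finset ℕ} (hP : ∀ p ∈ P, 17 ≤ p) (c : ℝ) : Differentiable ℂ (RR P c) := by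
  unfold RR
  refine Differentiable.fun_finsetProd fun p hp => ?_
  have : (p:ℂ) ≠ 0 := by have := hP p hp; exact_mod_cast (by omega : p ≠ 0)
  intro s
  refine (differentiableAt_const _).add ((differentiableAt_const _).mul ?_)
  exact DifferentiableAt.const_cpow (by fun_prop) (Or.inl this)

lemma norm_pcpow {p : ℕ} (hp : 17 ≤ p) (s : ℂ) : ‖(p:ℂ)^(1/2 - s)‖ = (p:ℝ)^(1/2 - s.re) := by
  rw [Complex.norm_natCast_cpow_of_pos (by omega)]; simp

lemma norm_pcpow_le {p : ℕ} (hp : 17 ≤ p) {s : ℂ} (hs : 1/2 ≤ s.re) : ‖(p:ℂ)^(1/2 - s)‖ ≤ 1 := by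
  rw [norm_pcpow hp]
  apply Real.rpow_le_one_of_one_le_of_nonpos
  · exact_mod_cast (by omega : 1 ≤ p)
  · linarith

lemma fac_bounds {c : ℝ} (hc : |c| ≤ 1/2) {a : ℂ} (ha : ‖a‖ ≤ 1) : 1/2 ≤ ‖1 + (c:ℂ) * a‖ ∧ ‖1 + (c:ℂ) * a‖ ≤ 3/2 := by
  have h1 : ‖(c:ℂ) * a‖ ≤ 1/2 := by
    rw [norm_mul, Complex.norm_real, Real.norm_eq_abs]; nlinarith [norm_nonneg a, abs_nonneg c]
  constructor
  · have := norm_sub_le_norm_add (1:ℂ) ((c:ℂ)*a)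
    rw [norm_one] at this; linarith
  · have := norm_add_le (1:ℂ) ((c:ℂ)*a)
    rw [norm_one] at this; linarith

lemma fac_ratio {c : ℝ} (hc : |c| ≤ 1/2) {a b : ℂ} (hb : ‖b‖ ≤ 1) :
    ‖1 + (c:ℂ) * a‖ ≤ (1 + ‖a - b‖) * ‖1 + (c:ℂ) * b‖ := by
  have h1 := (fac_bounds hc hb).1
  have h2 : ‖1 + (c:ℂ) * a‖ ≤ ‖1 + (c:ℂ) * b‖ + ‖(c:ℂ) * (a-b)‖ := by
    have := norm_add_le (1 + (c:ℂ) * b) ((c:ℂ) * (a-b))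
    have e : 1 + (c:ℂ) * a = 1 + (c:ℂ) * b + (c:ℂ) * (a-b) := by ring
    rwa [← e] at this
  have h3 : ‖(c:ℂ) * (a-b)‖ ≤ 1/2 * ‖a-b‖ := by
    rw [norm_mul, Complex.norm_real, Real.norm_eq_abs]; gcongr
  nlinarith [norm_nonneg (a-b)]

lemma RR_low {P : Finset ℕ} (hP : ∀ p ∈ P, 17 ≤ p) {c : ℝ} (hc : |c| ≤ 1/2) {s : ℂ} (hs : 1/2 ≤ s.re) :
    (1/2:ℝ)^P.card ≤ ‖RR P c s‖ := by
  rw [RR, norm_prod, ← Finset.prod_const]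
  exact Finset.prod_le_prod (fun _ _ => by norm_num) fun p hp => (fac_bounds hc (norm_pcpow_le (hP p hp) hs)).1

lemma RR_up {P : Finset ℕ} (hP : ∀ p ∈ P, 17 ≤ p) {c : ℝ} (hc : |c| ≤ 1/2) {s : ℂ} (hs : 1/2 ≤ s.re) :
    ‖RR P c s‖ ≤ (3/2:ℝ)^P.card := by
  rw [RR, norm_prod, ← Finset.prod_const]
  exact Finset.prod_le_prod (fun _ _ => norm_nonneg _) fun p hp => (fac_bounds hc (norm_pcpow_le (hP p hp) hs)).2

lemma RR_pos {P : Finset ℕ} (hP : ∀ p ∈ P, 17 ≤ p) {c : ℝ} (hc : |c| ≤ 1/2) {s : ℂ} (hs : 1/2 ≤ s.re) :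
    0 < ‖RR P c s‖ := lt_of_lt_of_le (by positivity) (RR_low hP hc hs)

lemma pcpow_lip {p : ℕ} (hp : 17 ≤ p) {s s' : ℂ} (hs : 1/2 ≤ s.re) (hs' : 1/2 ≤ s'.re) :
    ‖(p:ℂ)^(1/2 - s) - (p:ℂ)^(1/2 - s')‖ ≤ Real.log p * ‖s - s'‖ := by
  have hp0 : (p:ℂ) ≠ 0 := by exact_mod_cast (by omega : p ≠ 0)
  have hc : Convex ℝ {z : ℂ | 1/2 ≤ z.re} := convex_halfSpace_re_ge _
  refine hc.norm_image_sub_le_of_norm_hasDerivWithin_le (f := fun z : ℂ => (p:ℂ)^(1/2 - z))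
    (f' := fun z => (p:ℂ)^(1/2 - z) * Complex.log p * (-1)) ?_ ?_ hs' hs
  · intro z hz
    have := ((hasDerivAt_id z).const_sub (1/2:ℂ)).const_cpow (c := (p:ℂ)) (Or.inl hp0)
    exact this.hasDerivWithinAt
  · intro z hz
    rw [norm_mul, norm_mul, norm_neg, norm_one, mul_one]
    have h1 := norm_pcpow_le hp (s := z) hz
    have h2 : ‖Complex.log p‖ = Real.log p := by
      rw [← Complex.natCast_log, Complex.norm_real, Real.norm_of_nonneg (Real.log_natCast_nonneg p)]
    rw [h2]
    have := Real.log_natCast_nonneg p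
    nlinarith

lemma RR_ratio {P : Finset ℕ} (hP : ∀ p ∈ P, 17 ≤ p) {c : ℝ} (hc : |c| ≤ 1/2) {s s' : ℂ} (hs : 1/2 ≤ s.re) (hs' : 1/2 ≤ s'.re) :
    ‖RR P c s‖ ≤ Real.exp (ZP P * ‖s - s'‖) * ‖RR P c s'‖ := by
  rw [RR, RR, norm_prod, norm_prod, ZP, Finset.sum_mul, Real.exp_sum, ← Finset.prod_mul_distrib]
  refine Finset.prod_le_prod (fun _ _ => norm_nonneg _) fun p hp => ?_
  refine (fac_ratio hc (norm_pcpow_le (hP p hp) hs')).trans ?_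
  gcongr
  have := pcpow_lip (hP p hp) hs hs'
  have h2 := Real.add_one_le_exp (Real.log p * ‖s - s'‖)
  linarith

lemma RR_left {P : Finset ℕ} (hP : ∀ p ∈ P, 17 ≤ p) {c : ℝ} (hc : |c| ≤ 1/2) {x : ℝ} (hx : 0 ≤ x) (t : ℝ) :
    ‖RR P c ((1/2 - x : ℝ) + t * I)‖ ≤ Real.exp (2 * x * ZP P) * ‖RR P c ((1/2 + x : ℝ) + t * I)‖ := by
  rw [RR, RR, norm_prod, norm_prod, ZP, Finset.mul_sum, Real.exp_sum, ← Finset.prod_mul_distrib]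
  refine Finset.prod_le_prod (fun _ _ => norm_nonneg _) fun p hp => ?_
  refine (fac_ratio hc (norm_pcpow_le (hP p hp) (s := (1/2 + x : ℝ) + t * I) (by simp; linarith))).trans ?_
  gcongr
  have hp0 : (p:ℂ) ≠ 0 := by have := hP p hp; exact_mod_cast (by omega : p ≠ 0)
  have hp1 : (0:ℝ) < p := by have := hP p hp; exact_mod_cast (by omega : 0 < p)
  have e1 : (p:ℂ)^(1/2 - (((1/2 - x : ℝ):ℂ) + t * I)) = ((p:ℝ)^x : ℝ) * (p:ℂ)^(-(t * I)) := by
    rw [Complex.ofReal_cpow hp1.le, Complex.ofReal_natCast, ← Complex.cpow_add _ _ hp0]; congr 1; push_cast; ring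
  have e2 : (p:ℂ)^(1/2 - (((1/2 + x : ℝ):ℂ) + t * I)) = ((p:ℝ)^(-x) : ℝ) * (p:ℂ)^(-(t * I)) := by
    rw [Complex.ofReal_cpow hp1.le, Complex.ofReal_natCast, ← Complex.cpow_add _ _ hp0]; congr 1; push_cast; ring
  have e3 : ‖(p:ℂ)^(-(t * I))‖ = 1 := by
    rw [Complex.norm_natCast_cpow_of_pos (by have := hP p hp; omega)]; simp
  have hl := Real.log_natCast_nonneg p
  have hxl : 0 ≤ x * Real.log p := mul_nonneg hx hl
  have e4 : (p:ℝ)^x = Real.exp (x * Real.log p) := by rw [Real.rpow_def_of_pos hp1, mul_comm]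
  have e5 : (p:ℝ)^(-x) = Real.exp (-(x * Real.log p)) := by rw [Real.rpow_def_of_pos hp1]; congr 1; ring
  rw [e1, e2, ← sub_mul, ← Complex.ofReal_sub, norm_mul, e3, mul_one, Complex.norm_real, e4, e5]
  set y := x * Real.log p
  have h1 : 1 ≤ Real.exp y := Real.one_le_exp hxl
  have h2 : Real.exp (-y) ≤ 1 := Real.exp_le_one_iff.mpr (by linarith)
  have h3 : Real.exp y * Real.exp (-y) = 1 := by rw [← Real.exp_add]; simp
  have h4 : Real.exp (2 * x * Real.log p) = Real.exp y * Real.exp y := by rw [← Real.exp_add]; congr 1; simp only [y]; ring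
  rw [Real.norm_of_nonneg (by linarith), h4]
  nlinarith

lemma qfac_bounds (t : ℝ) {x : ℝ} (hx : x ≤ 1/4) :
    9/50 ≤ ‖1 - (2:ℂ)^(1 - ((1/2 + x : ℝ) + t * I))‖ := by
  have h : ‖(2:ℂ)^(1 - (((1/2 + x : ℝ):ℂ) + t * I))‖ = (2:ℝ)^(1/2 - x) := by
    have := Complex.norm_natCast_cpow_of_pos (n := 2) (by norm_num) (1 - (((1/2 + x : ℝ):ℂ) + t * I))
    push_cast at this
    push_cast
    rw [this]; congr 1; simp; ring
  have h2 : (2:ℝ)^(1/4:ℝ) ≤ (2:ℝ)^(1/2 - x) := Real.rpow_le_rpow_of_exponent_le (by norm_num) (by linarith)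
  have h3 : (1.18:ℝ) ≤ (2:ℝ)^(1/4:ℝ) := by
    rw [show (1/4:ℝ) = ((4:ℕ):ℝ)⁻¹ by norm_num]
    rw [Real.le_rpow_inv_iff_of_pos (by norm_num) (by norm_num) (by norm_num)]
    norm_num
  have := norm_sub_norm_le ((2:ℂ)^(1 - (((1/2 + x : ℝ):ℂ) + t * I))) 1
  rw [norm_sub_rev, h, norm_one] at this
  linarith

lemma qfac_left (t : ℝ) {x : ℝ} (h0 : 0 ≤ x) (hx : x ≤ 1/4) :
    ‖1 - (2:ℂ)^(1 - ((1/2 - x : ℝ) + t * I))‖ ≤ Real.exp (20 * x) * ‖1 - (2:ℂ)^(1 - ((1/2 + x : ℝ) + t * I))‖ := by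
  have hq := qfac_bounds t hx
  have e1 : (2:ℂ)^(1 - (((1/2 - x : ℝ):ℂ) + t * I)) = ((2:ℝ)^x : ℝ) * (2:ℂ)^((1/2:ℂ)-(t * I)) := by
    rw [Complex.ofReal_cpow (by norm_num), Complex.ofReal_ofNat, ← Complex.cpow_add _ _ (by norm_num)]; congr 1; push_cast; ring
  have e2 : (2:ℂ)^(1 - (((1/2 + x : ℝ):ℂ) + t * I)) = ((2:ℝ)^(-x) : ℝ) * (2:ℂ)^((1/2:ℂ)-(t * I)) := by
    rw [Complex.ofReal_cpow (by norm_num), Complex.ofReal_ofNat, ← Complex.cpow_add _ _ (by norm_num)]; congr 1; push_cast; ring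
  have e3 : ‖(2:ℂ)^((1/2:ℂ)-(t * I))‖ ≤ 3/2 := by
    have := Complex.norm_natCast_cpow_of_pos (n := 2) (by norm_num) ((1/2:ℂ)-(t * I))
    push_cast at this
    rw [this]
    have e : ((1/2:ℂ)-(t * I)).re = 1/2 := by simp
    rw [e, ← Real.sqrt_eq_rpow, Real.sqrt_le_left (by norm_num)]; norm_num
  have b1 : (2:ℝ)^x ≤ 1 + x := by
    have := rpow_one_add_le_one_add_mul_self (s := 1) (by norm_num) h0 (by linarith)
    norm_num at this; linarith
  have b2 : 1 - x ≤ (2:ℝ)^(-x) := by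
    rw [Real.rpow_def_of_pos (by norm_num)]
    have := Real.add_one_le_exp (Real.log 2 * -x)
    have h2 := Real.log_two_lt_d9
    nlinarith
  have b3 : (2:ℝ)^(-x) ≤ (2:ℝ)^x := Real.rpow_le_rpow_of_exponent_le (by norm_num) (by linarith)
  have tri := norm_add_le (1 - (2:ℂ)^(1 - (((1/2 + x : ℝ):ℂ) + t * I))) ((2:ℂ)^(1 - (((1/2 + x : ℝ):ℂ) + t * I)) - (2:ℂ)^(1 - (((1/2 - x : ℝ):ℂ) + t * I)))
  rw [sub_add_sub_cancel] at tri
  have d : ‖(2:ℂ)^(1 - (((1/2 + x : ℝ):ℂ) + t * I)) - (2:ℂ)^(1 - (((1/2 - x : ℝ):ℂ) + t * I))‖ ≤ 3 * x := by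
    rw [e1, e2, ← sub_mul, ← Complex.ofReal_sub, norm_mul, Complex.norm_real, norm_sub_rev, Real.norm_of_nonneg (by linarith)]
    calc _ ≤ (2*x) * (3/2) := by gcongr; linarith
      _ = _ := by ring
  have := Real.add_one_le_exp (20 * x)
  nlinarith

lemma eZ_left : ∃ C : ℝ, 1 ≤ C ∧ ∀ x t : ℝ, 0 ≤ x → x ≤ 1/4 → 2 ≤ t →
    ‖eZ ((1/2 - x : ℝ) + t * I)‖ ≤ Real.exp (x * (Real.log t + C)) * ‖eZ ((1/2 + x : ℝ) + t * I)‖ := by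
  obtain ⟨C, hC, h⟩ := zeta_left
  refine ⟨C + 20, by linarith, fun x t h0 hx ht => ?_⟩
  have hne : ∀ σ : ℝ, ((σ:ℂ) + t * I) ≠ 1 := fun σ he => by
    have := congrArg Complex.im he; simp at this; linarith
  rw [eZ_zeta (hne _), eZ_zeta (hne _), norm_mul, norm_mul]
  have h1 := h x t h0 hx ht
  have h2 := qfac_left t h0 hx
  calc _ ≤ (Real.exp (20 * x) * ‖1 - (2:ℂ)^(1 - (((1/2 + x : ℝ):ℂ) + t * I))‖) * (Real.exp (x * (Real.log t + C)) * ‖riemannZeta ((1/2 + x : ℝ) + t * I)‖) := by gcongr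
    _ = _ := by
      rw [show x * (Real.log t + (C+20)) = 20 * x + x * (Real.log t + C) by ring, Real.exp_add]; ring

end

section

lemma one_add_abs_mul (a b c : ℝ) : 1 + |a - c| ≤ (1 + |a - b|) * (1 + |c - b|) := by
  have h := abs_sub_le a b c
  rw [abs_sub_comm b c] at h
  nlinarith [mul_nonneg (abs_nonneg (a-b)) (abs_nonneg (c-b))]

lemma norm_half_add (t : ℝ) : ‖(1/2:ℂ) + t * I‖ ≤ 1 + |t| := by
  refine (norm_add_le _ _).trans ?_
  rw [norm_mul, Complex.norm_I, Complex.norm_real, Real.norm_eq_abs]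
  norm_num

lemma peak_exists {f : ℂ → ℂ} (hf : Continuous f) {A : ℝ} (hA : 0 ≤ A)
    (hb : ∀ s : ℂ, 1/2 ≤ s.re → ‖f s‖ ≤ A * ‖s‖) (t₁ : ℝ) (h1 : f (1/2 + (t₁:ℂ) * I) ≠ 0) :
    ∃ p : ℝ, (∀ t : ℝ, ‖f (1/2 + (t:ℂ) * I)‖ ≤ ‖f (1/2 + (p:ℂ) * I)‖ * (1 + |t - p|)^2) ∧
      ‖f (1/2 + (t₁:ℂ) * I)‖ * (1 + |t₁ - p|)^2 ≤ ‖f (1/2 + (p:ℂ) * I)‖ := by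
  set h : ℝ → ℝ := fun t => ‖f (1/2 + (t:ℂ) * I)‖ / (1 + |t₁ - t|)^2 with hh
  have hpos : ∀ t : ℝ, 0 < 1 + |t₁ - t| := fun t => by positivity
  have hc : Continuous h := by
    refine Continuous.div (by fun_prop) (by fun_prop) fun t => by have := hpos t; positivity
  have h10 : 0 < h t₁ := by simp only [hh]; have := norm_pos_iff.mpr h1; have := hpos t₁; positivity
  have hev : ∀ᶠ t in cocompact ℝ, h t ≤ h t₁ := by
    have h2 := (tendsto_norm_cocompact_atTop (E := ℝ)).eventually_ge_atTop (|t₁| + A * (1 + |t₁|) / h t₁)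
    filter_upwards [h2] with t ht
    have hb1 := (hb (1/2 + t * I) (by simp)).trans (mul_le_mul_of_nonneg_left (norm_half_add t) hA)
    have hm : 1 + |t| ≤ (1 + |t₁|) * (1 + |t₁ - t|) := by
      have := one_add_abs_mul 0 t₁ t
      simp only [zero_sub, abs_neg] at this
      rwa [abs_sub_comm t t₁] at this
    have h3 : A * (1 + |t₁|) / h t₁ ≤ 1 + |t₁ - t| := by
      have := abs_sub_abs_le_abs_sub t t₁
      rw [Real.norm_eq_abs] at ht
      rw [abs_sub_comm] at this
      linarith
    rw [div_le_iff₀ h10] at h3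
    simp only [hh] at h3 ⊢
    rw [div_le_iff₀ (by have := hpos t; positivity)]
    calc _ ≤ A * ((1 + |t₁|) * (1 + |t₁ - t|)) := hb1.trans (by gcongr)
      _ = (A * (1 + |t₁|)) * (1 + |t₁ - t|) := by ring
      _ ≤ _ := (mul_le_mul_of_nonneg_right h3 (hpos t).le).trans (le_of_eq (by ring))
  obtain ⟨p, hp⟩ := hc.exists_forall_ge' t₁ hev
  refine ⟨p, fun t => ?_, ?_⟩
  · have := hp t
    simp only [hh] at this
    rw [div_le_div_iff₀ (by have := hpos t; positivity) (by have := hpos p; positivity)] at this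
    have h4 : (1 + |t₁ - t|) ≤ (1 + |t₁ - p|) * (1 + |t - p|) := one_add_abs_mul _ _ _
    have h5 : (1 + |t₁ - t|)^2 ≤ (1 + |t₁ - p|)^2 * (1 + |t - p|)^2 := by
      rw [← mul_pow]; exact pow_le_pow_left₀ (hpos t).le h4 2
    have h6 : 0 < (1 + |t₁ - p|)^2 := by have := hpos p; positivity
    refine le_of_mul_le_mul_right (this.trans ?_) h6
    calc _ ≤ ‖f (1/2 + (p:ℂ) * I)‖ * ((1 + |t₁ - p|)^2 * (1 + |t - p|)^2) := by gcongr
      _ = _ := by ring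
  · have := hp t₁
    simp only [hh] at this
    rw [le_div_iff₀ (by have := hpos p; positivity)] at this
    simpa using this

lemma peak_PL {f : ℂ → ℂ} (hf : Differentiable ℂ f) {A : ℝ} (hA : 0 ≤ A)
    (hb : ∀ s : ℂ, 1/2 ≤ s.re → ‖f s‖ ≤ A * ‖s‖) {p M : ℝ}
    (hp : ∀ t : ℝ, ‖f (1/2 + (t:ℂ) * I)‖ ≤ M * (1 + |t - p|)^2) {w : ℂ} (hw : 0 ≤ w.re) :
    ‖f (1/2 + (p:ℂ) * I + w)‖ ≤ 26/25 * M * ‖1 + 5 * w‖^2 := by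
  have hM : 0 ≤ M := by have := (norm_nonneg _).trans (hp p); simpa using this
  set s0 : ℂ := 1/2 + (p:ℂ) * I with hs0
  set G : ℂ → ℂ := fun w => f (s0 + w) / (1 + 5 * w)^2 with hG
  have hn1 : ∀ w : ℂ, 0 ≤ w.re → 1 ≤ ‖1 + 5 * w‖ := fun w hw => by
    have := Complex.re_le_norm (1 + 5 * w); simp at this; linarith
  have hne : ∀ w : ℂ, 0 ≤ w.re → (1 + 5 * w)^2 ≠ 0 := fun w hw => by
    have := hn1 w hw
    exact pow_ne_zero _ (norm_pos_iff.mp (by linarith))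
  have hGb : ∀ w : ℂ, 0 ≤ w.re → ‖G w‖ ≤ A * (‖s0‖ + ‖w‖) := fun w hw => by
    simp only [hG, norm_div, norm_pow]
    refine (div_le_self (norm_nonneg _) (one_le_pow₀ (hn1 w hw))).trans ?_
    refine (hb _ (by simp [hs0]; exact hw)).trans (by gcongr; exact norm_add_le _ _)
  have key : ‖G w‖ ≤ 26/25 * M := by
    refine PhragmenLindelof.right_half_plane_of_bounded_on_real (f := G) (C := 26/25*M) ?_ ⟨1, by norm_num, 1, ?_⟩ ?_ ?_ hw
    · refine DifferentiableOn.diffContOnCl ?_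
      intro z hz
      have hz' : 0 ≤ z.re := by
        have : closure {z : ℂ | 0 < z.re} = {z | 0 ≤ z.re} := Complex.closure_setOf_lt_re 0
        rw [this] at hz; exact hz
      refine DifferentiableAt.differentiableWithinAt ?_
      exact DifferentiableAt.div (by fun_prop) (by fun_prop) (hne z hz')
    · refine Asymptotics.IsBigO.of_bound (A * (‖s0‖ + 1)) ?_
      refine eventually_inf_principal.mpr (Eventually.of_forall fun z hz => ?_)
      refine (hGb z (le_of_lt hz)).trans ?_
      rw [Real.rpow_one, one_mul, Real.norm_of_nonneg (Real.exp_pos _).le, mul_assoc]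
      gcongr
      have h1 := Real.add_one_le_exp ‖z‖
      nlinarith [norm_nonneg s0, norm_nonneg z]
    · refine ⟨A * (‖s0‖ + 1), ?_⟩
      rw [eventually_map]
      filter_upwards [eventually_ge_atTop (0:ℝ)] with x hx
      simp only [hG, norm_div, norm_pow]
      have h1 : ‖1 + 5 * (x:ℂ)‖ = 1 + 5 * x := by
        have : (1 + 5 * (x:ℂ)) = ((1 + 5 * x : ℝ):ℂ) := by push_cast; ring
        rw [this, Complex.norm_real, Real.norm_of_nonneg (by linarith)]
      rw [h1, div_le_iff₀ (by positivity)]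
      have h2 := hb (s0 + x) (by simp [hs0]; exact hx)
      have h3 : ‖s0 + (x:ℂ)‖ ≤ ‖s0‖ + x := by
        refine (norm_add_le _ _).trans ?_
        rw [Complex.norm_real, Real.norm_of_nonneg hx]
      refine (h2.trans (mul_le_mul_of_nonneg_left h3 hA)).trans ?_
      rw [mul_assoc]
      gcongr
      nlinarith [norm_nonneg s0, mul_nonneg (norm_nonneg s0) hx, mul_nonneg (norm_nonneg s0) (mul_nonneg hx hx)]
    · intro x
      simp only [hG, norm_div, norm_pow]
      have h1 : ‖1 + 5 * ((x:ℂ) * I)‖^2 = 1 + 25 * x^2 := by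
        rw [← Complex.normSq_eq_norm_sq, Complex.normSq_apply]; simp; ring
      rw [h1, div_le_iff₀ (by positivity)]
      have h2 := hp (p + x)
      have e : (1/2:ℂ) + ((p + x : ℝ):ℂ) * I = s0 + x * I := by rw [hs0]; push_cast; ring
      rw [e] at h2
      refine h2.trans ?_
      rw [show 26/25*M*(1+25*x^2) = M * (26/25*(1+25*x^2)) by ring]
      gcongr
      have : |p + x - p| = |x| := by congr 1; ring
      rw [this]
      nlinarith [sq_abs x, sq_nonneg (5*|x| - 1/5)]
  simp only [hG, norm_div, norm_pow] at key
  rwa [div_le_iff₀ (by have := hn1 w hw; positivity)] at key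

end

section

lemma schwarz2 {K : ℂ → ℂ} (hK : Differentiable ℂ K) (h0 : K 0 = 0) (hev : ∀ w, K (-w) = K w) {ρ B : ℝ} (hρ : 0 < ρ)
    (hB : ∀ w : ℂ, ‖w‖ = ρ → ‖K w‖ ≤ B) {w : ℂ} (hw : ‖w‖ ≤ ρ) : ‖K w‖ ≤ B * (‖w‖ / ρ)^2 := by
  have hd0 : deriv K 0 = 0 := by
    have h1 : HasDerivAt K (deriv K 0) 0 := (hK 0).hasDerivAt
    have h2 : HasDerivAt (fun w => K (-w)) (deriv K 0 * (-1)) 0 := by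
      have h1' : HasDerivAt K (deriv K 0) (-0) := by simpa using h1
      exact h1'.comp 0 (hasDerivAt_neg 0)
    have h3 : (fun w => K (-w)) = K := funext hev
    rw [h3] at h2
    have := h1.unique h2
    linear_combination this / 2
  set k1 := dslope K 0 with hk1
  set k2 := dslope k1 0 with hk2
  have d1 : DifferentiableOn ℂ k1 univ := (Complex.differentiableOn_dslope univ_mem).mpr hK.differentiableOn
  have d2 : DifferentiableOn ℂ k2 univ := (Complex.differentiableOn_dslope univ_mem).mpr d1
  have hk10 : k1 0 = 0 := by rw [hk1, dslope_same, hd0]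
  have e1 : ∀ w, K w = w * k1 w := fun w => by
    have := sub_smul_dslope K 0 w
    simp only [sub_zero, h0, smul_eq_mul] at this; exact this.symm
  have e2 : ∀ w, k1 w = w * k2 w := fun w => by
    have := sub_smul_dslope k1 0 w
    simp only [sub_zero, hk10, smul_eq_mul] at this; exact this.symm
  have e3 : ∀ w, ‖K w‖ = ‖w‖^2 * ‖k2 w‖ := fun w => by rw [e1, e2, norm_mul, norm_mul]; ring
  have key : ‖k2 w‖ ≤ B / ρ^2 := by
    refine Complex.norm_le_of_forall_mem_frontier_norm_le (U := Metric.ball 0 ρ) Metric.isBounded_ball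
      (d2.mono (subset_univ _)).diffContOnCl (fun z hz => ?_) ?_
    · rw [frontier_ball _ hρ.ne'] at hz
      have hz' : ‖z‖ = ρ := by simpa using hz
      have := hB z hz'
      rw [e3, hz'] at this
      rw [le_div_iff₀ (by positivity)]; linarith
    · rw [closure_ball _ hρ.ne']; simpa using hw
  rw [e3]
  calc _ ≤ ‖w‖^2 * (B/ρ^2) := by gcongr
    _ = _ := by rw [div_pow]; ring

lemma LLgen {f : ℂ → ℂ} (hf : Differentiable ℂ f) {A : ℝ} (hA : 0 ≤ A)
    (hb : ∀ s : ℂ, 1/2 ≤ s.re → ‖f s‖ ≤ A * ‖s‖) {p L : ℝ} (hL : 20000 ≤ L)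
    (hp : ∀ t : ℝ, ‖f (1/2 + (t:ℂ) * I)‖ ≤ ‖f (1/2 + (p:ℂ) * I)‖ * (1 + |t - p|)^2)
    (hne : f (1/2 + (p:ℂ) * I) ≠ 0)
    (hleft : ∀ x y : ℝ, 0 ≤ x → x ≤ 1/4 → |y| ≤ 1 →
      ‖f ((1/2 - x : ℝ) + ((p + y : ℝ):ℂ) * I)‖ ≤ Real.exp (2.02 * L * x) * ‖f ((1/2 + x : ℝ) + ((p + y : ℝ):ℂ) * I)‖)
    {y : ℝ} (hy : |y| ≤ 0.41 / L) :
    ‖f (1/2 + (p:ℂ) * I)‖ / 5 ≤ ‖f (1/2 + ((p + y : ℝ):ℂ) * I)‖ := by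
  set s0 : ℂ := 1/2 + (p:ℂ) * I with hs0
  set M := ‖f s0‖ with hM
  have hMpos : 0 < M := norm_pos_iff.mpr hne
  have hLpos : 0 < L := by linarith
  set κ : ℝ := 1.01 * L with hκ
  set H : ℂ → ℂ := fun w => f (s0 + w) / f s0 * cexp (κ * w) with hH
  have hHd : Differentiable ℂ H := by
    simp only [hH]; fun_prop
  have hexpn : ∀ w : ℂ, ‖cexp (κ * w)‖ = Real.exp (κ * w.re) := fun w => by
    rw [Complex.norm_exp]; simp
  have hinv : 1 / L ≤ 1 / 20000 := one_div_le_one_div_of_le (by norm_num) hL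
  have hρ2 : 2 / L ≤ 1/10000 := by rw [show 2/L = 2*(1/L) by ring]; linarith
  have hρ0 : 0 < 2 / L := by positivity
  have hR : ∀ w : ℂ, 0 ≤ w.re → ‖w‖ ≤ 2 / L → ‖f (s0 + w)‖ ≤ 1.05 * M := fun w hw hwn => by
    have h1 := peak_PL hf hA hb hp hw
    have h2 : ‖1 + 5 * w‖ ≤ 1 + 5 * (1/10000) := by
      refine (norm_add_le _ _).trans ?_
      rw [norm_one, norm_mul]; norm_num
      linarith
    refine h1.trans ?_
    calc _ ≤ 26/25 * M * (1 + 5 * (1/10000))^2 := by gcongr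
      _ ≤ _ := by nlinarith
  have hHb : ∀ w : ℂ, ‖w‖ ≤ 2 / L → ‖H w‖ ≤ 1.05 * Real.exp 2.02 := fun w hwn => by
    have hre : |w.re| ≤ 2 / L := (Complex.abs_re_le_norm w).trans hwn
    have him : |w.im| ≤ 2 / L := (Complex.abs_im_le_norm w).trans hwn
    have hκr : κ * |w.re| ≤ 2.02 := by
      calc κ * |w.re| ≤ κ * (2/L) := by gcongr
        _ = 2.02 := by rw [hκ]; field_simp; norm_num
    simp only [hH]
    rw [norm_mul, norm_div, hexpn, ← hM]
    rcases le_total 0 w.re with h | h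
    · rw [abs_of_nonneg h] at hκr
      have := hR w h hwn
      have h2 : ‖f (s0 + w)‖ / M ≤ 1.05 := by rw [div_le_iff₀ hMpos]; exact this
      gcongr
    · have hx : 0 ≤ -w.re := by linarith
      rw [abs_of_nonpos h] at hre hκr
      have h1 := hleft (-w.re) w.im hx (by linarith) (by linarith)
      have e1 : (((1/2 - -w.re : ℝ):ℂ) + ((p + w.im : ℝ):ℂ) * I) = s0 + w := by
        apply Complex.ext <;> simp [hs0]
      have e2 : (((1/2 + -w.re : ℝ):ℂ) + ((p + w.im : ℝ):ℂ) * I) = s0 + (((-w.re : ℝ):ℂ) + (w.im:ℂ) * I) := by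
        apply Complex.ext <;> simp [hs0]
      rw [e1, e2] at h1
      have h3 := hR (((-w.re : ℝ):ℂ) + (w.im:ℂ) * I) (by simp; exact h) (by
        refine le_trans (le_of_eq ?_) hwn
        rw [Complex.norm_eq_sqrt_sq_add_sq, Complex.norm_eq_sqrt_sq_add_sq]; simp)
      have h2 : ‖f (s0 + w)‖ / M ≤ Real.exp (2.02 * L * (-w.re)) * 1.05 := by
        rw [div_le_iff₀ hMpos]
        refine h1.trans ?_
        rw [mul_assoc (Real.exp _)]
        exact mul_le_mul_of_nonneg_left h3 (Real.exp_pos _).le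
      calc _ ≤ Real.exp (2.02 * L * (-w.re)) * 1.05 * Real.exp (κ * w.re) := by gcongr
        _ = 1.05 * Real.exp (κ * (-w.re)) := by
          rw [mul_comm (Real.exp (2.02 * L * (-w.re))), mul_assoc, ← Real.exp_add]; congr 2; rw [hκ]; ring
        _ ≤ _ := by gcongr
  have hH0 : H 0 = 1 := by simp [hH, hne]
  set K : ℂ → ℂ := fun w => H w + H (-w) - 2 with hK
  have hKd : Differentiable ℂ K := by
    have : Differentiable ℂ fun w => H (-w) := hHd.comp differentiable_neg
    exact (hHd.add this).sub_const 2
  have hyL : |y| ≤ 2/L := hy.trans (by gcongr; norm_num)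
  have hyn : ‖(y:ℂ) * I‖ = |y| := by simp
  have hKy := schwarz2 hKd (by simp [hK, hH0]; norm_num) (fun w => by simp [hK]; ring) hρ0 (B := 17.9) (fun w hw => by
    have h1 := hHb w hw.le
    have h2 := hHb (-w) (by rw [norm_neg]; exact hw.le)
    have h3 : Real.exp 2.02 ≤ 7.55 := by
      have e : (2.02:ℝ) = 1 + 1 + 0.02 := by norm_num
      rw [e, Real.exp_add, Real.exp_add]
      have a1 := Real.exp_one_lt_d9
      have a2 : Real.exp 0.02 ≤ 1/(1 - 0.02) := by
        have := Real.one_sub_le_exp_neg 0.02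
        rw [Real.exp_neg] at this
        have h' : (0:ℝ) < 1 - 0.02 := by norm_num
        rw [le_div_iff₀ h']
        have hx := Real.exp_pos 0.02
        have := mul_le_mul_of_nonneg_left this hx.le
        rwa [mul_inv_cancel₀ hx.ne'] at this
      have a0 := Real.exp_pos 1
      have a3 : Real.exp 1 * Real.exp 1 ≤ 2.7182818286 * 2.7182818286 := by gcongr
      exact (mul_le_mul a3 a2 (Real.exp_pos _).le (by norm_num)).trans (by norm_num)
    calc ‖K w‖ ≤ ‖H w‖ + ‖H (-w)‖ + ‖(2:ℂ)‖ := by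
          simp only [hK]; exact (norm_sub_le _ _).trans (by gcongr; exact norm_add_le _ _)
      _ ≤ 17.9 := by
        have : ‖(2:ℂ)‖ = 2 := by norm_num
        rw [this]; linarith) (w := (y:ℂ)*I) (by rw [hyn]; exact hyL)
  have hq : 17.9 * (‖(y:ℂ)*I‖ / (2/L))^2 ≤ 0.76 := by
    rw [hyn]
    have : |y| / (2/L) ≤ 0.205 := by
      rw [div_le_iff₀ hρ0]; refine hy.trans (le_of_eq ?_); ring
    have h0 : 0 ≤ |y| / (2/L) := by positivity
    nlinarith
  have hy1 : ∀ y : ℝ, ‖H ((y:ℂ) * I)‖ = ‖f (1/2 + ((p + y : ℝ):ℂ) * I)‖ / M := fun y => by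
    simp only [hH]
    rw [norm_mul, hexpn, norm_div]
    have : s0 + (y:ℂ) * I = 1/2 + ((p + y : ℝ):ℂ) * I := by rw [hs0]; push_cast; ring
    rw [this]; simp [hM]
  have hup : ‖H (-((y:ℂ) * I))‖ ≤ 1.01 := by
    have := hy1 (-y)
    rw [show ((-y : ℝ):ℂ) * I = -((y:ℂ) * I) by push_cast; ring] at this
    rw [this, div_le_iff₀ hMpos]
    refine (hp _).trans ?_
    rw [show p + -y - p = -y by ring, abs_neg, mul_comm]
    gcongr
    have := abs_nonneg y
    nlinarith
  have tri : (2:ℝ) ≤ ‖H ((y:ℂ)*I)‖ + ‖H (-((y:ℂ) * I))‖ + ‖K ((y:ℂ) * I)‖ := by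
    have e : (2:ℂ) = H ((y:ℂ)*I) + H (-((y:ℂ) * I)) - K ((y:ℂ) * I) := by simp only [hK]; ring
    have h1 : ‖(2:ℂ)‖ ≤ ‖H ((y:ℂ)*I)‖ + ‖H (-((y:ℂ) * I))‖ + ‖K ((y:ℂ) * I)‖ := by
      conv_lhs => rw [e]
      exact (norm_sub_le _ _).trans (by gcongr; exact norm_add_le _ _)
    simpa using h1
  have hfin : 1/5 ≤ ‖H ((y:ℂ)*I)‖ := by linarith
  rw [hy1, le_div_iff₀ hMpos] at hfin
  linarith

end

section

noncomputable def ff (P : Finset ℕ) (c : ℝ) (s : ℂ) : ℂ := eZ s * RR P c s ^ 2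

lemma ff_diff {P : Finset ℕ} (hP : ∀ p ∈ P, 17 ≤ p) (c : ℝ) : Differentiable ℂ (ff P c) :=
  eZ_diff.mul ((RR_diff hP c).pow 2)

lemma ff_growth : ∃ C : ℝ, 1 ≤ C ∧ ∀ (P : Finset ℕ) (c : ℝ), (∀ p ∈ P, 17 ≤ p) → |c| ≤ 1/2 →
    ∀ s : ℂ, 1/2 ≤ s.re → ‖ff P c s‖ ≤ C * ((3/2:ℝ)^P.card)^2 * ‖s‖ := by
  obtain ⟨C, hC, h⟩ := eZ_growth
  refine ⟨C, hC, fun P c hP hc s hs => ?_⟩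
  rw [ff, norm_mul, norm_pow]
  have h1 := h s hs
  have h2 := RR_up hP hc hs
  calc _ ≤ (C * ‖s‖) * ((3/2:ℝ)^P.card)^2 := by gcongr
    _ = _ := by ring

lemma q_up (t : ℝ) : ‖1 - (2:ℂ)^(1 - ((1/2:ℂ) + t * I))‖ ≤ 3 := by
  have e3 : ‖(2:ℂ)^(1 - ((1/2:ℂ) + t * I))‖ ≤ 3/2 := by
    have := Complex.norm_natCast_cpow_of_pos (n := 2) (by norm_num) (1 - ((1/2:ℂ) + t * I))
    push_cast at this
    rw [this]
    have e : (1 - ((1/2:ℂ) + t * I)).re = 1/2 := by simp; norm_num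
    rw [e, ← Real.sqrt_eq_rpow, Real.sqrt_le_left (by norm_num)]; norm_num
  refine (norm_sub_le _ _).trans ?_
  rw [norm_one]; linarith

lemma q_low (t : ℝ) : 9/50 ≤ ‖1 - (2:ℂ)^(1 - ((1/2:ℂ) + t * I))‖ := by
  have := qfac_bounds t (x := 0) (by norm_num)
  simpa using this

lemma eZ_vs_zeta {t : ℝ} (ht : 1 ≤ t) : 9/50 * ‖riemannZeta (1/2 + (t:ℂ) * I)‖ ≤ ‖eZ (1/2 + (t:ℂ) * I)‖ ∧
    ‖eZ (1/2 + (t:ℂ) * I)‖ ≤ 3 * ‖riemannZeta (1/2 + (t:ℂ) * I)‖ := by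
  have hne : ((1/2:ℂ) + t * I) ≠ 1 := fun he => by
    have := congrArg Complex.im he; simp at this; linarith
  rw [eZ_zeta hne, norm_mul]
  exact ⟨by gcongr; exact q_low t, by gcongr; exact q_up t⟩

set_option maxHeartbeats 1000000 in
lemma peak_arc : ∃ C₀ : ℝ, 1 ≤ C₀ ∧ ∀ (P : Finset ℕ) (c p : ℝ), (∀ p ∈ P, 17 ≤ p) → |c| ≤ 1/2 → 4 ≤ p →
    C₀ * (1 + ZP P) ≤ Real.log p → ff P c (1/2 + (p:ℂ) * I) ≠ 0 →
    (∀ t : ℝ, ‖ff P c (1/2 + (t:ℂ) * I)‖ ≤ ‖ff P c (1/2 + (p:ℂ) * I)‖ * (1 + |t - p|)^2) →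
    ∀ θ : ℝ, |θ - Complex.arg (riemannZeta (1/2 + (p:ℂ) * I))| < Real.pi / 8 →
    ∃ t r : ℝ, |t - p| ≤ 1 ∧ 0 < r ∧ ‖eZ (1/2 + (p:ℂ) * I)‖ / 60 ≤ r ∧ r ≤ 60 * ‖eZ (1/2 + (p:ℂ) * I)‖ ∧
      riemannZeta (1/2 + (t:ℂ) * I) = r * cexp (I * θ) := by
  obtain ⟨C1, hC1, hleft⟩ := eZ_left
  obtain ⟨C2, hC2, harc⟩ := arc_lemma
  obtain ⟨C3, hC3, hgr⟩ := ff_growth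
  refine ⟨40000 * (C1 + C2), by linarith, fun P c p hP hc hp4 hlog hne hpk θ hθ => ?_⟩
  set L := 1/2 * Real.log p with hL
  have hZ := ZP_nonneg P
  have hL1 : 20000 * (C1 + C2) * (1 + ZP P) ≤ L := by rw [hL]; linarith
  have hL2 : 20000 * (C1 + C2) ≤ L := by nlinarith
  have hL3 : 20000 * ZP P ≤ L := by nlinarith
  have hL20 : 20000 ≤ L := by linarith
  have hL0 : 0 < L := by linarith
  have hδ0 : 0 < 0.41 / L := by positivity
  have hδ1 : 0.41 / L ≤ 1/10000 := by
    rw [div_le_iff₀ hL0]; linarith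
  have hlow : ∀ y : ℝ, |y| ≤ 0.41 / L → ‖ff P c (1/2 + (p:ℂ) * I)‖ / 5 ≤ ‖ff P c (1/2 + ((p + y : ℝ):ℂ) * I)‖ := by
    intro y hy
    refine LLgen (ff_diff hP c) (by positivity) (hgr P c hP hc) hL20 hpk hne ?_ hy
    intro x y hx0 hx hy
    have hy' := abs_le.mp hy
    rw [ff, ff, norm_mul, norm_mul, norm_pow, norm_pow]
    have h1 := hleft x (p + y) hx0 hx (by linarith)
    have h2 := RR_left hP hc hx0 (p + y)
    have hlogb : Real.log (p + y) ≤ Real.log p + 1 := by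
      have : p + y ≤ p * Real.exp 1 := by nlinarith [Real.add_one_le_exp 1]
      have h3 := Real.log_le_log (by linarith) this
      rwa [Real.log_mul (by linarith) (Real.exp_pos 1).ne', Real.log_exp] at h3
    calc _ ≤ (Real.exp (x * (Real.log (p+y) + C1)) * ‖eZ ((1/2 + x : ℝ) + ((p+y:ℝ):ℂ) * I)‖) * (Real.exp (2 * x * ZP P) * ‖RR P c ((1/2 + x : ℝ) + ((p+y:ℝ):ℂ) * I)‖)^2 := by gcongr
      _ = Real.exp (x * (Real.log (p+y) + C1) + (2 * x * ZP P + 2 * x * ZP P)) * (‖eZ ((1/2 + x : ℝ) + ((p+y:ℝ):ℂ) * I)‖ * ‖RR P c ((1/2 + x : ℝ) + ((p+y:ℝ):ℂ) * I)‖^2) := by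
        rw [Real.exp_add, Real.exp_add]; ring
      _ ≤ _ := by
        gcongr
        have : Real.log (p+y) + C1 + 4 * ZP P ≤ 2.02 * L := by
          have : Real.log p = 2 * L := by rw [hL]; ring
          linarith
        nlinarith
  have hRp := RR_pos hP hc (s := 1/2 + (p:ℂ) * I) (by simp)
  have hEp : 0 < ‖eZ (1/2 + (p:ℂ) * I)‖ := by
    rw [norm_pos_iff]; intro h; apply hne; rw [ff, h, zero_mul]
  have hE : ∀ y : ℝ, |y| ≤ 0.41 / L → ‖eZ (1/2 + (p:ℂ) * I)‖ / 20 ≤ ‖eZ (1/2 + ((p+y:ℝ):ℂ) * I)‖ ∧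
      ‖eZ (1/2 + ((p+y:ℝ):ℂ) * I)‖ ≤ 5 * ‖eZ (1/2 + (p:ℂ) * I)‖ := by
    intro y hy
    have hd : ‖((1/2:ℂ) + ((p+y:ℝ):ℂ) * I) - (1/2 + (p:ℂ) * I)‖ = |y| := by
      have : ((1/2:ℂ) + ((p+y:ℝ):ℂ) * I) - (1/2 + (p:ℂ) * I) = (y:ℂ) * I := by push_cast; ring
      rw [this]; simp
    have hexp : Real.exp (ZP P * |y|) ≤ 2 := by
      have h1 : ZP P * |y| ≤ 1/2 := by
        calc _ ≤ ZP P * (0.41 / L) := by gcongr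
          _ ≤ 1/2 := by rw [mul_div_assoc', div_le_iff₀ hL0]; linarith
      have h2 : Real.exp (1/2) ≤ 2 := by
        have := Real.exp_one_lt_d9
        have h3 : Real.exp (1/2) * Real.exp (1/2) = Real.exp 1 := by rw [← Real.exp_add]; norm_num
        nlinarith [Real.exp_pos (1/2)]
      exact (Real.exp_le_exp.mpr h1).trans h2
    have r1 := RR_ratio hP hc (s := 1/2 + ((p+y:ℝ):ℂ) * I) (s' := 1/2 + (p:ℂ) * I) (by simp) (by simp)
    have r2 := RR_ratio hP hc (s' := 1/2 + ((p+y:ℝ):ℂ) * I) (s := 1/2 + (p:ℂ) * I) (by simp) (by simp)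
    rw [norm_sub_rev, hd] at r2
    rw [hd] at r1
    have hRy := RR_pos hP hc (s := 1/2 + ((p+y:ℝ):ℂ) * I) (by simp)
    have l1 := hlow y hy
    have u1 := hpk (p + y)
    rw [ff, ff, norm_mul, norm_mul, norm_pow, norm_pow] at l1 u1
    have ey : p + y - p = y := by ring
    rw [ey] at u1
    set E0 := ‖eZ (1/2 + (p:ℂ) * I)‖
    set E1 := ‖eZ (1/2 + ((p+y:ℝ):ℂ) * I)‖
    set R0 := ‖RR P c (1/2 + (p:ℂ) * I)‖
    set R1 := ‖RR P c (1/2 + ((p+y:ℝ):ℂ) * I)‖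
    have r1' : R1 ≤ 2 * R0 := r1.trans (by gcongr)
    have r2' : R0 ≤ 2 * R1 := r2.trans (by gcongr)
    have hE1 : 0 ≤ E1 := norm_nonneg _
    constructor
    · have : R1^2 ≤ 4 * R0^2 := by nlinarith
      have h3 : E1 * R1^2 ≤ E1 * (4 * R0^2) := by gcongr
      have h4 : E0 / 20 * R0^2 ≤ E1 * R0^2 := by linarith
      exact le_of_mul_le_mul_right h4 (by positivity)
    · have h5 : R0^2 ≤ 4 * R1^2 := by nlinarith
      have h6 : (1 + |y|)^2 ≤ 5/4 := by nlinarith [abs_nonneg y]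
      have h4 : E1 * R1^2 ≤ (5 * E0) * R1^2 := by
        calc _ ≤ E0 * R0^2 * (1 + |y|)^2 := u1
          _ ≤ E0 * (4 * R1^2) * (5/4) := by gcongr
          _ = _ := by ring
      exact le_of_mul_le_mul_right h4 (by positivity)
  have hz := fun y hy => hE y hy
  obtain ⟨y, hy, r, hr, heq⟩ := harc p (0.41/L) hp4 hδ0 (by linarith) (by
      have h1 : 0.41 / L * (1/2 * Real.log p - C2) = 0.41 - 0.41 * C2 / L := by
        rw [← hL]; field_simp
      rw [h1]
      have h2 : 0.41 * C2 / L ≤ 1/10000 := by rw [div_le_iff₀ hL0]; linarith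
      have := Real.pi_lt_d2
      linarith) (fun y hy h0 => by
      have hy' : |y| ≤ 0.41/L := abs_le.mpr hy
      have := (eZ_vs_zeta (t := p + y) (by have := (abs_le.mp hy').1; linarith)).2
      rw [h0, norm_zero, mul_zero] at this
      have h2 := (hE y hy').1
      linarith) θ hθ
  have hy' : |y| ≤ 0.41/L := abs_le.mpr hy
  have hEy := hE y hy'
  have hv := eZ_vs_zeta (t := p + y) (by have := (abs_le.mp hy').1; linarith)
  have hrn : ‖riemannZeta (1/2 + ((p+y:ℝ):ℂ) * I)‖ = r := by
    rw [heq, norm_mul, Complex.norm_real, Real.norm_of_nonneg hr.le, mul_comm I, Complex.norm_exp_ofReal_mul_I, mul_one]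
  rw [hrn] at hv
  refine ⟨p + y, r, ?_, hr, by linarith, by linarith, heq⟩
  rw [show p + y - p = y by ring]; linarith

end

section

lemma final_red (S : ℕ → Set ℝ)
    (H : ∀ n : ℕ, ∃ α ∈ Icc (-Real.pi) Real.pi, ∀ θ : ℝ, |θ - α| < Real.pi / 8 → ∃ t r : ℝ, (n:ℝ) + 2 ≤ t ∧ 0 < r ∧ r ∈ S n ∧
      riemannZeta (1/2 + (t:ℂ) * I) = r * cexp (I * θ)) :
    ∃ θ₀ ∈ Ico (0:ℝ) (2 * Real.pi), ∀ θ ∈ Ioo (θ₀ - Real.pi / 8) (θ₀ + Real.pi / 8),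
      ∃ φ : ℕ → ℕ, StrictMono φ ∧ ∃ t r : ℕ → ℝ, (∀ n, (φ n : ℝ) + 2 ≤ t n) ∧ (∀ n, 0 < r n) ∧ (∀ n, r n ∈ S (φ n)) ∧
        ∀ n, riemannZeta (1/2 + (t n : ℂ) * I) = r n * cexp (I * θ) := by
  choose α hα h using H
  obtain ⟨a, ha, φ, hφ, hlim⟩ := isCompact_Icc.tendsto_subseq hα
  have main : ∀ θ : ℝ, |θ - a| < Real.pi / 8 → ∃ φ : ℕ → ℕ, StrictMono φ ∧ ∃ t r : ℕ → ℝ, (∀ n, (φ n : ℝ) + 2 ≤ t n) ∧ (∀ n, 0 < r n) ∧ (∀ n, r n ∈ S (φ n)) ∧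
        ∀ n, riemannZeta (1/2 + (t n : ℂ) * I) = r n * cexp (I * θ) := by
    intro θ hθ
    have h1 : Tendsto (fun n => |θ - (α ∘ φ) n|) atTop (𝓝 |θ - a|) := (hlim.const_sub θ).abs
    obtain ⟨N, hN⟩ := eventually_atTop.mp (h1.eventually (gt_mem_nhds hθ))
    choose t r h1 h2 h3 h4 using fun n => h (φ (n + N)) θ (hN (n + N) (by omega))
    exact ⟨fun n => φ (n + N), fun a b hab => hφ (by omega), t, r, h1, h2, h3, h4⟩
  have hpi := Real.pi_pos
  rcases le_or_gt 0 a with h0 | h0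
  · refine ⟨a, ⟨h0, by linarith [ha.2]⟩, fun θ hθ => main θ ?_⟩
    rw [abs_lt]; constructor <;> linarith [hθ.1, hθ.2]
  · refine ⟨a + 2 * Real.pi, ⟨by linarith [ha.1], by linarith⟩, fun θ hθ => ?_⟩
    obtain ⟨φ, hφ, t, r, h1, h2, h3, h4⟩ := main (θ - 2 * Real.pi) (by rw [abs_lt]; constructor <;> linarith [hθ.1, hθ.2])
    refine ⟨φ, hφ, t, r, h1, h2, h3, fun n => ?_⟩
    rw [h4]; congr 1
    rw [show I * ((θ - 2 * Real.pi : ℝ):ℂ) = I * θ - 2 * Real.pi * I by push_cast; ring, Complex.exp_sub, Complex.exp_two_pi_mul_I, div_one]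

lemma stmt_of
    (Ha : ∀ n : ℕ, ∃ α ∈ Icc (-Real.pi) Real.pi, ∀ θ : ℝ, |θ - α| < Real.pi / 8 → ∃ t r : ℝ, (n:ℝ) + 2 ≤ t ∧ 0 < r ∧ r ≤ 1/((n:ℝ)+1) ∧
      riemannZeta (1/2 + (t:ℂ) * I) = r * cexp (I * θ))
    (Hb : ∀ n : ℕ, ∃ α ∈ Icc (-Real.pi) Real.pi, ∀ θ : ℝ, |θ - α| < Real.pi / 8 → ∃ t r : ℝ, (n:ℝ) + 2 ≤ t ∧ 0 < r ∧ (n:ℝ) ≤ r ∧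
      riemannZeta (1/2 + (t:ℂ) * I) = r * cexp (I * θ)) :
    ∃ θ₀ ∈ Set.Ico (0 : ℝ) (2 * Real.pi), ∃ θinf ∈ Set.Ico (0 : ℝ) (2 * Real.pi),
      (∀ θ ∈ Set.Ioo (θ₀ - Real.pi / 8) (θ₀ + Real.pi / 8),
        ∃ t : ℕ → ℝ, ∃ r : ℕ → ℝ, (∀ n, 2 ≤ t n) ∧ Tendsto t atTop atTop ∧
          (∀ n, 0 < r n) ∧ Tendsto r atTop (𝓝 0) ∧
          ∀ n : ℕ, riemannZeta ((1 / 2 : ℂ) + (t n : ℝ) * Complex.I) =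
            (r n : ℝ) * Complex.exp (Complex.I * (θ : ℝ))) ∧
      (∀ θ ∈ Set.Ioo (θinf - Real.pi / 8) (θinf + Real.pi / 8),
        ∃ t : ℕ → ℝ, ∃ r : ℕ → ℝ, (∀ n, 2 ≤ t n) ∧ Tendsto t atTop atTop ∧
          (∀ n, 0 < r n) ∧ Tendsto r atTop atTop ∧
          ∀ n : ℕ, riemannZeta ((1 / 2 : ℂ) + (t n : ℝ) * Complex.I) =
            (r n : ℝ) * Complex.exp (Complex.I * (θ : ℝ))) := by
  obtain ⟨θ0, h0, A⟩ := final_red (fun n => {r | r ≤ 1/((n:ℝ)+1)}) Ha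
  obtain ⟨θ1, h1, B⟩ := final_red (fun n => {r | (n:ℝ) ≤ r}) Hb
  have tn : ∀ (φ : ℕ → ℕ), StrictMono φ → Tendsto (fun n => ((φ n : ℕ):ℝ)) atTop atTop := fun φ hφ =>
    tendsto_natCast_atTop_atTop.comp hφ.tendsto_atTop
  refine ⟨θ0, h0, θ1, h1, fun θ hθ => ?_, fun θ hθ => ?_⟩
  · obtain ⟨φ, hφ, t, r, a1, a2, a3, a4⟩ := A θ hθ
    refine ⟨t, r, fun n => ?_, ?_, a2, ?_, a4⟩
    · have := a1 n; have h : (0:ℝ) ≤ φ n := by positivity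
      linarith
    · exact tendsto_atTop_mono (fun n => by have := a1 n; linarith) (tn φ hφ)
    · have h := tendsto_one_div_add_atTop_nhds_zero_nat (𝕜 := ℝ) |>.comp hφ.tendsto_atTop
      exact squeeze_zero (fun n => (a2 n).le) a3 h
  · obtain ⟨φ, hφ, t, r, a1, a2, a3, a4⟩ := B θ hθ
    refine ⟨t, r, fun n => ?_, ?_, a2, ?_, a4⟩
    · have := a1 n; have h : (0:ℝ) ≤ φ n := by positivity
      linarith
    · exact tendsto_atTop_mono (fun n => by have := a1 n; linarith) (tn φ hφ)
    · exact tendsto_atTop_mono a3 (tn φ hφ)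

end

section

noncomputable def gw (u : ℝ) : ℝ := Real.exp (-u^2)

lemma gw_pos (u : ℝ) : 0 < gw u := Real.exp_pos _
lemma gw_cont : Continuous gw := by unfold gw; fun_prop

lemma gw_int : MeasureTheory.Integrable gw := by
  have := integrable_exp_neg_mul_sq (b := 1) one_pos
  unfold gw; simpa using this

lemma gw_integral : ∫ u, gw u = Real.sqrt Real.pi := by
  have := integral_gaussian 1
  simpa [gw] using this

lemma gw_fourier (ℓ T Δ : ℝ) : ∫ u : ℝ, cexp (-(((T + Δ * u) * ℓ : ℝ):ℂ) * I) * (gw u : ℂ) =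
    cexp (-((T * ℓ : ℝ):ℂ) * I) * (Real.sqrt Real.pi * Real.exp (-(Δ*ℓ)^2/4) : ℝ) := by
  have h := fourierIntegral_gaussian (b := 1) (by simp) (-(Δ * ℓ : ℝ) : ℂ)
  have e : (fun u : ℝ => cexp (-(((T + Δ * u) * ℓ : ℝ):ℂ) * I) * (gw u : ℂ)) =
      fun u : ℝ => cexp (-((T * ℓ : ℝ):ℂ) * I) * (cexp (I * (-(Δ * ℓ : ℝ) : ℂ) * u) * cexp (-1 * (u:ℂ)^2)) := by
    funext u
    rw [gw, Complex.ofReal_exp, ← Complex.exp_add, ← Complex.exp_add, ← Complex.exp_add]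
    congr 1; push_cast; ring
  rw [e, MeasureTheory.integral_const_mul, h]
  congr 1
  push_cast
  congr 1
  · rw [div_one, Real.sqrt_eq_rpow, Complex.ofReal_cpow Real.pi_pos.le]; norm_num
  · congr 1; ring

lemma norm_phase (x : ℝ) : ‖cexp (-(x:ℂ) * I)‖ = 1 := by
  have := Complex.norm_exp_ofReal_mul_I (-x); simpa using this

lemma phase_int (T Δ ℓ : ℝ) : MeasureTheory.Integrable fun u : ℝ => cexp (-(((T + Δ * u) * ℓ : ℝ):ℂ) * I) * (gw u : ℂ) := by
  refine MeasureTheory.Integrable.mono' gw_int (Continuous.aestronglyMeasurable (by have := gw_cont; fun_prop)) (Eventually.of_forall fun u => ?_)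
  rw [norm_mul, norm_phase, one_mul, Complex.norm_real, Real.norm_of_nonneg (gw_pos u).le]

lemma GM {ι : Type*} (s : Finset ι) (a : ι → ℂ) (ℓ : ι → ℝ) {δ : ℝ} (hδ : 0 ≤ δ) (hℓ : ∀ i ∈ s, ℓ i = 0 ∨ δ ≤ |ℓ i|) (T Δ : ℝ) :
    ‖(∫ u : ℝ, (∑ i ∈ s, a i * cexp (-(((T + Δ * u) * ℓ i : ℝ):ℂ) * I)) * (gw u : ℂ)) - Real.sqrt Real.pi * ∑ i ∈ s with ℓ i = 0, a i‖
      ≤ Real.sqrt Real.pi * Real.exp (-(Δ*δ)^2/4) * ∑ i ∈ s, ‖a i‖ := by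
  have e1 : (∫ u : ℝ, (∑ i ∈ s, a i * cexp (-(((T + Δ * u) * ℓ i : ℝ):ℂ) * I)) * (gw u : ℂ)) =
      ∑ i ∈ s, a i * (cexp (-((T * ℓ i : ℝ):ℂ) * I) * (Real.sqrt Real.pi * Real.exp (-(Δ*ℓ i)^2/4) : ℝ)) := by
    simp_rw [Finset.sum_mul, mul_assoc]
    rw [MeasureTheory.integral_finsetSum s fun i _ => (phase_int T Δ (ℓ i)).const_mul (a i)]
    refine Finset.sum_congr rfl fun i _ => ?_
    rw [MeasureTheory.integral_const_mul, gw_fourier]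
  rw [e1, Finset.sum_filter, Finset.mul_sum, Finset.mul_sum, ← Finset.sum_sub_distrib]
  refine (norm_sum_le _ _).trans (Finset.sum_le_sum fun i hi => ?_)
  by_cases h0 : ℓ i = 0
  · simp [h0]
    rw [mul_comm, sub_self]; simp; positivity
  · rw [if_neg h0, mul_zero, sub_zero, norm_mul, norm_mul, norm_phase, one_mul, Complex.norm_real, Real.norm_of_nonneg (by positivity), mul_comm]
    have h1 : δ ≤ |ℓ i| := (hℓ i hi).resolve_left h0
    have : (Δ*δ)^2 ≤ (Δ*ℓ i)^2 := by
      rw [mul_pow, mul_pow, ← sq_abs (ℓ i)]; gcongr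
    have h2 : Real.exp (-(Δ*ℓ i)^2/4) ≤ Real.exp (-(Δ*δ)^2/4) := Real.exp_le_exp.mpr (by linarith)
    gcongr

lemma log_sep {m n : ℕ} {N : ℝ} (hm : 1 ≤ m) (hn : 1 ≤ n) (hne : m ≠ n) (hmN : (n:ℝ) ≤ N) : 1/(2*N) ≤ |Real.log m - Real.log n| := by
  have hm' : (0:ℝ) < m := by exact_mod_cast hm
  have hn' : (1:ℝ) ≤ n := by exact_mod_cast hn
  rw [← Real.log_div hm'.ne' (by linarith)]
  have hN : 1 / (2*N) ≤ 1/(2*n) := by gcongr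
  refine hN.trans ?_
  rcases Nat.lt_or_gt_of_ne hne with h | h
  · -- m < n
    have h1 : (m:ℝ) + 1 ≤ n := by exact_mod_cast h
    have h2 := Real.log_le_sub_one_of_pos (x := m / n) (by positivity)
    have h3 : (m:ℝ)/n - 1 ≤ -(1/(2*n)) := by
      rw [div_sub_one (by linarith), div_le_iff₀ (by linarith)]
      have : -(1/(2*(n:ℝ))) * n = -(1/2) := by field_simp
      linarith
    rw [le_abs]; right; linarith
  · have h1 : (n:ℝ) + 1 ≤ m := by exact_mod_cast h
    have h2 := Real.one_sub_inv_le_log_of_pos (x := m / n) (by positivity)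
    rw [le_abs]; left
    refine le_trans ?_ h2
    rw [inv_div, le_sub_iff_add_le, div_add_div _ _ (by linarith) (by linarith), div_le_one (by positivity)]
    nlinarith

lemma natpow_phase {n : ℕ} (hn : 1 ≤ n) (t : ℝ) : (n:ℂ)^(-((t:ℂ) * I)) = cexp (-((t * Real.log n : ℝ):ℂ) * I) := by
  rw [Complex.cpow_def_of_ne_zero (by exact_mod_cast (by omega : n ≠ 0)), ← Complex.natCast_log]
  congr 1; push_cast; ring

/-- Gaussian mean square of a Dirichlet polynomial. -/
lemma MS (N : ℕ) (a : ℕ → ℂ) (T Δ : ℝ) :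
    ∫ u : ℝ, ‖∑ n ∈ Finset.Icc 1 N, a n * (n:ℂ)^(-(((T + Δ * u : ℝ):ℂ) * I))‖^2 * gw u ≤
      Real.sqrt Real.pi * (∑ n ∈ Finset.Icc 1 N, ‖a n‖^2 + Real.exp (-(Δ*(1/(2*N)))^2/4) * (∑ n ∈ Finset.Icc 1 N, ‖a n‖)^2) := by
  classical
  set s := Finset.Icc 1 N ×ˢ Finset.Icc 1 N
  set b : ℕ × ℕ → ℂ := fun i => a i.1 * (starRingEnd ℂ) (a i.2) with hb
  set ℓ : ℕ × ℕ → ℝ := fun i => Real.log i.1 - Real.log i.2 with hℓ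
  have h := GM s b ℓ (δ := 1/(2*N)) (by positivity) (fun i hi => by
    simp only [s, Finset.mem_product, Finset.mem_Icc] at hi
    by_cases h : i.1 = i.2
    · left; simp [hℓ, h]
    · right; exact log_sep hi.1.1 hi.2.1 h (by exact_mod_cast hi.2.2)) T Δ
  have e : ∀ u : ℝ, (∑ i ∈ s, b i * cexp (-(((T + Δ * u) * ℓ i : ℝ):ℂ) * I)) * (gw u : ℂ) =
      ((‖∑ n ∈ Finset.Icc 1 N, a n * (n:ℂ)^(-(((T + Δ * u : ℝ):ℂ) * I))‖^2 * gw u : ℝ) : ℂ) := by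
    intro u
    rw [Complex.ofReal_mul, Complex.ofReal_pow]
    congr 1
    rw [← Complex.mul_conj', map_sum, Finset.sum_mul_sum, ← Finset.sum_product']
    refine Finset.sum_congr rfl fun i hi => ?_
    simp only [s, Finset.mem_product, Finset.mem_Icc] at hi
    rw [natpow_phase hi.1.1, natpow_phase hi.2.1, map_mul, ← Complex.exp_conj]
    simp only [hb, hℓ]
    rw [mul_mul_mul_comm, ← Complex.exp_add]
    congr 2
    simp only [map_mul, map_neg, Complex.conj_ofReal, Complex.conj_I]
    push_cast; ring
  simp_rw [e] at h
  rw [integral_complex_ofReal] at h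
  have d : ∑ i ∈ s with ℓ i = 0, b i = ((∑ n ∈ Finset.Icc 1 N, ‖a n‖^2 : ℝ) : ℂ) := by
    push_cast
    rw [Finset.sum_filter, Finset.sum_product]
    refine Finset.sum_congr rfl fun n hn => ?_
    rw [Finset.sum_eq_single n]
    · simp [hℓ, hb, Complex.mul_conj']
    · intro m hm hmn
      rw [if_neg]
      simp only [hℓ]
      rw [sub_eq_zero]
      intro hl
      simp only [Finset.mem_Icc] at hm hn
      have := Real.log_injOn_pos (by simp; omega) (by simp; omega) hl
      exact hmn (by exact_mod_cast this.symm)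
    · intro h; exact absurd hn h
  rw [d] at h
  have sn : ∑ i ∈ s, ‖b i‖ = (∑ n ∈ Finset.Icc 1 N, ‖a n‖)^2 := by
    rw [sq, Finset.sum_mul_sum, ← Finset.sum_product']
    refine Finset.sum_congr rfl fun i _ => ?_
    simp [hb]
  rw [sn, ← Complex.ofReal_mul] at h
  have h2 := (Complex.re_le_norm _).trans h
  rw [Complex.sub_re, Complex.ofReal_re, Complex.ofReal_re] at h2
  linarith

end

section

def pr (A : Finset ℕ) : ℕ := ∏ p ∈ A, p

lemma pr_pos {A : Finset ℕ} (hA : ∀ p ∈ A, p.Prime) : 1 ≤ pr A :=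
  Finset.prod_pos fun p hp => (hA p hp).pos

lemma pr_le {A P : Finset ℕ} (hP : ∀ p ∈ P, p.Prime) (h : A ⊆ P) : pr A ≤ pr P :=
  Finset.prod_le_prod_of_subset_of_one_le' h fun p hp _ => (hP p hp).one_lt.le

lemma RR_line {P : Finset ℕ} (hP : ∀ p ∈ P, p.Prime) (c t : ℝ) :
    RR P c (1/2 + (t:ℂ) * I) = ∑ A ∈ P.powerset, (c:ℂ)^A.card * cexp (-((t * Real.log (pr A) : ℝ):ℂ) * I) := by
  rw [RR, Finset.prod_one_add]
  refine Finset.sum_congr rfl fun A hA => ?_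
  have hA' : ∀ p ∈ A, p.Prime := fun p hp => hP p (Finset.mem_powerset.mp hA hp)
  rw [Finset.prod_mul_distrib, Finset.prod_const, pr, Nat.cast_prod, Real.log_prod (fun p hp => by
    exact_mod_cast (hA' p hp).ne_zero)]
  congr 1
  rw [Finset.mul_sum]
  push_cast
  rw [← Finset.sum_neg_distrib, Finset.sum_mul, Complex.exp_sum]
  refine Finset.prod_congr rfl fun p hp => ?_
  have := natpow_phase (hA' p hp).one_lt.le t
  rw [show (1/2 - (1/2 + (t:ℂ) * I)) = -((t:ℂ) * I) by ring, this]
  push_cast; rfl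

lemma sum_powerset_card (P : Finset ℕ) (c : ℝ) : ∑ A ∈ P.powerset, c^A.card = (1 + c)^P.card := by
  have := Finset.prod_one_add (f := fun _ : ℕ => c) P
  simp only [Finset.prod_const] at this
  exact this.symm

lemma GM_R {P : Finset ℕ} (hP : ∀ p ∈ P, p.Prime) {c : ℝ} (hc : |c| ≤ 1/2) (S : Finset ℕ) (hS : ∀ n ∈ S, 1 ≤ n)
    (b : ℕ → ℂ) (T Δ : ℝ) :
    ‖(∫ u : ℝ, ((∑ n ∈ S, b n * (n:ℂ)^(-(((T + Δ * u : ℝ):ℂ) * I))) * (‖RR P c (1/2 + ((T + Δ * u : ℝ):ℂ) * I)‖^2 : ℝ)) * (gw u : ℂ))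
      - Real.sqrt Real.pi * ∑ B ∈ P.powerset, ∑ A ∈ P.powerset, ∑ n ∈ S, if n * pr A = pr B then b n * (c:ℂ)^A.card * (c:ℂ)^B.card else 0‖
      ≤ Real.sqrt Real.pi * Real.exp (-(Δ*(1/(2*(pr P:ℝ))))^2/4) * ((∑ n ∈ S, ‖b n‖) * ((3/2:ℝ)^P.card)^2) := by
  classical
  set s := P.powerset ×ˢ P.powerset ×ˢ S with hs
  set a : Finset ℕ × Finset ℕ × ℕ → ℂ := fun i => b i.2.2 * (c:ℂ)^i.2.1.card * (c:ℂ)^i.1.card with ha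
  set ℓ : Finset ℕ × Finset ℕ × ℕ → ℝ := fun i => Real.log ((i.2.2 * pr i.2.1 : ℕ):ℝ) - Real.log (pr i.1) with hℓ
  have hpp : ∀ A ∈ P.powerset, 1 ≤ pr A := fun A hA => pr_pos fun p hp => hP p (Finset.mem_powerset.mp hA hp)
  have hz : ∀ i ∈ s, ℓ i = 0 ↔ i.2.2 * pr i.2.1 = pr i.1 := by
    intro i hi
    simp only [hs, Finset.mem_product] at hi
    have h1 := hpp _ hi.1
    have h2 := hpp _ hi.2.1
    have h3 := hS _ hi.2.2
    simp only [hℓ]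
    rw [sub_eq_zero]
    constructor
    · intro h
      have h4 : 0 < i.2.2 * pr i.2.1 := Nat.mul_pos h3 h2
      have := Real.log_injOn_pos (by simp only [Set.mem_Ioi]; exact_mod_cast h4) (by simp only [Set.mem_Ioi]; exact_mod_cast h1) h
      exact_mod_cast this
    · intro h; rw [h]
  have h := GM s a ℓ (δ := 1/(2*(pr P:ℝ))) (by positivity) (fun i hi => by
    by_cases h0 : i.2.2 * pr i.2.1 = pr i.1
    · left; exact (hz i hi).mpr h0
    · right
      simp only [hs, Finset.mem_product] at hi
      refine log_sep (Nat.mul_pos (hS _ hi.2.2) (hpp _ hi.2.1)) (hpp _ hi.1) h0 ?_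
      exact_mod_cast pr_le hP (Finset.mem_powerset.mp hi.1)) T Δ
  have e : ∀ u : ℝ, (∑ i ∈ s, a i * cexp (-(((T + Δ * u) * ℓ i : ℝ):ℂ) * I)) * (gw u : ℂ) =
      ((∑ n ∈ S, b n * (n:ℂ)^(-(((T + Δ * u : ℝ):ℂ) * I))) * (‖RR P c (1/2 + ((T + Δ * u : ℝ):ℂ) * I)‖^2 : ℝ)) * (gw u : ℂ) := by
    intro u
    congr 1
    generalize T + Δ * u = t
    rw [Complex.ofReal_pow, ← Complex.conj_mul', RR_line hP, map_sum, mul_left_comm, Finset.sum_mul,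
      hs, Finset.sum_product]
    refine Finset.sum_congr rfl fun B hB => ?_
    rw [Finset.sum_product, mul_comm (∑ n ∈ S, _) (∑ A ∈ P.powerset, _), Finset.sum_mul_sum]
    simp_rw [Finset.mul_sum]
    refine Finset.sum_congr rfl fun A hA => Finset.sum_congr rfl fun n hn => ?_
    rw [natpow_phase (hS n hn), map_mul, ← Complex.exp_conj]
    simp only [ha, hℓ]
    have h1 : Real.log ((n * pr A : ℕ):ℝ) = Real.log n + Real.log (pr A) := by
      push_cast
      rw [Real.log_mul (by have := hS n hn; exact_mod_cast (by omega : n ≠ 0)) (by have := hpp A hA; exact_mod_cast (by omega : pr A ≠ 0))]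
    rw [h1, map_pow, Complex.conj_ofReal]
    simp only [map_mul, map_neg, Complex.conj_ofReal, Complex.conj_I]
    have h2 : cexp (-((t * (Real.log n + Real.log (pr A) - Real.log (pr B)) : ℝ):ℂ) * I) =
        cexp (-((t * Real.log (pr B) : ℝ):ℂ) * -I) * (cexp (-((t * Real.log (pr A) : ℝ):ℂ) * I) * cexp (-((t * Real.log n : ℝ):ℂ) * I)) := by
      rw [← Complex.exp_add, ← Complex.exp_add]; congr 1; push_cast; ring
    rw [h2]; ring
  simp_rw [e] at h
  have d : ∑ i ∈ s with ℓ i = 0, a i = ∑ B ∈ P.powerset, ∑ A ∈ P.powerset, ∑ n ∈ S, if n * pr A = pr B then b n * (c:ℂ)^A.card * (c:ℂ)^B.card else 0 := by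
    rw [Finset.sum_filter]
    have : ∀ i ∈ s, (if ℓ i = 0 then a i else 0) = if i.2.2 * pr i.2.1 = pr i.1 then a i else 0 := fun i hi => by
      simp only [hz i hi]
    rw [Finset.sum_congr rfl this, hs, Finset.sum_product]
    refine Finset.sum_congr rfl fun B _ => ?_
    rw [Finset.sum_product]
  rw [d] at h
  have sn : ∑ i ∈ s, ‖a i‖ ≤ (∑ n ∈ S, ‖b n‖) * ((3/2:ℝ)^P.card)^2 := by
    have h1 : ∑ i ∈ s, ‖a i‖ = (∑ n ∈ S, ‖b n‖) * ((1+|c|)^P.card)^2 := by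
      rw [hs, Finset.sum_product]
      simp_rw [Finset.sum_product]
      rw [← sum_powerset_card, sq, mul_comm, mul_assoc, Finset.sum_mul, ]
      refine Finset.sum_congr rfl fun B _ => ?_
      rw [Finset.sum_mul_sum, Finset.mul_sum]
      refine Finset.sum_congr rfl fun A _ => ?_
      rw [Finset.mul_sum]
      refine Finset.sum_congr rfl fun n _ => ?_
      simp only [ha, norm_mul, norm_pow, Complex.norm_real, Real.norm_eq_abs]; ring
    rw [h1]
    have : (1 + |c|) ≤ 3/2 := by linarith
    gcongr
  refine h.trans ?_
  gcongr

noncomputable def bE (n : ℕ) : ℂ := (((-1)^(n+1) * (n:ℝ)^(-(1/2):ℝ) : ℝ) : ℂ)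

lemma bE_norm {n : ℕ} (hn : 1 ≤ n) : ‖bE n‖ ≤ 1 := by
  rw [bE, Complex.norm_real, norm_mul, norm_pow, norm_neg, norm_one, one_pow, one_mul, Real.norm_of_nonneg (by positivity)]
  exact Real.rpow_le_one_of_one_le_of_nonpos (by exact_mod_cast hn) (by norm_num)

lemma bE_term {n : ℕ} (hn : 1 ≤ n) (t : ℝ) : bE n * (n:ℂ)^(-((t:ℂ) * I)) = (-1:ℂ)^(n+1) * (n:ℂ)^(-((1/2:ℂ) + t * I)) := by
  rw [bE, Complex.ofReal_mul, mul_assoc, Complex.ofReal_cpow (by positivity), Complex.ofReal_natCast, ← Complex.cpow_add _ _ (by exact_mod_cast (by omega : n ≠ 0))]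
  push_cast
  congr 2; ring

lemma sub_of_dvd {A B : Finset ℕ} (hA : ∀ p ∈ A, p.Prime) (hB : ∀ p ∈ B, p.Prime) {n : ℕ} (h : n * pr A = pr B) : A ⊆ B := by
  intro p hp
  have h1 : p ∣ pr B := by rw [← h]; exact Dvd.dvd.mul_left (Finset.dvd_prod_of_mem _ hp) n
  obtain ⟨q, hq, hd⟩ := (hA p hp).prime.dvd_finsetProd_iff (fun q => q) |>.mp h1
  rwa [(Nat.prime_dvd_prime_iff_eq (hA p hp) (hB q hq)).mp hd]

lemma diag_value {P : Finset ℕ} (hP : ∀ p ∈ P, p.Prime ∧ 17 ≤ p) (c : ℝ) {X : ℕ} (hX : pr P ≤ X) :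
    (∑ B ∈ P.powerset, ∑ A ∈ P.powerset, ∑ n ∈ Finset.Icc 1 X, if n * pr A = pr B then bE n * (c:ℂ)^A.card * (c:ℂ)^B.card else 0)
      = ((∏ p ∈ P, (1 + c * (c + (p:ℝ)^(-(1/2):ℝ))) : ℝ) : ℂ) := by
  rw [Finset.prod_one_add]
  push_cast
  refine Finset.sum_congr rfl fun B hB => ?_
  have hBP := Finset.mem_powerset.mp hB
  have hBp : ∀ p ∈ B, p.Prime := fun p hp => (hP p (hBP hp)).1
  have hsub : B.powerset ⊆ P.powerset := Finset.powerset_mono.mpr hBP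
  rw [← Finset.sum_subset hsub (by
    intro A hA hAB
    have hAp : ∀ p ∈ A, p.Prime := fun p hp => (hP p (Finset.mem_powerset.mp hA hp)).1
    refine Finset.sum_eq_zero fun n _ => if_neg fun h => hAB ?_
    exact Finset.mem_powerset.mpr (sub_of_dvd hAp hBp h)), Finset.prod_mul_distrib, Finset.prod_const, Finset.prod_add, Finset.mul_sum]
  refine Finset.sum_congr rfl fun A hA => ?_
  have hAB := Finset.mem_powerset.mp hA
  have hDp : ∀ p ∈ B \ A, p.Prime := fun p hp => hBp p (Finset.sdiff_subset hp)
  have hAp : ∀ p ∈ A, p.Prime := fun p hp => hBp p (hAB hp)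
  have hmul : pr (B \ A) * pr A = pr B := Finset.prod_sdiff hAB
  have hDle : pr (B \ A) ≤ X := (pr_le (fun p hp => (hP p hp).1) (Finset.sdiff_subset.trans hBP)).trans hX
  rw [Finset.sum_eq_single (pr (B \ A))]
  · rw [if_pos hmul, Finset.prod_const]
    have hodd : Odd (pr (B \ A)) := by
      have : ∀ D : Finset ℕ, (∀ p ∈ D, Odd p) → Odd (pr D) := fun D hD => by
        unfold pr
        exact Finset.prod_induction _ Odd (fun a b ha hb => ha.mul hb) odd_one hD
      exact this _ fun p hp => (hDp p hp).odd_of_ne_two (by have := (hP p (hBP (Finset.sdiff_subset hp))).2; omega)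
    have hb : bE (pr (B \ A)) = ∏ p ∈ B \ A, (((p:ℝ)^(-(1/2):ℝ) : ℝ) : ℂ) := by
      rw [bE, (hodd.add_one).neg_one_pow, one_mul, pr, Nat.cast_prod, ← Real.finsetProd_rpow _ _ (fun p _ => by positivity)]
      push_cast; rfl
    rw [hb]; ring
  · intro n _ hn
    refine if_neg fun h => hn ?_
    exact Nat.eq_of_mul_eq_mul_right (pr_pos hAp) (h.trans hmul.symm)
  · intro h
    exact absurd (Finset.mem_Icc.mpr ⟨pr_pos hDp, hDle⟩) h

lemma diag_one {P : Finset ℕ} (hP : ∀ p ∈ P, p.Prime) (c : ℝ) :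
    (∑ B ∈ P.powerset, ∑ A ∈ P.powerset, ∑ n ∈ ({1} : Finset ℕ), if n * pr A = pr B then (1:ℂ) * (c:ℂ)^A.card * (c:ℂ)^B.card else 0)
      = (((1 + c^2)^P.card : ℝ) : ℂ) := by
  rw [← sum_powerset_card]
  push_cast
  refine Finset.sum_congr rfl fun B hB => ?_
  have hBP := Finset.mem_powerset.mp hB
  have hBp : ∀ p ∈ B, p.Prime := fun p hp => hP p (hBP hp)
  simp only [Finset.sum_singleton, one_mul]
  rw [Finset.sum_eq_single B]
  · rw [if_pos rfl]; ring
  · intro A hA hne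
    have hAp : ∀ p ∈ A, p.Prime := fun p hp => hP p (Finset.mem_powerset.mp hA hp)
    refine if_neg fun h => hne (Finset.Subset.antisymm ?_ ?_)
    · exact sub_of_dvd (n := 1) hAp hBp (by rw [one_mul, h])
    · exact sub_of_dvd (n := 1) hBp hAp (by rw [one_mul, h])
  · intro h; exact absurd hB h

end

section

lemma w_int : MeasureTheory.Integrable fun u : ℝ => (1 + |u|) * Real.exp (-u^2/2) := by
  have h1 : MeasureTheory.Integrable fun u : ℝ => Real.exp (-(1/4) * u^2) := integrable_exp_neg_mul_sq (by norm_num)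
  refine (h1.const_mul 4).mono' (by fun_prop) (Eventually.of_forall fun u => ?_)
  rw [Real.norm_of_nonneg (by positivity), show -u^2/2 = -(1/4)*u^2 + -(1/4)*u^2 by ring, Real.exp_add, ← mul_assoc]
  refine mul_le_mul_of_nonneg_right ?_ (Real.exp_pos _).le
  have h2 : (1/4)*u^2 + 1 ≤ Real.exp ((1/4)*u^2) := Real.add_one_le_exp _
  have h3 : Real.exp (-(1/4)*u^2) * Real.exp ((1/4)*u^2) = 1 := by rw [← Real.exp_add]; simp
  have h4 : 1 + |u| ≤ 4 * ((1/4)*u^2 + 1) := by nlinarith [sq_abs u, sq_nonneg (|u|-1)]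
  have h5 := Real.exp_pos (-(1/4)*u^2)
  nlinarith

noncomputable def WW : ℝ := ∫ u : ℝ, (1 + |u|) * Real.exp (-u^2/2)

lemma gw_le (u : ℝ) : gw u ≤ Real.exp (-u^2/2) := by
  unfold gw; apply Real.exp_le_exp.mpr; nlinarith [sq_nonneg u]

lemma WW_nonneg : 0 ≤ WW := MeasureTheory.integral_nonneg fun u => by positivity

lemma lin_le (T Δ u : ℝ) : 1 + |T + Δ * u| ≤ (1 + |T| + |Δ|) * (1 + |u|) := by
  have h1 : |T + Δ*u| ≤ |T| + |Δ| * |u| := by rw [← abs_mul]; exact abs_add_le _ _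
  nlinarith [abs_nonneg T, abs_nonneg u, abs_nonneg Δ, mul_nonneg (abs_nonneg T) (abs_nonneg u)]

/-- truncation to the central part -/
lemma central {F H : ℝ → ℝ} {A T Δ U : ℝ} (hA : 0 ≤ A) (hU : 0 ≤ U)
    (hF : ∀ u, U ≤ |u| → F u ≤ A * (1 + |T + Δ * u|)) (hH0 : ∀ u, 0 ≤ H u) (hFH : ∀ u, |u| ≤ U → F u ≤ H u)
    (hFi : MeasureTheory.Integrable fun u => F u * gw u) (hHi : MeasureTheory.Integrable fun u => H u * gw u) :
    ∫ u, F u * gw u ≤ (∫ u, H u * gw u) + A * (1 + |T| + |Δ|) * WW * Real.exp (-U^2/2) := by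
  have e : A * (1 + |T| + |Δ|) * WW * Real.exp (-U^2/2) = ∫ u, (A * (1 + |T| + |Δ|) * Real.exp (-U^2/2)) * ((1 + |u|) * Real.exp (-u^2/2)) := by
    rw [MeasureTheory.integral_const_mul, WW]; ring
  have hi := w_int.const_mul (A * (1 + |T| + |Δ|) * Real.exp (-U^2/2))
  rw [e, ← MeasureTheory.integral_add hHi hi]
  refine MeasureTheory.integral_mono hFi (hHi.add hi) fun u => ?_
  beta_reduce
  rcases le_total |u| U with h | h
  · have := mul_le_mul_of_nonneg_right (hFH u h) (gw_pos u).le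
    have h2 : 0 ≤ (A * (1 + |T| + |Δ|) * Real.exp (-U^2/2)) * ((1 + |u|) * Real.exp (-u^2/2)) := by positivity
    linarith
  · have h1 := mul_nonneg (hH0 u) (gw_pos u).le
    have h2 : gw u ≤ Real.exp (-U^2/2) * Real.exp (-u^2/2) := by
      rw [gw, ← Real.exp_add]; apply Real.exp_le_exp.mpr
      have : U^2 ≤ u^2 := by rw [← sq_abs u]; gcongr
      linarith
    have h3 : F u ≤ A * ((1 + |T| + |Δ|) * (1 + |u|)) := (hF u h).trans (by gcongr; exact lin_le T Δ u)
    have h4 : F u * gw u ≤ A * ((1 + |T| + |Δ|) * (1 + |u|)) * (Real.exp (-U^2/2) * Real.exp (-u^2/2)) :=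
      (mul_le_mul_of_nonneg_right h3 (gw_pos u).le).trans (by gcongr)
    calc _ ≤ _ := h4
      _ = (A * (1 + |T| + |Δ|) * Real.exp (-U^2/2)) * ((1 + |u|) * Real.exp (-u^2/2)) := by ring
      _ ≤ _ := by linarith

/-- integrability for functions of linear growth -/
lemma gw_growth_int {E : Type*} [NormedAddCommGroup E] [NormedSpace ℝ E] {F : ℝ → E} (hF : Continuous F) {A T Δ : ℝ} (hA : 0 ≤ A) (hb : ∀ u, ‖F u‖ ≤ A * (1 + |T + Δ * u|) * gw u) :
    MeasureTheory.Integrable F := by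
  refine (w_int.const_mul (A * (1 + |T| + |Δ|))).mono' hF.aestronglyMeasurable (Eventually.of_forall fun u => ?_)
  refine (hb u).trans ?_
  calc _ ≤ A * ((1 + |T| + |Δ|) * (1 + |u|)) * Real.exp (-u^2/2) := by
        have := lin_le T Δ u
        have := gw_le u
        have := (gw_pos u).le
        gcongr
    _ = _ := by ring

lemma gw_growth_bd {F : ℝ → ℂ} (hF : Continuous F) {A T Δ : ℝ} (hA : 0 ≤ A) (hb : ∀ u, ‖F u‖ ≤ A * (1 + |T + Δ * u|) * gw u) :
    ‖∫ u, F u‖ ≤ A * (1 + |T| + |Δ|) * WW := by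
  rw [WW, ← MeasureTheory.integral_const_mul]
  refine MeasureTheory.norm_integral_le_of_norm_le (w_int.const_mul _) (Eventually.of_forall fun u => (hb u).trans ?_)
  calc _ ≤ A * ((1 + |T| + |Δ|) * (1 + |u|)) * Real.exp (-u^2/2) := by
        have := lin_le T Δ u
        have := gw_le u
        have := (gw_pos u).le
        gcongr
    _ = _ := by ring

lemma RR_line_cont {P : Finset ℕ} (hP : ∀ p ∈ P, 17 ≤ p) (c : ℝ) : Continuous fun t : ℝ => RR P c (1/2 + (t:ℂ) * I) :=
  (RR_diff hP c).continuous.comp (by fun_prop)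

lemma M1 : ∃ C : ℝ, 1 ≤ C ∧ ∀ (P : Finset ℕ) (c T Δ : ℝ) (K : ℕ), (∀ p ∈ P, p.Prime ∧ 17 ≤ p) → |c| ≤ 1/2 → pr P ≤ 2*K →
    ‖(∫ u : ℝ, (eZ (1/2 + ((T + Δ * u : ℝ):ℂ) * I) * (‖RR P c (1/2 + ((T + Δ * u : ℝ):ℂ) * I)‖^2 : ℝ)) * (gw u : ℂ))
      - Real.sqrt Real.pi * ((∏ p ∈ P, (1 + c * (c + (p:ℝ)^(-(1/2):ℝ))) : ℝ) : ℂ)‖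
      ≤ Real.sqrt Real.pi * Real.exp (-(Δ*(1/(2*(pr P:ℝ))))^2/4) * ((2*K) * ((3/2:ℝ)^P.card)^2)
        + C * ((K:ℝ)+1)^(-(1/4):ℝ) * ((3/2:ℝ)^P.card)^2 * (1 + |T| + |Δ|) := by
  obtain ⟨C, hC1, hC⟩ := eZ_approx
  refine ⟨max 1 (C * WW), le_max_left _ _, fun P c T Δ K hP hc hK => ?_⟩
  have hP1 : ∀ p ∈ P, p.Prime := fun p hp => (hP p hp).1
  have hP2 : ∀ p ∈ P, 17 ≤ p := fun p hp => (hP p hp).2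
  have hg := GM_R hP1 hc (Finset.Icc 1 (2*K)) (fun n hn => (Finset.mem_Icc.mp hn).1) bE T Δ
  rw [diag_value hP c hK] at hg
  set D : ℝ → ℂ := fun t => ∑ n ∈ Finset.Icc 1 (2*K), bE n * (n:ℂ)^(-((t:ℂ) * I)) with hD
  have hDeq : ∀ t : ℝ, D t = ∑ n ∈ Finset.range (2*K+1), (-1:ℂ)^(n+1) * (n:ℂ)^(-((1/2:ℂ) + t * I)) := by
    intro t
    rw [Finset.sum_range_succ', hD]
    have h0 : ((0:ℕ):ℂ)^(-((1/2:ℂ) + t * I)) = 0 := by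
      rw [Nat.cast_zero, Complex.zero_cpow]
      intro h; have := congrArg Complex.re h; simp at this
    rw [h0, mul_zero, add_zero, Finset.range_eq_Ico, Finset.sum_Ico_add' (fun n : ℕ => (-1:ℂ)^(n+1) * (n:ℂ)^(-((1/2:ℂ) + t * I))) 0 (2*K) 1]
    refine Finset.sum_congr (by ext; simp only [Finset.mem_Icc, Finset.mem_Ico]; omega) fun n hn => bE_term (by simp at hn; omega) t
  have hDc : Continuous D := by
    have : D = fun t : ℝ => ∑ n ∈ Finset.Icc 1 (2*K), bE n * cexp (-((t * Real.log n : ℝ):ℂ) * I) := by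
      ext t; exact Finset.sum_congr rfl fun n hn => by rw [natpow_phase (Finset.mem_Icc.mp hn).1]
    rw [this]; fun_prop
  have hEc : Continuous fun t : ℝ => eZ (1/2 + (t:ℂ) * I) := eZ_diff.continuous.comp (by fun_prop)
  have hRc := RR_line_cont hP2 c
  have hd : ∀ t : ℝ, ‖eZ (1/2 + (t:ℂ) * I) - D t‖ ≤ C * ((K:ℝ)+1)^(-(1/4):ℝ) * (1 + |t|) := by
    intro t
    rw [hDeq]
    refine (hC K (1/2 + (t:ℂ) * I) (by simp)).trans ?_
    rw [mul_right_comm]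
    exact mul_le_mul_of_nonneg_left (norm_half_add t) (by positivity)
  have hR : ∀ t : ℝ, ‖RR P c (1/2 + (t:ℂ) * I)‖^2 ≤ ((3/2:ℝ)^P.card)^2 := fun t => by
    have := RR_up hP2 hc (s := 1/2 + (t:ℂ) * I) (by simp)
    gcongr
  set G : ℝ → ℂ := fun u => ((eZ (1/2 + ((T + Δ * u : ℝ):ℂ) * I) - D (T + Δ*u)) * (‖RR P c (1/2 + ((T + Δ * u : ℝ):ℂ) * I)‖^2 : ℝ)) * (gw u : ℂ) with hG
  have hGb : ∀ u, ‖G u‖ ≤ C * ((K:ℝ)+1)^(-(1/4):ℝ) * ((3/2:ℝ)^P.card)^2 * (1 + |T + Δ*u|) * gw u := by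
    intro u
    rw [hG, norm_mul, norm_mul, Complex.norm_real, Complex.norm_real, Real.norm_of_nonneg (gw_pos u).le, Real.norm_of_nonneg (by positivity)]
    refine mul_le_mul_of_nonneg_right ?_ (gw_pos u).le
    calc _ ≤ (C * ((K:ℝ)+1)^(-(1/4):ℝ) * (1 + |T + Δ*u|)) * ((3/2:ℝ)^P.card)^2 :=
          mul_le_mul (hd _) (hR _) (by positivity) (by positivity)
      _ = _ := by ring
  have hGc : Continuous G := by
    have h1 : Continuous fun u : ℝ => T + Δ*u := by fun_prop
    have h2 := hEc.comp h1
    have h3 := hRc.comp h1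
    have h4 := hDc.comp h1
    have h5 := gw_cont
    exact ((h2.sub h4).mul (Complex.continuous_ofReal.comp (h3.norm.pow 2))).mul (Complex.continuous_ofReal.comp h5)
  have hGi := gw_growth_int hGc (by positivity) hGb
  have hGn := gw_growth_bd hGc (by positivity) hGb
  have hDi : MeasureTheory.Integrable fun u : ℝ => (D (T + Δ*u) * (‖RR P c (1/2 + ((T + Δ * u : ℝ):ℂ) * I)‖^2 : ℝ)) * (gw u : ℂ) := by
    have h1 : Continuous fun u : ℝ => T + Δ*u := by fun_prop
    refine gw_growth_int (T := 0) (Δ := 0) (A := (2*K) * ((3/2:ℝ)^P.card)^2) (((hDc.comp h1).mul (Complex.continuous_ofReal.comp ((hRc.comp h1).norm.pow 2))).mul (Complex.continuous_ofReal.comp gw_cont)) (by positivity) fun u => ?_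
    rw [norm_mul, norm_mul, Complex.norm_real, Complex.norm_real, Real.norm_of_nonneg (gw_pos u).le, Real.norm_of_nonneg (by positivity)]
    simp only [zero_mul, add_zero, abs_zero, mul_one]
    refine mul_le_mul_of_nonneg_right (mul_le_mul ?_ (hR _) (by positivity) (by positivity)) (gw_pos u).le
    refine (norm_sum_le_of_le (f := fun n => bE n * (n:ℂ)^(-(((T+Δ*u:ℝ):ℂ) * I))) _ (fun n hn => ?_)).trans ((Finset.sum_const (1:ℝ)).le.trans (by simp))
    rw [natpow_phase (Finset.mem_Icc.mp hn).1, norm_mul, norm_phase, mul_one]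
    exact bE_norm (Finset.mem_Icc.mp hn).1
  have hsplit : (∫ u : ℝ, (eZ (1/2 + ((T + Δ * u : ℝ):ℂ) * I) * (‖RR P c (1/2 + ((T + Δ * u : ℝ):ℂ) * I)‖^2 : ℝ)) * (gw u : ℂ)) =
      (∫ u, G u) + ∫ u : ℝ, (D (T + Δ*u) * (‖RR P c (1/2 + ((T + Δ * u : ℝ):ℂ) * I)‖^2 : ℝ)) * (gw u : ℂ) := by
    rw [← MeasureTheory.integral_add hGi hDi]
    congr 1; ext u; simp only [hG]; ring
  rw [hsplit, add_sub_assoc]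
  refine (norm_add_le _ _).trans ?_
  rw [add_comm]
  refine add_le_add (hg.trans ?_) (hGn.trans ?_)
  · have : ∑ n ∈ Finset.Icc 1 (2*K), ‖bE n‖ ≤ 2*K := by
      refine (Finset.sum_le_sum fun n hn => bE_norm (Finset.mem_Icc.mp hn).1).trans ?_
      simp
    gcongr
  · have : C * WW ≤ max 1 (C*WW) := le_max_right _ _
    calc _ = (C * WW) * (((K:ℝ)+1)^(-(1/4):ℝ) * ((3/2:ℝ)^P.card)^2 * (1 + |T| + |Δ|)) := by ring
      _ ≤ max 1 (C*WW) * (((K:ℝ)+1)^(-(1/4):ℝ) * ((3/2:ℝ)^P.card)^2 * (1 + |T| + |Δ|)) := by gcongr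
      _ = _ := by ring

lemma M0 {P : Finset ℕ} {c : ℝ} (T Δ : ℝ) (hP : ∀ p ∈ P, p.Prime ∧ 17 ≤ p) (hc : |c| ≤ 1/2) :
    (∫ u : ℝ, ‖RR P c (1/2 + ((T + Δ * u : ℝ):ℂ) * I)‖^2 * gw u) ≤
      Real.sqrt Real.pi * ((1+c^2)^P.card + Real.exp (-(Δ*(1/(2*(pr P:ℝ))))^2/4) * ((3/2:ℝ)^P.card)^2) := by
  have hg := GM_R (fun p hp => (hP p hp).1) hc {1} (by simp) (fun _ => 1) T Δ
  rw [diag_one (fun p hp => (hP p hp).1)] at hg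
  have e : (∫ u : ℝ, ((∑ n ∈ ({1}:Finset ℕ), (fun _ => (1:ℂ)) n * (n:ℂ)^(-(((T + Δ * u : ℝ):ℂ) * I))) * (‖RR P c (1/2 + ((T + Δ * u : ℝ):ℂ) * I)‖^2 : ℝ)) * (gw u : ℂ))
      = ((∫ u : ℝ, ‖RR P c (1/2 + ((T + Δ * u : ℝ):ℂ) * I)‖^2 * gw u : ℝ) : ℂ) := by
    rw [← integral_complex_ofReal]
    congr 1; ext u; simp
  rw [e] at hg
  have h2 : ∀ a b : ℝ, ‖(a:ℂ) - b‖ = |a - b| := fun a b => by rw [← Complex.ofReal_sub, Complex.norm_real, Real.norm_eq_abs]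
  rw [← Complex.ofReal_mul, h2] at hg
  have := (abs_le.mp hg).2
  simp at this ⊢
  linarith

end

section

def Pz (z : ℕ) : Finset ℕ := (Finset.range (z+1)).filter fun p => p.Prime ∧ 17 ≤ p
noncomputable def xz (z : ℕ) : ℝ := (z:ℝ)^3
noncomputable def Tz (z : ℕ) : ℝ := Real.exp (xz z)
noncomputable def Dz (z : ℕ) : ℝ := Real.exp (0.95 * xz z)

lemma Pz_mem {z p : ℕ} (h : p ∈ Pz z) : p.Prime ∧ 17 ≤ p := (Finset.mem_filter.mp h).2
lemma Pz_le {z p : ℕ} (h : p ∈ Pz z) : p ≤ z := by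
  have := Finset.mem_range.mp (Finset.mem_filter.mp h).1; omega

lemma Pz_card (z : ℕ) : (Pz z).card ≤ z := by
  have h : Pz z ⊆ Finset.Icc 1 z := fun p hp => Finset.mem_Icc.mpr ⟨(Pz_mem hp).1.pos, Pz_le hp⟩
  simpa using Finset.card_le_card h

lemma pr_Pz (z : ℕ) : pr (Pz z) ≤ 4^z := by
  refine le_trans ?_ (primorial_le_four_pow z)
  unfold primorial pr
  refine Finset.prod_le_prod_of_subset_of_one_le' ?_ fun p hp _ => ?_
  · intro p hp
    exact Finset.mem_filter.mpr ⟨Finset.mem_range.mpr (by have := Pz_le hp; omega), (Pz_mem hp).1⟩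
  · exact (Finset.mem_filter.mp hp).2.one_lt.le

lemma four_pow_le (z : ℕ) : (4:ℝ)^z ≤ Real.exp (2*z) := by
  have h : (4:ℝ) ≤ Real.exp 2 := by
    have := Real.add_one_le_exp (1:ℝ)
    have h2 : Real.exp 2 = Real.exp 1 * Real.exp 1 := by rw [← Real.exp_add]; norm_num
    rw [h2]; nlinarith
  calc (4:ℝ)^z ≤ (Real.exp 2)^z := by gcongr
    _ = _ := by rw [← Real.exp_nat_mul]; ring_nf

lemma pr_Pz' (z : ℕ) : (pr (Pz z) : ℝ) ≤ Real.exp (2*z) := by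
  refine le_trans ?_ (four_pow_le z)
  exact_mod_cast pr_Pz z

lemma ZP_Pz (z : ℕ) : ZP (Pz z) ≤ 2*z := by
  have h1 : ZP (Pz z) = Real.log (pr (Pz z)) := by
    rw [ZP, pr, Nat.cast_prod, Real.log_prod fun p hp => by exact_mod_cast (Pz_mem hp).1.ne_zero]
  rw [h1]
  have h0 : (0:ℝ) < pr (Pz z) := by exact_mod_cast pr_pos fun p hp => (Pz_mem hp).1
  exact (Real.log_le_iff_le_exp h0).mpr (pr_Pz' z)

lemma card_pow (z : ℕ) : ((3/2:ℝ)^(Pz z).card)^2 ≤ Real.exp z := by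
  have h1 : ((3/2:ℝ)^(Pz z).card)^2 ≤ ((3/2:ℝ)^z)^2 := by
    have := pow_le_pow_right₀ (by norm_num : (1:ℝ) ≤ 3/2) (Pz_card z)
    gcongr
  have h2 : (9/4:ℝ) ≤ Real.exp 1 := by have := Real.exp_one_gt_d9; linarith
  calc _ ≤ _ := h1
    _ = (9/4:ℝ)^z := by rw [← pow_mul, mul_comm z 2, pow_mul]; norm_num
    _ ≤ (Real.exp 1)^z := by gcongr
    _ = _ := by rw [← Real.exp_nat_mul, mul_one]

lemma xz_ge {z : ℕ} (hz : 30 ≤ z) : 900 * (z:ℝ) ≤ xz z := by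
  have : (30:ℝ) ≤ z := by exact_mod_cast hz
  unfold xz; nlinarith [mul_nonneg (by linarith : (0:ℝ) ≤ z) (by nlinarith : (0:ℝ) ≤ (z:ℝ)^2 - 900)]

lemma exp_quad {y : ℝ} (hy : 0 ≤ y) : y^2/2 ≤ Real.exp y := by
  have := Real.quadratic_le_exp_of_nonneg hy; nlinarith

lemma size3 {z : ℕ} (hz : 30 ≤ z) : 1 + |Tz z| + |Dz z| ≤ 3 * Real.exp (xz z) := by
  have h := xz_ge hz
  have h0 : (0:ℝ) ≤ z := by positivity
  rw [Tz, Dz, abs_of_pos (Real.exp_pos _), abs_of_pos (Real.exp_pos _)]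
  have h1 : Real.exp (0.95 * xz z) ≤ Real.exp (xz z) := Real.exp_le_exp.mpr (by nlinarith)
  have h2 : 1 ≤ Real.exp (xz z) := Real.one_le_exp (by nlinarith)
  linarith

lemma UU_eq (z : ℕ) : Tz z / (2 * Dz z) = Real.exp (0.05 * xz z) / 2 := by
  rw [Tz, Dz, div_mul_eq_div_div_swap, ← Real.exp_sub]; ring_nf

lemma tailz {A : ℝ} (hA : 0 ≤ A) : ∃ z₀ : ℕ, ∀ z ≥ z₀,
    A * ((3/2:ℝ)^(Pz z).card)^2 * (1 + |Tz z| + |Dz z|) * WW * Real.exp (-(Tz z / (2 * Dz z))^2/2) ≤ Real.exp (-xz z) := by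
  obtain ⟨z₁, hz₁⟩ := exists_nat_ge (3 * A * WW)
  refine ⟨max 30 z₁, fun z hz => ?_⟩
  have hz30 : 30 ≤ z := le_trans (le_max_left _ _) hz
  have hzz : 3 * A * WW ≤ z := hz₁.trans (by exact_mod_cast le_trans (le_max_right _ _) hz)
  have hx := xz_ge hz30
  have hz0 : (30:ℝ) ≤ z := by exact_mod_cast hz30
  have hzE : (z:ℝ) ≤ Real.exp z := by have := Real.add_one_le_exp (z:ℝ); linarith
  rw [UU_eq]
  have hE : -(Real.exp (0.05 * xz z) / 2)^2/2 ≤ -(4 * xz z) := by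
    have e : (Real.exp (0.05 * xz z))^2 = Real.exp (xz z/10) := by rw [← Real.exp_nat_mul]; norm_num; ring
    have := exp_quad (y := xz z/10) (by linarith)
    rw [div_pow, e]
    nlinarith
  have hW := WW_nonneg
  calc _ ≤ A * Real.exp z * (3 * Real.exp (xz z)) * WW * Real.exp (-(4 * xz z)) := by
        have h1 := card_pow z
        have h2 := size3 hz30
        have h3 := Real.exp_le_exp.mpr hE
        gcongr
    _ = (3 * A * WW) * (Real.exp z * Real.exp (xz z) * Real.exp (-(4 * xz z))) := by ring
    _ ≤ Real.exp z * (Real.exp z * Real.exp (xz z) * Real.exp (-(4 * xz z))) := by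
        gcongr; exact hzz.trans hzE
    _ = Real.exp (z + (z + xz z + -(4 * xz z))) := by simp only [Real.exp_add]
    _ ≤ _ := Real.exp_le_exp.mpr (by linarith)

lemma rpow_p {p : ℕ} (hp : 17 ≤ p) : 0 < (p:ℝ)^(-(1/2):ℝ) ∧ (p:ℝ)^(-(1/2):ℝ) ≤ 1/4 := by
  have h : (17:ℝ) ≤ p := by exact_mod_cast hp
  refine ⟨by positivity, ?_⟩
  calc (p:ℝ)^(-(1/2):ℝ) ≤ (16:ℝ)^(-(1/2):ℝ) := Real.rpow_le_rpow_of_nonpos (by norm_num) (by linarith) (by norm_num)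
    _ = 1/4 := by
      rw [show (16:ℝ) = 4^(2:ℝ) by norm_num, ← Real.rpow_mul (by norm_num)]; norm_num [Real.rpow_neg_one]

lemma main_ge_one {P : Finset ℕ} (hP : ∀ p ∈ P, 17 ≤ p) {c : ℝ} (hc : c = 1/2 ∨ c = -1/2) :
    1 ≤ ∏ p ∈ P, (1 + c * (c + (p:ℝ)^(-(1/2):ℝ))) := by
  refine Finset.prod_induction _ (fun x => (1:ℝ) ≤ x) (fun a b ha hb => by nlinarith) le_rfl fun p hp => ?_
  have := rpow_p (hP p hp)
  rcases hc with rfl | rfl <;> nlinarith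

lemma errE {z : ℕ} (hz : 30 ≤ z) : Real.exp (-(Dz z*(1/(2*(pr (Pz z):ℝ))))^2/4) ≤ Real.exp (-(10 * xz z)) := by
  have hx := xz_ge hz
  have hz0 : (30:ℝ) ≤ z := by exact_mod_cast hz
  have hp := pr_Pz' z
  have h0 : (0:ℝ) < pr (Pz z) := by exact_mod_cast pr_pos fun p hp => (Pz_mem hp).1
  apply Real.exp_le_exp.mpr
  have h1 : Real.exp (0.95 * xz z - 2 * z) / 2 ≤ Dz z*(1/(2*(pr (Pz z):ℝ))) := by
    rw [Dz, mul_one_div, Real.exp_sub, div_div, mul_comm _ (2:ℝ)]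
    gcongr
  have h2 : (Real.exp (0.95 * xz z - 2 * z) / 2)^2 ≤ (Dz z*(1/(2*(pr (Pz z):ℝ))))^2 := by gcongr
  have e : (Real.exp (0.95 * xz z - 2 * z))^2 = Real.exp (1.9 * xz z - 4 * z) := by rw [← Real.exp_nat_mul]; congr 1; push_cast; ring
  have h3 := exp_quad (y := 1.9 * xz z - 4 * z) (by linarith)
  have h4 : xz z ≤ 1.9 * xz z - 4*z := by linarith
  rw [div_pow, e] at h2
  nlinarith

lemma M1z : ∃ z₀ : ℕ, ∀ z ≥ z₀, ∀ c : ℝ, (c = 1/2 ∨ c = -1/2) →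
    Real.sqrt Real.pi / 2 * ∏ p ∈ Pz z, (1 + c * (c + (p:ℝ)^(-(1/2):ℝ))) ≤
      ∫ u : ℝ, (‖eZ (1/2 + ((Tz z + Dz z * u : ℝ):ℂ) * I)‖ * ‖RR (Pz z) c (1/2 + ((Tz z + Dz z * u : ℝ):ℂ) * I)‖^2) * gw u := by
  obtain ⟨C, hC1, hC⟩ := M1
  obtain ⟨z₁, hz₁⟩ := exists_nat_ge (12 * C)
  refine ⟨max 30 z₁, fun z hz c hc => ?_⟩
  have hz30 : 30 ≤ z := le_trans (le_max_left _ _) hz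
  have hzz : 12 * C ≤ z := hz₁.trans (by exact_mod_cast le_trans (le_max_right _ _) hz)
  have hx := xz_ge hz30
  have hz0 : (30:ℝ) ≤ z := by exact_mod_cast hz30
  have hzE : (z:ℝ) ≤ Real.exp z := by have := Real.add_one_le_exp (z:ℝ); linarith
  have hc2 : |c| ≤ 1/2 := by rcases hc with rfl | rfl <;> norm_num [abs_le]
  set K : ℕ := ⌈Real.exp (8 * xz z)⌉₊ with hK
  have hK1 : Real.exp (8 * xz z) ≤ K := Nat.le_ceil _
  have hK2 : (K:ℝ) ≤ Real.exp (8 * xz z) + 1 := (Nat.ceil_lt_add_one (Real.exp_pos _).le).le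
  have hE1 : 1 ≤ Real.exp (8 * xz z) := Real.one_le_exp (by linarith)
  have hpK : pr (Pz z) ≤ 2 * K := by
    have h1 := pr_Pz' z
    have h2 : Real.exp (2*z) ≤ Real.exp (8 * xz z) := Real.exp_le_exp.mpr (by linarith)
    have : (pr (Pz z):ℝ) ≤ 2 * K := by linarith
    exact_mod_cast this
  have h := hC (Pz z) c (Tz z) (Dz z) K (fun p hp => Pz_mem hp) hc2 hpK
  have hpi : 1 ≤ Real.sqrt Real.pi := Real.one_le_sqrt.mpr (by linarith [Real.pi_gt_three])
  have e1 : Real.sqrt Real.pi * Real.exp (-(Dz z*(1/(2*(pr (Pz z):ℝ))))^2/4) * ((2*K) * ((3/2:ℝ)^(Pz z).card)^2) ≤ Real.sqrt Real.pi / 4 := by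
    calc _ ≤ Real.sqrt Real.pi * Real.exp (-(10 * xz z)) * ((4 * Real.exp (8 * xz z)) * Real.exp z) := by
          have h1 := errE hz30
          have h2 := card_pow z
          have h3 : (2*K:ℝ) ≤ 4 * Real.exp (8 * xz z) := by linarith
          gcongr
      _ = Real.sqrt Real.pi * 4 * Real.exp (-(10 * xz z) + 8 * xz z + z) := by simp only [Real.exp_add]; ring
      _ ≤ Real.sqrt Real.pi * 4 * Real.exp (-(z:ℝ)) := by gcongr; linarith
      _ ≤ Real.sqrt Real.pi * 4 * (1/16) := by
          gcongr
          rw [Real.exp_neg, inv_eq_one_div]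
          gcongr; linarith
      _ = _ := by ring
  have e2 : C * ((K:ℝ)+1)^(-(1/4):ℝ) * ((3/2:ℝ)^(Pz z).card)^2 * (1 + |Tz z| + |Dz z|) ≤ Real.sqrt Real.pi / 4 := by
    have h1 : ((K:ℝ)+1)^(-(1/4):ℝ) ≤ Real.exp (-(2 * xz z)) := by
      calc _ ≤ (Real.exp (8 * xz z))^(-(1/4):ℝ) := Real.rpow_le_rpow_of_nonpos (Real.exp_pos _) (by linarith) (by norm_num)
        _ = _ := by rw [← Real.exp_mul]; ring_nf
    calc _ ≤ C * Real.exp (-(2 * xz z)) * Real.exp z * (3 * Real.exp (xz z)) := by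
          have h2 := card_pow z
          have h3 := size3 hz30
          gcongr
      _ = (12 * C) / 4 * (Real.exp (-(2 * xz z)) * Real.exp z * Real.exp (xz z)) := by ring
      _ ≤ Real.exp z / 4 * (Real.exp (-(2 * xz z)) * Real.exp z * Real.exp (xz z)) := by gcongr; exact hzz.trans hzE
      _ = 1/4 * Real.exp (z + (-(2 * xz z) + z + xz z)) := by simp only [Real.exp_add]; ring
      _ ≤ 1/4 * 1 := by gcongr; exact Real.exp_le_one_iff.mpr (by linarith)
      _ ≤ _ := by linarith
  have hm := main_ge_one (P := Pz z) (fun p hp => (Pz_mem hp).2) hc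
  set Mn := ∏ p ∈ Pz z, (1 + c * (c + (p:ℝ)^(-(1/2):ℝ))) with hMn
  set J := ∫ u : ℝ, (eZ (1/2 + ((Tz z + Dz z * u : ℝ):ℂ) * I) * (‖RR (Pz z) c (1/2 + ((Tz z + Dz z * u : ℝ):ℂ) * I)‖^2 : ℝ)) * (gw u : ℂ) with hJ
  have h5 : ‖J‖ ≤ ∫ u : ℝ, (‖eZ (1/2 + ((Tz z + Dz z * u : ℝ):ℂ) * I)‖ * ‖RR (Pz z) c (1/2 + ((Tz z + Dz z * u : ℝ):ℂ) * I)‖^2) * gw u := by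
    refine (MeasureTheory.norm_integral_le_integral_norm _).trans (le_of_eq ?_)
    congr 1; ext u
    rw [norm_mul, norm_mul, Complex.norm_real, Complex.norm_real, Real.norm_of_nonneg (gw_pos u).le, Real.norm_of_nonneg (by positivity)]
  refine le_trans ?_ h5
  have h6 : ‖(Real.sqrt Real.pi : ℂ) * (Mn:ℂ)‖ = Real.sqrt Real.pi * Mn := by
    rw [← Complex.ofReal_mul, Complex.norm_real, Real.norm_of_nonneg (by positivity)]
  have h7 := norm_sub_norm_le ((Real.sqrt Real.pi : ℂ) * (Mn:ℂ)) J
  rw [h6, norm_sub_rev] at h7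
  nlinarith

end

section

noncomputable def PS (z : ℕ) : ℝ := ∑ p ∈ Pz z, (p:ℝ)^(-(1/2):ℝ)

lemma Pz_card_ge (z : ℕ) : (Nat.primeCounting z : ℝ) ≤ (Pz z).card + 17 := by
  have : Nat.primeCounting z ≤ (Pz z).card + 17 := by
    rw [Nat.primeCounting, Nat.primeCounting', Nat.count_eq_card_filter_range]
    have h : (Finset.range (z+1)).filter Nat.Prime ⊆ Pz z ∪ Finset.range 17 := by
      intro p hp
      rw [Finset.mem_filter] at hp
      by_cases h17 : 17 ≤ p
      · exact Finset.mem_union_left _ (Finset.mem_filter.mpr ⟨hp.1, hp.2, h17⟩)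
      · exact Finset.mem_union_right _ (Finset.mem_range.mpr (by omega))
    refine (Finset.card_le_card h).trans ((Finset.card_union_le _ _).trans ?_)
    simp
  exact_mod_cast this

lemma PS_large (A : ℝ) : ∃ z₀ : ℕ, ∀ z ≥ z₀, A * Real.log z ≤ PS z ∧ A ≤ PS z := by
  have ht : Tendsto (fun z : ℕ => (z:ℝ)^(1/8:ℝ)) atTop atTop :=
    (tendsto_rpow_atTop (by norm_num)).comp tendsto_natCast_atTop_atTop
  obtain ⟨z₀, hz₀⟩ := eventually_atTop.mp (ht.eventually_ge_atTop (max 100 (8*|A|)))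
  refine ⟨max 2 z₀, fun z hz => ?_⟩
  have hz2 : 2 ≤ z := le_trans (le_max_left _ _) hz
  have hy := hz₀ z (le_trans (le_max_right _ _) hz)
  set y := (z:ℝ)^(1/8:ℝ) with hydef
  have hy1 : 100 ≤ y := le_trans (le_max_left _ _) hy
  have hy2 : 8*|A| ≤ y := le_trans (le_max_right _ _) hy
  have hzr : (2:ℝ) ≤ z := by exact_mod_cast hz2
  have hy8 : y^8 = z := by rw [hydef, ← Real.rpow_natCast, ← Real.rpow_mul (by positivity)]; norm_num
  have hl : Real.log z ≤ 8 * y := by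
    have := Real.log_le_rpow_div (x := (z:ℝ)) (by positivity) (by norm_num : (0:ℝ) < 1/8)
    rw [← hydef] at this; linarith
  have hl0 : 0 < Real.log z := Real.log_pos (by linarith)
  have hl1 : Real.log (z+1) ≤ 1 + 8*y := by
    have : Real.log ((z:ℝ)+1) ≤ Real.log z + 1 := by
      have e1 : Real.log z + 1 = Real.log (z * Real.exp 1) := by
        rw [Real.log_mul (by positivity) (by positivity), Real.log_exp]
      rw [e1]
      apply Real.log_le_log (by positivity)
      have := Real.add_one_le_exp (1:ℝ)
      nlinarith
    linarith
  have hpi := Chebyshev.pi_ge z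
  have hc := Pz_card_ge z
  have hl2 := Real.log_two_gt_d9
  have hnum : 8*y*(y^6+17) ≤ z * Real.log 2 - Real.log (z+1) := by
    have h1 : (z:ℝ) * 0.69 ≤ z * Real.log 2 := by nlinarith
    have h7 : y^8 = y * y^7 := by ring
    have h8 : 100 * y ≤ y^7 := by
      have h6 : 1 ≤ y^5 := one_le_pow₀ (by linarith)
      calc 100 * y ≤ y * y * 1 := by nlinarith
        _ ≤ y * y * y^5 := by gcongr
        _ = y^7 := by ring
    have h9 : 0 ≤ y^7 := by positivity
    have h10 : 100 * y^7 ≤ z := by rw [← hy8, h7]; gcongr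
    have h11 : 8*y*(y^6+17) = 8 * y^7 + 136 * y := by ring
    rw [h11]
    linarith
  have hcard : y^6 ≤ (Pz z).card := by
    have h1 : y^6 + 17 ≤ (z * Real.log 2 - Real.log (z+1))/Real.log z := by
      rw [le_div_iff₀ hl0]
      refine le_trans ?_ hnum
      rw [mul_comm (8*y)]
      exact mul_le_mul_of_nonneg_left hl (by positivity)
    linarith
  have hy4 : (z:ℝ)^(-(1/2):ℝ) = (y^4)⁻¹ := by
    rw [hydef, ← Real.rpow_natCast, ← Real.rpow_mul (by positivity), ← Real.rpow_neg (by positivity)]; norm_num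
  have hPS : y^2 ≤ PS z := by
    have h1 : (Pz z).card * (y^4)⁻¹ ≤ PS z := by
      rw [PS, ← nsmul_eq_mul]
      refine Finset.card_nsmul_le_sum _ _ _ fun p hp => ?_
      rw [← hy4]
      have hp0 : (0:ℝ) < p := by exact_mod_cast (Pz_mem hp).1.pos
      exact Real.rpow_le_rpow_of_nonpos hp0 (by exact_mod_cast Pz_le hp) (by norm_num)
    have h2 : y^2 = y^6 * (y^4)⁻¹ := by field_simp
    have h3 : y^6 * (y^4)⁻¹ ≤ (Pz z).card * (y^4)⁻¹ := by gcongr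
    linarith
  have hA := le_abs_self A
  have hA0 := abs_nonneg A
  constructor
  · calc A * Real.log z ≤ |A| * (8*y) := by
          exact (mul_le_mul_of_nonneg_right hA hl0.le).trans (mul_le_mul_of_nonneg_left hl hA0)
      _ ≤ y^2 := by nlinarith
      _ ≤ _ := hPS
  · nlinarith

lemma sum_le_prod_one_add (P : Finset ℕ) (f : ℕ → ℝ) (hf : ∀ p ∈ P, 0 ≤ f p) : 1 + ∑ p ∈ P, f p ≤ ∏ p ∈ P, (1 + f p) := by
  classical
  induction P using Finset.induction_on with
  | empty => simp
  | insert a s ha ih =>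
    rw [Finset.sum_insert ha, Finset.prod_insert ha]
    have h1 := ih fun p hp => hf p (Finset.mem_insert_of_mem hp)
    have h2 := hf a (Finset.mem_insert_self _ _)
    have h3 : 0 ≤ ∑ p ∈ s, f p := Finset.sum_nonneg fun p hp => hf p (Finset.mem_insert_of_mem hp)
    nlinarith

lemma eZ_large {K' T₀ : ℝ} (hK : 0 ≤ K') : ∃ t : ℝ, T₀ ≤ t ∧ K' ≤ ‖eZ (1/2 + (t:ℂ) * I)‖ := by
  by_contra! hcon
  obtain ⟨C, hC1, hC⟩ := eZ_growth
  obtain ⟨z₁, h1⟩ := M1z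
  obtain ⟨z₂, h2⟩ := tailz (A := C) (by linarith)
  obtain ⟨z₃, h3⟩ := PS_large (20 * (K' + 1))
  obtain ⟨z₄, h4⟩ := exists_nat_ge (2 * T₀)
  set z := max (max z₁ z₂) (max (max z₃ z₄) 30) with hz
  have hz1 : z₁ ≤ z := by omega
  have hz2 : z₂ ≤ z := by omega
  have hz3 : z₃ ≤ z := by omega
  have hz4 : z₄ ≤ z := by omega
  have hz30 : 30 ≤ z := by omega
  clear_value z
  have hx := xz_ge hz30
  have hz0 : (30:ℝ) ≤ z := by exact_mod_cast hz30
  have hT0 : T₀ ≤ Tz z / 2 := by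
    have : (z₄:ℝ) ≤ z := by exact_mod_cast hz4
    have h5 := Real.add_one_le_exp (xz z)
    rw [Tz]; linarith
  have hP2 : ∀ p ∈ Pz z, 17 ≤ p := fun p hp => (Pz_mem hp).2
  have hc2 : |(1/2:ℝ)| ≤ 1/2 := by norm_num [abs_le]
  have hT := Real.exp_pos (xz z)
  rw [← Tz] at hT
  have hD : 0 < Dz z := Real.exp_pos _
  have hm := h1 z hz1 (1/2) (Or.inl rfl)
  have ht := h2 z hz2
  have hPS := (h3 z hz3).2
  have hlin : Continuous fun u : ℝ => Tz z + Dz z * u := by fun_prop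
  have hEc : Continuous fun u : ℝ => ‖eZ (1/2 + ((Tz z + Dz z * u : ℝ):ℂ) * I)‖ := (eZ_diff.continuous.comp (by fun_prop)).norm
  have hRc : Continuous fun u : ℝ => ‖RR (Pz z) (1/2) (1/2 + ((Tz z + Dz z * u : ℝ):ℂ) * I)‖^2 := ((RR_line_cont hP2 (1/2)).comp hlin).norm.pow 2
  have hR : ∀ t : ℝ, ‖RR (Pz z) (1/2) (1/2 + (t:ℂ) * I)‖^2 ≤ ((3/2:ℝ)^(Pz z).card)^2 := fun t => by
    have := RR_up hP2 hc2 (s := 1/2 + (t:ℂ) * I) (by simp)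
    gcongr
  have hF : ∀ t : ℝ, ‖eZ (1/2 + (t:ℂ) * I)‖ * ‖RR (Pz z) (1/2) (1/2 + (t:ℂ) * I)‖^2 ≤ C * ((3/2:ℝ)^(Pz z).card)^2 * (1 + |t|) := by
    intro t
    have ha : ‖eZ (1/2 + (t:ℂ) * I)‖ ≤ C * (1 + |t|) := (hC _ (by simp)).trans (mul_le_mul_of_nonneg_left (norm_half_add t) (by linarith))
    calc _ ≤ C * (1 + |t|) * ((3/2:ℝ)^(Pz z).card)^2 := mul_le_mul ha (hR t) (by positivity) (by positivity)
      _ = _ := by ring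
  have hcen := central (F := fun u => ‖eZ (1/2 + ((Tz z + Dz z * u : ℝ):ℂ) * I)‖ * ‖RR (Pz z) (1/2) (1/2 + ((Tz z + Dz z * u : ℝ):ℂ) * I)‖^2)
    (H := fun u => K' * ‖RR (Pz z) (1/2) (1/2 + ((Tz z + Dz z * u : ℝ):ℂ) * I)‖^2)
    (A := C * ((3/2:ℝ)^(Pz z).card)^2) (T := Tz z) (Δ := Dz z) (U := Tz z / (2 * Dz z)) (by positivity) (by positivity)
    (fun u _ => hF _) (fun u => by positivity) (fun u hu => by
      refine mul_le_mul_of_nonneg_right ?_ (by positivity)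
      refine (hcon _ (hT0.trans ?_)).le
      have h5 : Dz z * |u| ≤ Tz z / 2 := by
        calc Dz z * |u| ≤ Dz z * (Tz z / (2 * Dz z)) := by gcongr
          _ = _ := by field_simp
      have h6 := neg_abs_le u
      nlinarith)
    (by
      refine gw_growth_int (T := Tz z) (Δ := Dz z) (A := C * ((3/2:ℝ)^(Pz z).card)^2) ((hEc.mul hRc).mul gw_cont) (by positivity) fun u => ?_
      rw [Real.norm_of_nonneg (by have := gw_pos u; positivity)]
      exact mul_le_mul_of_nonneg_right (hF _) (gw_pos u).le)
    (by
      refine gw_growth_int (T := 0) (Δ := 0) (A := K' * ((3/2:ℝ)^(Pz z).card)^2) ((continuous_const.mul hRc).mul gw_cont) (by positivity) fun u => ?_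
      rw [Real.norm_of_nonneg (by have := gw_pos u; positivity)]
      simp only [zero_mul, add_zero, abs_zero, mul_one]
      exact mul_le_mul_of_nonneg_right (mul_le_mul_of_nonneg_left (hR _) hK) (gw_pos u).le)
  have hM0 := M0 (P := Pz z) (c := 1/2) (Tz z) (Dz z) (fun p hp => Pz_mem hp) hc2
  simp_rw [mul_assoc K'] at hcen
  rw [MeasureTheory.integral_const_mul] at hcen
  have hpi : 1 ≤ Real.sqrt Real.pi := Real.one_le_sqrt.mpr (by linarith [Real.pi_gt_three])
  set n := (Pz z).card with hn
  have herr : Real.exp (-(Dz z*(1/(2*(pr (Pz z):ℝ))))^2/4) * ((3/2:ℝ)^n)^2 ≤ 1 := by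
    calc _ ≤ Real.exp (-(10 * xz z)) * Real.exp z := by
          have := errE hz30; have := card_pow z; gcongr
      _ = Real.exp (-(10 * xz z) + z) := by rw [Real.exp_add]
      _ ≤ 1 := Real.exp_le_one_iff.mpr (by linarith)
  have h54 : (1:ℝ) ≤ (5/4:ℝ)^n := one_le_pow₀ (by norm_num)
  have hprod : (5/4:ℝ)^n * (1 + 0.4 * PS z) ≤ ∏ p ∈ Pz z, (1 + (1/2:ℝ) * (1/2 + (p:ℝ)^(-(1/2):ℝ))) := by
    have e : ∏ p ∈ Pz z, (1 + (1/2:ℝ) * (1/2 + (p:ℝ)^(-(1/2):ℝ))) = (5/4:ℝ)^n * ∏ p ∈ Pz z, (1 + 0.4 * (p:ℝ)^(-(1/2):ℝ)) := by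
      rw [hn, ← Finset.prod_const, ← Finset.prod_mul_distrib]
      exact Finset.prod_congr rfl fun p _ => by ring
    rw [e, PS, Finset.mul_sum]
    gcongr
    exact sum_le_prod_one_add _ _ fun p hp => by positivity
  have e1 : (1 + (1/2:ℝ)^2)^n = (5/4:ℝ)^n := by norm_num
  rw [e1] at hM0
  have hexp : Real.exp (-xz z) ≤ 1 := Real.exp_le_one_iff.mpr (by linarith)
  have h6 : Real.sqrt Real.pi / 2 * ((5/4:ℝ)^n * (1 + 0.4 * PS z)) ≤ K' * (Real.sqrt Real.pi * ((5/4:ℝ)^n + 1)) + 1 := by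
    refine (mul_le_mul_of_nonneg_left hprod (by positivity)).trans (hm.trans (hcen.trans (add_le_add ?_ (ht.trans hexp))))
    refine mul_le_mul_of_nonneg_left (hM0.trans ?_) hK
    gcongr
  set q := (5/4:ℝ)^n with hq
  set r := Real.sqrt Real.pi with hr
  have hrq : 1 ≤ r * q := by nlinarith
  have h7 : K' * (r * (q + 1)) + 1 ≤ (2 * K' + 1) * (r * q) := by nlinarith [mul_nonneg hK (by linarith : 0 ≤ r)]
  have h8 : r / 2 * (q * (1 + 0.4 * PS z)) = (r*q) * ((1 + 0.4 * PS z)/2) := by ring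
  rw [h8] at h6
  have h9 : (r*q) * ((1 + 0.4 * PS z)/2) ≤ (r*q) * (2*K'+1) := by linarith
  have h10 := le_of_mul_le_mul_left h9 (by linarith)
  linarith

lemma part_b (n : ℕ) : ∃ α ∈ Icc (-Real.pi) Real.pi, ∀ θ : ℝ, |θ - α| < Real.pi/8 →
    ∃ t r : ℝ, (n:ℝ) + 2 ≤ t ∧ 0 < r ∧ (n:ℝ) ≤ r ∧ riemannZeta (1/2 + (t:ℂ) * I) = r * cexp (I * θ) := by
  obtain ⟨C, hC1, hC⟩ := ff_growth
  obtain ⟨C₀, hC₀, hpa⟩ := peak_arc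
  obtain ⟨t₁, ht1, ht2⟩ := eZ_large (K' := 60 * n + 4 * C) (T₀ := 2 * (n + 4 + Real.exp C₀)) (by positivity)
  have hn0 : (0:ℝ) ≤ n := by positivity
  have he : ∀ s, ff ∅ (1/2) s = eZ s := fun s => by simp [ff, RR]
  have hP0 : ∀ p ∈ (∅:Finset ℕ), 17 ≤ p := by simp
  have hc2 : |(1/2:ℝ)| ≤ 1/2 := by norm_num [abs_le]
  have hg : ∀ s : ℂ, 1/2 ≤ s.re → ‖ff ∅ (1/2) s‖ ≤ C * ‖s‖ := fun s hs => by
    have := hC ∅ (1/2) hP0 hc2 s hs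
    simpa using this
  have hpos : 0 < ‖eZ (1/2 + (t₁:ℂ) * I)‖ := by linarith
  obtain ⟨p, hp1, hp2⟩ := peak_exists (ff_diff hP0 (1/2)).continuous (by linarith) hg t₁ (by rw [he]; exact norm_pos_iff.mp hpos)
  have hex := Real.exp_pos C₀
  have hsz : ‖ff ∅ (1/2) (1/2 + (p:ℂ) * I)‖ ≤ C * (1 + |p|) :=
    (hg _ (by simp)).trans (mul_le_mul_of_nonneg_left (norm_half_add p) (by linarith))
  rw [he] at hp2
  have habs : 1 + |p| ≤ (1 + |t₁|) * (1 + |t₁ - p|) := by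
    have := one_add_abs_mul p t₁ 0
    simp only [sub_zero, zero_sub, abs_neg] at this
    rw [abs_sub_comm p t₁] at this; linarith
  have ht10 : 0 ≤ t₁ := by linarith
  have hd : 4 * (1 + |t₁ - p|) ≤ 1 + t₁ := by
    rw [abs_of_nonneg ht10] at habs
    set d := 1 + |t₁ - p| with hd
    have hd1 : 1 ≤ d := by have := abs_nonneg (t₁ - p); linarith
    have h1 : (4*C) * d^2 ≤ C * ((1+t₁)*d) := by
      calc (4*C) * d^2 ≤ ‖eZ (1/2 + (t₁:ℂ) * I)‖ * d^2 := by gcongr; linarith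
        _ ≤ C * (1 + |p|) := hp2.trans hsz
        _ ≤ _ := by gcongr
    have h2 : (C*d) * (4 * d) ≤ (C*d) * (1+t₁) := by nlinarith
    exact le_of_mul_le_mul_left h2 (by positivity)
  have hpt : t₁/2 ≤ p := by
    have := (abs_le.mp (le_refl |t₁ - p|)).2
    linarith
  have hsq : 1 ≤ (1 + |t₁ - p|)^2 := one_le_pow₀ (by have := abs_nonneg (t₁ - p); linarith)
  have hbig : 60 * n + 4 * C ≤ ‖eZ (1/2 + (p:ℂ) * I)‖ := by
    rw [he] at hp2; nlinarith
  refine ⟨arg (riemannZeta (1/2 + (p:ℂ) * I)), ⟨(neg_pi_lt_arg _).le, arg_le_pi _⟩, fun θ hθ => ?_⟩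
  obtain ⟨t, r, h1, h2, h3, -, h5⟩ := hpa ∅ (1/2) p hP0 hc2 (by linarith) (by
      rw [show ZP ∅ = 0 by simp [ZP]]
      rw [add_zero, mul_one, Real.le_log_iff_exp_le (by linarith)]
      linarith)
    (by rw [he]; exact norm_pos_iff.mp (by linarith)) hp1 θ hθ
  refine ⟨t, r, ?_, h2, ?_, h5⟩
  · have := (abs_le.mp h1).1; linarith
  · linarith

end

section

lemma int_inv_vert {b L : ℝ} (hb : 0 < b) : I * ∫ y in (-L)..L, ((b:ℂ) + y * I)⁻¹ = Complex.log (b + L * I) - Complex.log (b - L * I) := by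
  have h : ∀ y : ℝ, HasDerivAt (fun y : ℝ => Complex.log ((b:ℂ) + y * I)) (I * ((b:ℂ) + y * I)⁻¹) y := by
    intro y
    have h1 : HasDerivAt (fun y : ℝ => (b:ℂ) + y * I) (1 * I) y := ((Complex.ofRealCLM.hasDerivAt).mul_const I).const_add _
    have h2 := h1.clog_real (by left; simp [hb])
    refine h2.congr_deriv ?_
    rw [one_mul, div_eq_mul_inv]
  rw [← intervalIntegral.integral_const_mul, intervalIntegral.integral_eq_sub_of_hasDerivAt (fun y _ => h y)]
  · push_cast; ring_nf
  · apply Continuous.intervalIntegrable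
    refine continuous_const.mul (Continuous.inv₀ (by fun_prop) fun y hy => ?_)
    have := congrArg Complex.re hy; simp at this; linarith

lemma int_inv_hor {a b L : ℝ} (hL : L ≠ 0) : ∫ x in (-a)..b, ((x:ℂ) + L * I)⁻¹ = Complex.log (b + L * I) - Complex.log (-a + L * I) := by
  have h : ∀ y : ℝ, HasDerivAt (fun y : ℝ => Complex.log ((y:ℂ) + L * I)) (((y:ℂ) + L * I)⁻¹) y := by
    intro y
    have h1 : HasDerivAt (fun y : ℝ => (y:ℂ) + L * I) 1 y := (Complex.ofRealCLM.hasDerivAt).add_const _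
    have h2 := h1.clog_real (by right; simp [hL])
    exact h2.congr_deriv (one_div _)
  rw [intervalIntegral.integral_eq_sub_of_hasDerivAt (fun y _ => h y)]
  · push_cast; ring_nf
  · apply Continuous.intervalIntegrable
    refine Continuous.inv₀ (by fun_prop) fun y hy => ?_
    have := congrArg Complex.im hy; simp at this; exact hL this

lemma log_neg_im_pos {w : ℂ} (h : 0 < w.im) : Complex.log (-w) = Complex.log w - Real.pi * I := by
  rw [Complex.log, Complex.log, norm_neg, arg_neg_eq_arg_sub_pi_of_im_pos h]; push_cast; ring

lemma log_neg_im_neg {w : ℂ} (h : w.im < 0) : Complex.log (-w) = Complex.log w + Real.pi * I := by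
  rw [Complex.log, Complex.log, norm_neg, arg_neg_eq_arg_add_pi_of_im_neg h]; push_cast; ring

lemma rect_inv {a b L : ℝ} (ha : 0 < a) (hb : 0 < b) (hL : 0 < L) :
    (∫ x in (-a)..b, ((x:ℂ) - L * I)⁻¹) - (∫ x in (-a)..b, ((x:ℂ) + L * I)⁻¹) + I * (∫ y in (-L)..L, ((b:ℂ) + y * I)⁻¹)
      - I * (∫ y in (-L)..L, (-(a:ℂ) + y * I)⁻¹) = 2 * Real.pi * I := by
  have h1 := int_inv_vert (L := L) hb
  have h2 : I * (∫ y in (-L)..L, (-(a:ℂ) + y * I)⁻¹) = - (Complex.log (a + L * I) - Complex.log (a - L * I)) := by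
    rw [← int_inv_vert ha]
    have e : ∀ y : ℝ, (-(a:ℂ) + y * I)⁻¹ = - ((a:ℂ) + ((-y : ℝ):ℂ) * I)⁻¹ := fun y => by
      rw [← inv_neg]; congr 1; push_cast; ring
    simp_rw [e]
    rw [intervalIntegral.integral_neg, intervalIntegral.integral_comp_neg (fun y : ℝ => ((a:ℂ) + (y:ℂ) * I)⁻¹)]
    simp
  have h3 := int_inv_hor (a := a) (b := b) hL.ne'
  have h4 := int_inv_hor (a := a) (b := b) (L := -L) (by linarith)
  have e4 : ∀ x : ℝ, ((x:ℂ) - L * I)⁻¹ = ((x:ℂ) + ((-L:ℝ):ℂ) * I)⁻¹ := fun x => by congr 1; push_cast; ring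
  simp_rw [e4]
  rw [h1, h2, h3, h4]
  have l1 : Complex.log (-a + L * I) = Complex.log (a - L * I) + Real.pi * I := by
    rw [← log_neg_im_neg (by simp [hL])]; congr 1; ring
  have l2 : Complex.log (-a + ((-L:ℝ):ℂ) * I) = Complex.log (a + L * I) - Real.pi * I := by
    rw [← log_neg_im_pos (by simp [hL])]; congr 1; push_cast; ring
  rw [l1, l2]
  push_cast
  ring_nf

lemma rectKeq {Φ : ℂ → ℂ} (hΦ : Differentiable ℂ Φ) {a b L : ℝ} (ha : 0 < a) (hb : 0 < b) (hL : 0 < L) :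
    2 * Real.pi * I * Φ 0 = (∫ x in (-a)..b, Φ ((x:ℂ) - L * I) * ((x:ℂ) - L * I)⁻¹) - (∫ x in (-a)..b, Φ ((x:ℂ) + L * I) * ((x:ℂ) + L * I)⁻¹)
      + I * (∫ y in (-L)..L, Φ ((b:ℂ) + y * I) * ((b:ℂ) + y * I)⁻¹)
      - I * (∫ y in (-L)..L, Φ (-(a:ℂ) + y * I) * (-(a:ℂ) + y * I)⁻¹) := by
  have hd : DifferentiableOn ℂ (dslope Φ 0) univ := (differentiableOn_dslope univ_mem).mpr hΦ.differentiableOn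
  have hdc : Continuous (dslope Φ 0) := (differentiableOn_univ.mp hd).continuous
  have h := integral_boundary_rect_eq_zero_of_differentiableOn (dslope Φ 0) (-(a:ℂ) - L * I) ((b:ℂ) + L * I) (hd.mono (subset_univ _))
  have r1 : (-(a:ℂ) - L * I).re = -a := by simp
  have r2 : (-(a:ℂ) - L * I).im = -L := by simp
  have r3 : ((b:ℂ) + L * I).re = b := by simp
  have r4 : ((b:ℂ) + L * I).im = L := by simp
  rw [r1, r2, r3, r4] at h
  push_cast at h
  simp only [smul_eq_mul] at h
  have key : ∀ w : ℂ, w ≠ 0 → Φ w * w⁻¹ = dslope Φ 0 w + Φ 0 * w⁻¹ := fun w hw => by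
    rw [dslope_of_ne _ hw, slope_def_field]; field_simp; ring
  have n1 : ∀ x : ℝ, (x:ℂ) - L * I ≠ 0 := fun x hx => by have := congrArg Complex.im hx; simp at this; linarith
  have n2 : ∀ x : ℝ, (x:ℂ) + L * I ≠ 0 := fun x hx => by have := congrArg Complex.im hx; simp at this; linarith
  have n3 : ∀ y : ℝ, (b:ℂ) + y * I ≠ 0 := fun x hx => by have := congrArg Complex.re hx; simp at this; linarith
  have n4 : ∀ y : ℝ, -(a:ℂ) + y * I ≠ 0 := fun x hx => by have := congrArg Complex.re hx; simp at this; linarith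
  have split : ∀ (γ : ℝ → ℂ) (p q : ℝ), Continuous γ → (∀ x, γ x ≠ 0) →
      ∫ x in p..q, Φ (γ x) * (γ x)⁻¹ = (∫ x in p..q, dslope Φ 0 (γ x)) + Φ 0 * ∫ x in p..q, (γ x)⁻¹ := by
    intro γ p q hγ hn
    rw [← intervalIntegral.integral_const_mul, ← intervalIntegral.integral_add]
    · exact intervalIntegral.integral_congr fun x _ => key _ (hn x)
    · exact (hdc.comp hγ).intervalIntegrable _ _
    · exact (continuous_const.mul (hγ.inv₀ hn)).intervalIntegrable _ _
  rw [split (fun x => (x:ℂ) - L * I) _ _ (by fun_prop) n1, split (fun x => (x:ℂ) + L * I) _ _ (by fun_prop) n2,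
    split (fun y => (b:ℂ) + y * I) _ _ (by fun_prop) n3, split (fun y => -(a:ℂ) + y * I) _ _ (by fun_prop) n4]
  have hr := rect_inv ha hb hL
  have h' : (∫ x in (-a)..b, dslope Φ 0 ((x:ℂ) - L * I)) = ∫ x in (-a)..b, dslope Φ 0 ((x:ℂ) + -(L:ℂ) * I) := by
    congr 1; ext x; congr 1; ring
  rw [← h'] at h
  linear_combination (-Φ 0) * hr - h

lemma norm_kern (ℓ B x y : ℝ) : ‖cexp (ℓ * ((x:ℂ) + y * I) + B^2 * ((x:ℂ) + y * I)^2)‖ = Real.exp (ℓ * x + B^2 * x^2) * Real.exp (-(B^2 * y^2)) := by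
  rw [Complex.norm_exp, ← Real.exp_add]
  congr 1
  have e : (ℓ:ℂ) * ((x:ℂ) + y * I) + (B:ℂ)^2 * ((x:ℂ) + y * I)^2 = ((ℓ * x + B^2 * (x^2 - y^2) : ℝ):ℂ) + ((ℓ * y + B^2 * (2*x*y) : ℝ):ℂ) * I := by
    push_cast; linear_combination (B:ℂ)^2 * (y:ℂ)^2 * I_sq
  rw [e, Complex.add_re, Complex.re_ofReal_mul, Complex.I_re, Complex.ofReal_re]; ring

lemma rectK {H : ℂ → ℂ} (hH : Differentiable ℂ H) {a b L : ℝ} (ha : 0 < a) (hb : 0 < b) (hL : 0 < L) (B : ℝ) {ℓ : ℝ} (hℓ : 0 ≤ ℓ) {Mh : ℝ}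
    (h1 : ∀ x ∈ Icc (-a) b, ‖H ((x:ℂ) + L * I)‖ ≤ Mh) (h2 : ∀ x ∈ Icc (-a) b, ‖H ((x:ℂ) - L * I)‖ ≤ Mh) :
    ‖H 0‖ ≤ Real.exp (ℓ * b + B^2 * b^2) / b * (∫ v in (-L)..L, ‖H ((b:ℂ) + v * I)‖ * Real.exp (-(B^2 * v^2)))
      + Real.exp (-(ℓ * a) + B^2 * a^2) / a * (∫ v in (-L)..L, ‖H (-(a:ℂ) + v * I)‖ * Real.exp (-(B^2 * v^2)))
      + (a + b) / L * Real.exp (ℓ * b + B^2 * (a+b)^2 - B^2 * L^2) * Mh := by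
  set Φ : ℂ → ℂ := fun w => H w * cexp (ℓ * w + B^2 * w^2) with hΦ
  have hΦd : Differentiable ℂ Φ := by
    have : Differentiable ℂ fun w : ℂ => cexp ((ℓ:ℂ) * w + (B:ℂ)^2 * w^2) := by fun_prop
    exact hH.mul this
  have hΦ0 : Φ 0 = H 0 := by simp [hΦ]
  have hMh : 0 ≤ Mh := (norm_nonneg _).trans (h1 b ⟨by linarith, le_refl _⟩)
  have hk := rectKeq hΦd ha hb hL
  rw [hΦ0] at hk
  have hor : ∀ σ : ℝ, (σ = 1 ∨ σ = -1) → (∀ x ∈ Icc (-a) b, ‖H ((x:ℂ) + ((σ*L:ℝ):ℂ) * I)‖ ≤ Mh) →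
      ‖∫ x in (-a)..b, Φ ((x:ℂ) + ((σ*L:ℝ):ℂ) * I) * ((x:ℂ) + ((σ*L:ℝ):ℂ) * I)⁻¹‖ ≤ (a + b) / L * Real.exp (ℓ * b + B^2 * (a+b)^2 - B^2 * L^2) * Mh := by
    intro σ hσ hM
    have hσ2 : (σ*L)^2 = L^2 := by rcases hσ with rfl | rfl <;> ring
    refine (intervalIntegral.norm_integral_le_of_norm_le_const (C := Mh * Real.exp (ℓ * b + B^2 * (a+b)^2 - B^2 * L^2) * L⁻¹) fun x hx => ?_).trans (le_of_eq ?_)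
    · rw [uIoc_of_le (by linarith)] at hx
      have hx' : x ∈ Icc (-a) b := ⟨hx.1.le, hx.2⟩
      rw [norm_mul, norm_mul, norm_kern, hσ2, norm_inv, ← Real.exp_add]
      have hn : L ≤ ‖(x:ℂ) + ((σ*L:ℝ):ℂ) * I‖ := by
        refine le_trans ?_ (Complex.abs_im_le_norm _)
        rcases hσ with rfl | rfl <;> simp [abs_of_pos hL]
      have hx2 : x^2 ≤ (a+b)^2 := by
        apply sq_le_sq'
        · linarith [hx'.1]
        · linarith [hx'.2]
      have hE : Real.exp (ℓ * x + B^2 * x^2 + -(B^2 * L^2)) ≤ Real.exp (ℓ * b + B^2 * (a+b)^2 - B^2 * L^2) := by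
        apply Real.exp_le_exp.mpr
        have := mul_le_mul_of_nonneg_left hx2 (sq_nonneg B)
        have := mul_le_mul_of_nonneg_left hx'.2 hℓ
        linarith
      have := hM x hx'
      gcongr
    · rw [abs_of_pos (by linarith)]; field_simp; ring
  have ver : ∀ q : ℝ, q ≠ 0 → ‖∫ y in (-L)..L, Φ ((q:ℂ) + y * I) * ((q:ℂ) + y * I)⁻¹‖ ≤
      Real.exp (ℓ * q + B^2 * q^2) / |q| * ∫ v in (-L)..L, ‖H ((q:ℂ) + v * I)‖ * Real.exp (-(B^2 * v^2)) := by
    intro q hq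
    rw [← intervalIntegral.integral_const_mul]
    refine intervalIntegral.norm_integral_le_of_norm_le (by linarith) (Eventually.of_forall fun y _ => ?_) ?_
    · rw [norm_mul, norm_mul, norm_kern, norm_inv]
      have hn : |q| ≤ ‖(q:ℂ) + (y:ℂ) * I‖ := by
        refine le_trans ?_ (Complex.abs_re_le_norm _)
        simp
      have hq0 : 0 < |q| := abs_pos.mpr hq
      calc _ ≤ ‖H ((q:ℂ) + y * I)‖ * (Real.exp (ℓ * q + B^2 * q^2) * Real.exp (-(B^2 * y^2))) * |q|⁻¹ := by gcongr
        _ = _ := by ring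
    · refine Continuous.intervalIntegrable ?_ _ _
      have : Continuous fun v : ℝ => H ((q:ℂ) + v * I) := hH.continuous.comp (by fun_prop)
      exact continuous_const.mul (this.norm.mul (by fun_prop))
  have v1 := ver b hb.ne'
  have v2 := ver (-a) (by linarith)
  rw [abs_of_pos hb] at v1
  rw [abs_neg, abs_of_pos ha] at v2
  have o1 := hor 1 (Or.inl rfl) (by simpa using h1)
  have o2 := hor (-1) (Or.inr rfl) (fun x hx => by
    have := h2 x hx
    rw [sub_eq_add_neg] at this
    simpa using this)
  have e1 : (∫ x in (-a)..b, Φ ((x:ℂ) + ((1*L:ℝ):ℂ) * I) * ((x:ℂ) + ((1*L:ℝ):ℂ) * I)⁻¹) = ∫ x in (-a)..b, Φ ((x:ℂ) + L * I) * ((x:ℂ) + L * I)⁻¹ := by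
    simp
  have e2 : (∫ x in (-a)..b, Φ ((x:ℂ) + ((-1*L:ℝ):ℂ) * I) * ((x:ℂ) + ((-1*L:ℝ):ℂ) * I)⁻¹) = ∫ x in (-a)..b, Φ ((x:ℂ) - L * I) * ((x:ℂ) - L * I)⁻¹ := by
    congr 1; ext x; rw [show (x:ℂ) + ((-1*L:ℝ):ℂ) * I = (x:ℂ) - L * I by push_cast; ring]
  rw [e1] at o1
  rw [e2] at o2
  have c2 : ((-a:ℝ):ℂ) = -(a:ℂ) := by push_cast; rfl
  simp only [c2, mul_neg, neg_sq] at v2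
  have hn := congrArg norm hk
  rw [norm_mul, norm_mul, norm_mul, norm_I, Complex.norm_real, Real.norm_of_nonneg Real.pi_pos.le] at hn
  norm_num at hn
  have tri : ∀ A B C D : ℂ, ‖A - B + I * C - I * D‖ ≤ ‖A‖ + ‖B‖ + ‖C‖ + ‖D‖ := by
    intro A B C D
    calc _ ≤ ‖A - B + I * C‖ + ‖I * D‖ := norm_sub_le _ _
      _ ≤ ‖A - B‖ + ‖I * C‖ + ‖I * D‖ := by gcongr; exact norm_add_le _ _
      _ ≤ ‖A‖ + ‖B‖ + ‖I * C‖ + ‖I * D‖ := by gcongr; exact norm_sub_le _ _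
      _ = _ := by simp
  have t := tri (∫ x in (-a)..b, Φ ((x:ℂ) - L * I) * ((x:ℂ) - L * I)⁻¹) (∫ x in (-a)..b, Φ ((x:ℂ) + L * I) * ((x:ℂ) + L * I)⁻¹)
    (∫ y in (-L)..L, Φ ((b:ℂ) + y * I) * ((b:ℂ) + y * I)⁻¹) (∫ y in (-L)..L, Φ (-(a:ℂ) + y * I) * (-(a:ℂ) + y * I)⁻¹)
  rw [← hn] at t
  have hH0 := norm_nonneg (H 0)
  have pos1 : 0 ≤ Real.exp (ℓ * b + B^2 * b^2) / b * (∫ v in (-L)..L, ‖H ((b:ℂ) + v * I)‖ * Real.exp (-(B^2 * v^2))) := (norm_nonneg _).trans v1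
  have pos2 := (norm_nonneg _).trans v2
  have pi3 := Real.pi_gt_three
  nlinarith

end

section

noncomputable def wt (P : Finset ℕ) (n : ℕ) : ℝ := ∏ p ∈ P.filter (· ∣ n), (1 - Real.sqrt p / 2)
noncomputable def cf (P : Finset ℕ) (n : ℕ) : ℝ := (-1)^(n+1) * wt P n

lemma wt_insert {P : Finset ℕ} {q : ℕ} (hq : q ∉ P) (n : ℕ) :
    wt (insert q P) n = wt P n + if q ∣ n then (-(Real.sqrt q / 2)) * wt P n else 0 := by
  unfold wt
  rw [Finset.filter_insert]
  split_ifs with h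
  · rw [Finset.prod_insert (by simp [hq])]; ring
  · simp

lemma wt_mul {P : Finset ℕ} (hP : ∀ p ∈ P, p.Prime) {q : ℕ} (hq : q.Prime) (hqP : q ∉ P) (n : ℕ) : wt P (q * n) = wt P n := by
  unfold wt
  refine Finset.prod_congr ?_ fun _ _ => rfl
  ext p
  simp only [Finset.mem_filter]
  refine and_congr_right fun hp => ?_
  rw [(hP p hp).dvd_mul]
  refine or_iff_right fun h => ?_
  rw [(Nat.prime_dvd_prime_iff_eq (hP p hp) hq).mp h] at hp
  exact hqP hp

lemma hasSum_dvd {f : ℕ → ℂ} {q : ℕ} (hq : 0 < q) {S : ℂ} (h : HasSum (fun m => f (q * m)) S) :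
    HasSum (fun n => if q ∣ n then f n else 0) S := by
  have hinj : Function.Injective fun m : ℕ => q * m := fun a b hab => Nat.eq_of_mul_eq_mul_left hq hab
  have h0 : ∀ n ∉ Set.range (fun m : ℕ => q * m), (if q ∣ n then f n else 0) = 0 := fun n hn => by
    refine if_neg fun ⟨m, hm⟩ => hn ⟨m, hm.symm⟩
  rw [← hinj.hasSum_iff h0]
  have e : ((fun n => if q ∣ n then f n else 0) ∘ fun m : ℕ => q * m) = fun m => f (q * m) := by
    ext m; simp
  rw [e]; exact h

lemma cf_hasSum {P : Finset ℕ} (hP : ∀ p ∈ P, p.Prime ∧ 17 ≤ p) {s : ℂ} (hs : 1 < s.re) :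
    HasSum (fun n : ℕ => (cf P n : ℂ) * (n:ℂ)^(-s)) (eZ s * RR P (-1/2) s) := by
  classical
  induction P using Finset.induction_on with
  | empty => simpa [cf, wt, RR] using eZ_hasSum hs
  | insert q P hq ih =>
    have ih' := ih fun p hp => hP p (Finset.mem_insert_of_mem hp)
    have hqp := hP q (Finset.mem_insert_self _ _)
    have hqodd : Odd q := hqp.1.odd_of_ne_two (by omega)
    have hmul : HasSum (fun m : ℕ => (-(Real.sqrt q / 2 : ℝ) : ℂ) * ((cf P (q*m) : ℂ) * ((q*m:ℕ):ℂ)^(-s)))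
        (((-1/2:ℝ):ℂ) * (q:ℂ)^(1/2 - s) * (eZ s * RR P (-1/2) s)) := by
      have := ih'.mul_left (((-1/2:ℝ):ℂ) * (q:ℂ)^(1/2 - s))
      have e : (fun m : ℕ => (-(Real.sqrt q / 2 : ℝ) : ℂ) * ((cf P (q*m) : ℂ) * ((q*m:ℕ):ℂ)^(-s))) =
          fun m : ℕ => ((-1/2:ℝ):ℂ) * (q:ℂ)^(1/2 - s) * ((cf P m : ℂ) * (m:ℂ)^(-s)) := by
        ext m
        have hq0 : (q:ℂ) ≠ 0 := by exact_mod_cast hqp.1.ne_zero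
        have e1 : cf P (q*m) = cf P m := by
          rw [cf, cf, wt_mul (fun p hp => (hP p (Finset.mem_insert_of_mem hp)).1) hqp.1 hq]
          congr 1
          rw [pow_succ, pow_succ, pow_mul, hqodd.neg_one_pow]
        have e2 : (q:ℂ)^(1/2 - s) = (Real.sqrt q : ℂ) * (q:ℂ)^(-s) := by
          rw [sub_eq_add_neg, Complex.cpow_add _ _ hq0, Real.sqrt_eq_rpow, Complex.ofReal_cpow (by positivity)]
          push_cast; rfl
        rw [e1, e2, Nat.cast_mul, Complex.natCast_mul_natCast_cpow]
        push_cast; ring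
      rw [e]; exact this
    have h2 := hasSum_dvd (f := fun n => (-(Real.sqrt q / 2 : ℝ) : ℂ) * ((cf P n : ℂ) * (n:ℂ)^(-s))) hqp.1.pos hmul
    have h3 := ih'.add h2
    have e : eZ s * RR (insert q P) (-1/2) s = eZ s * RR P (-1/2) s + ((-1/2:ℝ):ℂ) * (q:ℂ)^(1/2 - s) * (eZ s * RR P (-1/2) s) := by
      rw [RR, Finset.prod_insert hq, ← RR]; ring
    rw [e]
    convert h3 using 2 with n
    rw [cf, wt_insert hq, cf]
    split_ifs <;> push_cast <;> ring

lemma wt_abs {P : Finset ℕ} (hP : ∀ p ∈ P, p.Prime ∧ 17 ≤ p) {n : ℕ} (hn : 1 ≤ n) : |wt P n| ≤ Real.sqrt n := by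
  have h1 : |wt P n| ≤ ∏ p ∈ P.filter (· ∣ n), Real.sqrt p := by
    rw [wt, Finset.abs_prod]
    refine Finset.prod_le_prod (fun _ _ => abs_nonneg _) fun p hp => ?_
    have hp17 := (hP p (Finset.mem_filter.mp hp).1).2
    have h4 : (4:ℝ) ≤ Real.sqrt p := Real.le_sqrt_of_sq_le (by norm_num; exact_mod_cast (by omega : 16 ≤ p))
    rw [abs_le]; constructor <;> linarith
  refine h1.trans ?_
  have h2 : ∏ p ∈ P.filter (· ∣ n), Real.sqrt p = Real.sqrt ((∏ p ∈ P.filter (· ∣ n), p : ℕ) : ℝ) := by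
    push_cast
    simp_rw [Real.sqrt_eq_rpow]
    exact Real.finsetProd_rpow _ _ (fun p _ => by positivity) _
  rw [h2]
  apply Real.sqrt_le_sqrt
  have : ∏ p ∈ P.filter (· ∣ n), p ∣ n := Finset.prod_primes_dvd n (fun p hp => (hP p (Finset.mem_filter.mp hp).1).1.prime) fun p hp => (Finset.mem_filter.mp hp).2
  exact_mod_cast Nat.le_of_dvd (by omega) this

lemma cf_abs {P : Finset ℕ} (hP : ∀ p ∈ P, p.Prime ∧ 17 ≤ p) {n : ℕ} (hn : 1 ≤ n) : |cf P n| ≤ Real.sqrt n := by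
  rw [cf, abs_mul, abs_pow, abs_neg, abs_one, one_pow, one_mul]; exact wt_abs hP hn

lemma cf_sq (P : Finset ℕ) (n : ℕ) : cf P n^2 = wt P n^2 := by
  rw [cf, mul_pow, ← pow_mul, mul_comm (n+1) 2, pow_mul]; norm_num

lemma diag_wt {P : Finset ℕ} (hP : ∀ p ∈ P, p.Prime ∧ 17 ≤ p) (N : ℕ) :
    ∑ n ∈ Finset.Icc 1 N, wt P n^2 / n ≤ (∏ p ∈ P, (5/4 - (p:ℝ)^(-(1/2):ℝ))) * ∑ n ∈ Finset.Icc 1 N, (1:ℝ)/n := by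
  classical
  induction P using Finset.induction_on with
  | empty => simp [wt]
  | insert q P hq ih =>
    have hP' : ∀ p ∈ P, p.Prime ∧ 17 ≤ p := fun p hp => hP p (Finset.mem_insert_of_mem hp)
    have ih' := ih hP'
    have hqp := hP q (Finset.mem_insert_self _ _)
    have hq0 : (0:ℝ) < q := by exact_mod_cast hqp.1.pos
    set κ : ℝ := q/4 - Real.sqrt q with hκ
    have hsq : Real.sqrt q ^ 2 = q := Real.sq_sqrt hq0.le
    have h4 : (4:ℝ) ≤ Real.sqrt q := Real.le_sqrt_of_sq_le (by norm_num; exact_mod_cast (by omega : 16 ≤ q))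
    have hκ0 : 0 ≤ κ := by rw [hκ]; nlinarith
    have e1 : ∀ n : ℕ, wt (insert q P) n^2 / n = wt P n^2/n + κ * (if q ∣ n then wt P n^2/n else 0) := by
      intro n
      rw [wt_insert hq]
      split_ifs
      · have : (wt P n + -(Real.sqrt q/2) * wt P n)^2 = (1 - Real.sqrt q + Real.sqrt q^2/4) * wt P n^2 := by ring
        rw [this, hsq, hκ]; ring
      · simp
    simp_rw [e1]
    rw [Finset.sum_add_distrib, ← Finset.mul_sum, Finset.prod_insert hq]
    have e2 : (∑ n ∈ Finset.Icc 1 N, if q ∣ n then wt P n^2/n else 0) ≤ (1/q) * ∑ n ∈ Finset.Icc 1 N, wt P n^2 / n := by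
      rw [← Finset.sum_filter]
      have hinj : Set.InjOn (fun m : ℕ => q * m) (Finset.Icc 1 (N/q) : Finset ℕ) := fun a _ b _ hab => Nat.eq_of_mul_eq_mul_left hqp.1.pos hab
      have e3 : (Finset.Icc 1 N).filter (q ∣ ·) = (Finset.Icc 1 (N/q)).image (fun m => q * m) := by
        ext n
        simp only [Finset.mem_filter, Finset.mem_Icc, Finset.mem_image]
        constructor
        · rintro ⟨⟨h1, h2⟩, m, rfl⟩
          refine ⟨m, ⟨?_, ?_⟩, rfl⟩
          · rcases Nat.eq_zero_or_pos m with h | h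
            · simp [h] at h1
            · exact h
          · rw [Nat.le_div_iff_mul_le hqp.1.pos, mul_comm]; exact h2
        · rintro ⟨m, ⟨h1, h2⟩, rfl⟩
          refine ⟨⟨Nat.mul_pos hqp.1.pos h1, ?_⟩, dvd_mul_right _ _⟩
          rw [Nat.le_div_iff_mul_le hqp.1.pos, mul_comm] at h2; exact h2
      rw [e3, Finset.sum_image hinj]
      have e4 : ∀ m : ℕ, wt P (q*m)^2 / ((q*m:ℕ):ℝ) = (1/q) * (wt P m^2/m) := fun m => by
        rw [wt_mul (fun p hp => (hP' p hp).1) hqp.1 hq, Nat.cast_mul, mul_comm (1/(q:ℝ)), div_mul_div_comm, mul_one, mul_comm (m:ℝ)]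
      simp_rw [e4]
      rw [← Finset.mul_sum]
      gcongr
      exact Nat.div_le_self _ _
    have e5 : (q:ℝ)^(-(1/2):ℝ) = (Real.sqrt q)⁻¹ := by
      rw [Real.rpow_neg hq0.le, Real.sqrt_eq_rpow]
    have e6 : κ * (1/q) = 1/4 - (q:ℝ)^(-(1/2):ℝ) := by
      rw [e5, hκ]
      have : (q:ℝ) ≠ 0 := hq0.ne'
      have h' : Real.sqrt q ≠ 0 := by linarith
      field_simp
      linear_combination (-4)*hsq
    have hS : 0 ≤ ∑ n ∈ Finset.Icc 1 N, wt P n^2 / n := Finset.sum_nonneg fun n _ => by positivity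
    have hq4 := (rpow_p hqp.2).2
    calc _ ≤ (∑ n ∈ Finset.Icc 1 N, wt P n^2 / n) + κ * ((1/q) * ∑ n ∈ Finset.Icc 1 N, wt P n^2 / n) := by gcongr
      _ = (5/4 - (q:ℝ)^(-(1/2):ℝ)) * ∑ n ∈ Finset.Icc 1 N, wt P n^2 / n := by rw [← mul_assoc, e6]; ring
      _ ≤ (5/4 - (q:ℝ)^(-(1/2):ℝ)) * ((∏ p ∈ P, (5/4 - (p:ℝ)^(-(1/2):ℝ))) * ∑ n ∈ Finset.Icc 1 N, (1:ℝ)/n) := by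
          refine mul_le_mul_of_nonneg_left ih' (by linarith)
      _ = _ := by ring

lemma harm_le {N : ℕ} : ∑ n ∈ Finset.Icc 1 N, (1:ℝ)/n ≤ 1 + Real.log N := by
  have := harmonic_le_one_add_log N
  rw [harmonic_eq_sum_Icc] at this
  push_cast at this
  simpa [one_div] using this

noncomputable def GN (P : Finset ℕ) (N : ℕ) (s : ℂ) : ℂ := ∑ n ∈ Finset.Icc 1 N, (cf P n : ℂ) * (n:ℂ)^(-s)

lemma GN_diff (P : Finset ℕ) (N : ℕ) : Differentiable ℂ (GN P N) := by
  unfold GN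
  refine Differentiable.fun_sum fun n hn => ?_
  have : (n:ℂ) ≠ 0 := by have := (Finset.mem_Icc.mp hn).1; exact_mod_cast (by omega : n ≠ 0)
  intro s
  exact (differentiableAt_const _).mul ((differentiableAt_id.neg).const_cpow (Or.inl this))

lemma GN_norm {P : Finset ℕ} (hP : ∀ p ∈ P, p.Prime ∧ 17 ≤ p) (N : ℕ) {s : ℂ} (hs : 0 ≤ s.re) : ‖GN P N s‖ ≤ (N:ℝ)^2 := by
  unfold GN
  refine (norm_sum_le_of_le (f := fun n => (cf P n : ℂ) * (n:ℂ)^(-s)) (n := fun _ => (N:ℝ)) _ fun n hn => ?_).trans (by simp [sq])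
  obtain ⟨h1, h2⟩ := Finset.mem_Icc.mp hn
  have hn1 : (1:ℝ) ≤ n := by exact_mod_cast h1
  rw [norm_mul, Complex.norm_real, Real.norm_eq_abs, Complex.norm_natCast_cpow_of_pos (by omega)]
  have h3 : (n:ℝ)^((-s).re) ≤ 1 := Real.rpow_le_one_of_one_le_of_nonpos hn1 (by simpa using hs)
  have h4 : Real.sqrt n ≤ n := by rw [Real.sqrt_le_left (by linarith)]; nlinarith
  have h5 : (n:ℝ) ≤ N := by exact_mod_cast h2
  calc _ ≤ Real.sqrt n * 1 := mul_le_mul (cf_abs hP h1) h3 (by positivity) (by positivity)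
    _ ≤ _ := by linarith

lemma GN_tail : ∃ C : ℝ, 1 ≤ C ∧ ∀ (P : Finset ℕ) (N : ℕ) (s : ℂ), (∀ p ∈ P, p.Prime ∧ 17 ≤ p) → 1 ≤ N → 3 ≤ s.re →
    ‖eZ s * RR P (-1/2) s - GN P N s‖ ≤ C * (N:ℝ)^(5/2 - s.re) := by
  have hsum : Summable fun n : ℕ => (n:ℝ)^(-2:ℝ) := Real.summable_nat_rpow.mpr (by norm_num)
  refine ⟨max 1 (∑' n : ℕ, (n:ℝ)^(-2:ℝ)), le_max_left _ _, fun P N s hP hN hs => ?_⟩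
  have h := cf_hasSum hP (s := s) (by linarith)
  have hG : GN P N s = ∑ n ∈ Finset.range (N+1), (cf P n : ℂ) * (n:ℂ)^(-s) := by
    rw [Finset.sum_range_succ', GN]
    have h0 : ((0:ℕ):ℂ)^(-s) = 0 := by
      rw [Nat.cast_zero, Complex.zero_cpow]
      intro h; have := congrArg Complex.re h; simp at this; linarith
    rw [h0, mul_zero, add_zero, Finset.range_eq_Ico, Finset.sum_Ico_add' (fun n : ℕ => (cf P n : ℂ) * (n:ℂ)^(-s)) 0 N 1]
    exact Finset.sum_congr (by ext; simp only [Finset.mem_Icc, Finset.mem_Ico]; omega) fun _ _ => rfl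
  have hN1 : (1:ℝ) ≤ N := by exact_mod_cast hN
  have ht := (hasSum_nat_add_iff' (N+1)).mpr h
  rw [← hG] at ht
  have hb : ∀ i : ℕ, ‖(cf P (i+(N+1)) : ℂ) * ((i+(N+1) : ℕ):ℂ)^(-s)‖ ≤ (N:ℝ)^(5/2 - s.re) * ((i+(N+1):ℕ):ℝ)^(-2:ℝ) := by
    intro i
    set n := i + (N+1) with hn
    have hnN : (N:ℝ) ≤ n := by exact_mod_cast (by omega : N ≤ n)
    have hn0 : (0:ℝ) < n := by linarith
    rw [norm_mul, Complex.norm_real, Real.norm_eq_abs, Complex.norm_natCast_cpow_of_pos (by omega)]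
    calc _ ≤ Real.sqrt n * (n:ℝ)^((-s).re) := mul_le_mul_of_nonneg_right (cf_abs hP (by omega)) (by positivity)
      _ = (n:ℝ)^(5/2 - s.re) * (n:ℝ)^(-2:ℝ) := by
          rw [Real.sqrt_eq_rpow, ← Real.rpow_add hn0, ← Real.rpow_add hn0]; congr 1; simp; ring
      _ ≤ _ := by
          gcongr ?_ * _
          exact Real.rpow_le_rpow_of_nonpos (by linarith) hnN (by linarith)
  have hs2 : Summable fun i : ℕ => ((i+(N+1):ℕ):ℝ)^(-2:ℝ) := (summable_nat_add_iff (N+1)).mpr hsum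
  have := ht.norm_le_of_bounded (hs2.mul_left _).hasSum hb
  refine this.trans ?_
  rw [tsum_mul_left, mul_comm]
  gcongr
  refine le_trans ?_ (le_max_right _ _)
  have h6 := hsum.sum_add_tsum_nat_add (N+1)
  have h7 : 0 ≤ ∑ i ∈ Finset.range (N+1), (i:ℝ)^(-2:ℝ) := Finset.sum_nonneg fun i _ => by positivity
  linarith

end

section

noncomputable def gg (P : Finset ℕ) (s : ℂ) : ℂ := eZ s * RR P (-1/2) s

lemma hm2 : |(-1/2:ℝ)| ≤ 1/2 := by norm_num [abs_le]

lemma gg_diff {P : Finset ℕ} (hP : ∀ p ∈ P, 17 ≤ p) : Differentiable ℂ (gg P) := eZ_diff.mul (RR_diff hP _)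

noncomputable def etaz (z : ℕ) : ℝ := 100 * Real.log z / xz z

lemma eta_facts {z : ℕ} (hz : 1000000 ≤ z) : 0 < etaz z ∧ xz z * etaz z = 100 * Real.log z ∧ 1 ≤ Real.log z ∧ Real.log z ≤ z ∧
    1/etaz z ≤ (z:ℝ)^3 ∧ z * etaz z ≤ 1/1000 ∧ etaz z ≤ 1/1000 := by
  have hz1 : (1000000:ℝ) ≤ z := by exact_mod_cast hz
  have hl : 1 ≤ Real.log z := by
    rw [Real.le_log_iff_exp_le (by linarith)]; linarith [Real.exp_one_lt_d9]
  have hl2 : Real.log z ≤ z := (Real.log_le_sub_one_of_pos (by linarith)).trans (by linarith)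
  have hx : 0 < xz z := by unfold xz; positivity
  have h1 : z * etaz z ≤ 1/1000 := by
    rw [etaz, ← mul_div_assoc, div_le_div_iff₀ hx (by norm_num), xz]
    nlinarith [sq_nonneg (z:ℝ), mul_le_mul hl2 hz1 (by norm_num) (by linarith)]
  have h0 : 0 < etaz z := by unfold etaz; positivity
  refine ⟨h0, ?_, hl, hl2, ?_, h1, ?_⟩
  · unfold etaz; field_simp
  · unfold etaz; rw [one_div_div, div_le_iff₀ (by positivity), xz]
    nlinarith [pow_pos (by linarith : (0:ℝ) < z) 3]
  · nlinarith

lemma gg_sup {z : ℕ} {p : ℝ}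
    (hp : ∀ t : ℝ, ‖ff (Pz z) (-1/2) (1/2 + (t:ℂ) * I)‖ ≤ ‖ff (Pz z) (-1/2) (1/2 + (p:ℂ) * I)‖ * (1 + |t - p|)^2) {w : ℂ} (hw : 0 ≤ w.re) :
    ‖gg (Pz z) (1/2 + (p:ℂ) * I + w)‖ ≤ 26/25 * ‖gg (Pz z) (1/2 + (p:ℂ) * I)‖ * ‖1 + 5 * w‖^2 * Real.exp (2 * z * ‖w‖) := by
  have hP2 : ∀ q ∈ Pz z, 17 ≤ q := fun q hq => (Pz_mem hq).2
  obtain ⟨C, hC1, hC⟩ := ff_growth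
  have h1 := peak_PL (ff_diff hP2 (-1/2)) (by positivity) (fun s hs => hC (Pz z) (-1/2) hP2 hm2 s hs) hp hw
  have hpos := RR_pos hP2 hm2 (s := 1/2 + (p:ℂ) * I + w) (by simp; linarith)
  have h2 := RR_ratio hP2 hm2 (s := 1/2 + (p:ℂ) * I) (s' := 1/2 + (p:ℂ) * I + w) (by simp) (by simp; linarith)
  have h3 : ‖1/2 + (p:ℂ) * I - (1/2 + (p:ℂ) * I + w)‖ = ‖w‖ := by rw [← norm_neg]; congr 1; ring
  rw [h3] at h2
  have h4 : Real.exp (ZP (Pz z) * ‖w‖) ≤ Real.exp (2 * z * ‖w‖) := by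
    have := ZP_Pz z; gcongr
  unfold ff at h1
  unfold gg
  rw [norm_mul, norm_pow] at h1
  rw [norm_mul (eZ (1/2 + (p:ℂ) * I)), norm_pow] at h1
  rw [norm_mul, norm_mul]
  set s' := 1/2 + (p:ℂ) * I + w
  set s := 1/2 + (p:ℂ) * I
  refine le_of_mul_le_mul_right ?_ hpos
  calc _ = ‖eZ s'‖ * ‖RR (Pz z) (-1/2) s'‖^2 := by ring
    _ ≤ 26/25 * (‖eZ s‖ * ‖RR (Pz z) (-1/2) s‖) * ‖1 + 5 * w‖^2 * ‖RR (Pz z) (-1/2) s‖ := by rw [← sub_nonneg]; rw [← sub_nonneg] at h1; refine h1.trans (le_of_eq (by ring))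
    _ ≤ 26/25 * (‖eZ s‖ * ‖RR (Pz z) (-1/2) s‖) * ‖1 + 5 * w‖^2 * (Real.exp (2 * z * ‖w‖) * ‖RR (Pz z) (-1/2) s'‖) := by
        refine mul_le_mul_of_nonneg_left (h2.trans (mul_le_mul_of_nonneg_right h4 (norm_nonneg _))) (by positivity)
    _ = _ := by ring

lemma gg_left : ∃ C : ℝ, 1 ≤ C ∧ ∀ z : ℕ, 1000000 ≤ z → C ≤ z → ∀ y t : ℝ, 0 ≤ y → y ≤ etaz z → 2 ≤ t → Real.log t ≤ xz z + 1 →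
    ‖gg (Pz z) (((1/2-y:ℝ):ℂ) + t * I)‖ ≤ 3 * Real.exp (y * xz z) * ‖gg (Pz z) (((1/2+y:ℝ):ℂ) + t * I)‖ := by
  obtain ⟨C, hC1, hC⟩ := eZ_left
  refine ⟨C, hC1, fun z hz hCz y t hy0 hy ht hlt => ?_⟩
  obtain ⟨h0, -, -, -, -, h1, h2⟩ := eta_facts hz
  have hz1 : (1000000:ℝ) ≤ z := by exact_mod_cast hz
  have hP2 : ∀ q ∈ Pz z, 17 ≤ q := fun q hq => (Pz_mem hq).2
  have a1 := hC y t hy0 (by linarith) ht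
  have a2 := RR_left hP2 hm2 hy0 t
  unfold gg
  rw [norm_mul, norm_mul]
  have h3 : Real.exp (y * (Real.log t + C)) * Real.exp (2 * y * ZP (Pz z)) ≤ 3 * Real.exp (y * xz z) := by
    have h5 : y * (Real.log t + C) + 2 * y * ZP (Pz z) ≤ 1 + y * xz z := by
      have a := ZP_Pz z
      have b : y * (Real.log t + C + 2 * ZP (Pz z)) ≤ y * (xz z + 6 * z) := mul_le_mul_of_nonneg_left (by linarith) hy0
      have c : y * z ≤ etaz z * z := by gcongr
      nlinarith
    rw [← Real.exp_add]
    refine (Real.exp_le_exp.mpr h5).trans ?_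
    rw [Real.exp_add]
    have := Real.exp_one_lt_d9
    gcongr; linarith
  calc _ ≤ (Real.exp (y * (Real.log t + C)) * ‖eZ (((1/2+y:ℝ):ℂ) + t * I)‖) * (Real.exp (2 * y * ZP (Pz z)) * ‖RR (Pz z) (-1/2) (((1/2+y:ℝ):ℂ) + t * I)‖) :=
        mul_le_mul a1 a2 (norm_nonneg _) (by positivity)
    _ = (Real.exp (y * (Real.log t + C)) * Real.exp (2 * y * ZP (Pz z))) * (‖eZ (((1/2+y:ℝ):ℂ) + t * I)‖ * ‖RR (Pz z) (-1/2) (((1/2+y:ℝ):ℂ) + t * I)‖) := by ring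
    _ ≤ _ := mul_le_mul_of_nonneg_right h3 (by positivity)

lemma gg_crude : ∃ C : ℝ, 1 ≤ C ∧ ∀ z : ℕ, 1000000 ≤ z → C ≤ z → ∀ s : ℂ, 1/2 ≤ s.re → s.re ≤ 102 → |s.im| ≤ 3 * Tz z →
    ‖gg (Pz z) s‖ ≤ Real.exp (2 * xz z) := by
  obtain ⟨C, hC1, hC⟩ := eZ_growth
  refine ⟨C, hC1, fun z hz hCz s h1 h2 h3 => ?_⟩
  have hz1 : (1000000:ℝ) ≤ z := by exact_mod_cast hz
  have hP2 : ∀ q ∈ Pz z, 17 ≤ q := fun q hq => (Pz_mem hq).2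
  have hx := xz_ge (z := z) (by omega)
  have a1 := RR_up hP2 hm2 h1
  have a2 := card_pow z
  have hT1 : (z:ℝ) ≤ Tz z := by rw [Tz]; linarith [Real.add_one_le_exp (xz z)]
  have a3 : ‖s‖ ≤ 4 * Tz z := by
    refine (Complex.norm_le_abs_re_add_abs_im s).trans ?_
    rw [abs_of_nonneg (by linarith : 0 ≤ s.re)]; linarith
  have a4 : (1:ℝ) ≤ (3/2:ℝ)^(Pz z).card := one_le_pow₀ (by norm_num)
  have a5 : (3/2:ℝ)^(Pz z).card ≤ Real.exp z := by nlinarith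
  have a6 : 4 * (z:ℝ) ≤ Real.exp (2*z) := by
    have := Real.quadratic_le_exp_of_nonneg (x := 2*z) (by positivity); nlinarith
  unfold gg
  rw [norm_mul]
  calc _ ≤ (C * ‖s‖) * Real.exp z := mul_le_mul (hC s h1) (a1.trans a5) (norm_nonneg _) (by positivity)
    _ ≤ (z * (4 * Tz z)) * Real.exp z := by gcongr
    _ = (4 * z) * Real.exp z * Tz z := by ring
    _ ≤ Real.exp (2*z) * Real.exp z * Real.exp (xz z) := by rw [Tz]; gcongr
    _ = Real.exp (3 * z + xz z) := by rw [← Real.exp_add, ← Real.exp_add]; congr 1; ring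
    _ ≤ _ := Real.exp_le_exp.mpr (by linarith)

end

section

lemma height {z : ℕ} (hz : 1000000 ≤ z) {p v : ℝ} (hp1 : Tz z / 4 ≤ p) (hp2 : p ≤ 2 * Tz z) (hv : |v| ≤ 3 * z) :
    2 ≤ p + v ∧ Real.log (p + v) ≤ xz z + 1 ∧ |p + v| ≤ 3 * Tz z := by
  have hz1 : (1000000:ℝ) ≤ z := by exact_mod_cast hz
  have hx := xz_ge (z := z) (by omega)
  have hT1 : 900 * (z:ℝ) ≤ Tz z := by rw [Tz]; linarith [Real.add_one_le_exp (xz z)]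
  obtain ⟨h1, h2⟩ := abs_le.mp hv
  have h3 : 2 ≤ p + v := by linarith
  refine ⟨h3, ?_, ?_⟩
  · rw [Real.log_le_iff_le_exp (by linarith), Real.exp_add, ← Tz]
    have := Real.exp_one_gt_d9
    nlinarith
  · rw [abs_of_nonneg (by linarith)]; linarith

lemma gg_strip : ∃ C : ℝ, 1 ≤ C ∧ ∀ z : ℕ, 1000000 ≤ z → C ≤ z → ∀ p : ℝ, Tz z / 4 ≤ p → p ≤ 2 * Tz z →
    (∀ t : ℝ, ‖ff (Pz z) (-1/2) (1/2 + (t:ℂ) * I)‖ ≤ ‖ff (Pz z) (-1/2) (1/2 + (p:ℂ) * I)‖ * (1 + |t - p|)^2) →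
    ∀ x v : ℝ, |x| ≤ etaz z → |v| ≤ 2 * z →
    ‖gg (Pz z) (((1/2+x:ℝ):ℂ) + (p+v:ℝ) * I)‖ ≤ 1400 * z^2 * Real.exp (etaz z * xz z) * ‖gg (Pz z) (1/2 + (p:ℂ) * I)‖ * Real.exp (2*z*|v|) := by
  obtain ⟨C, hC1, hC⟩ := gg_left
  refine ⟨C, hC1, fun z hz hCz p hp1 hp2 hp x v hx hv => ?_⟩
  have hz1 : (1000000:ℝ) ≤ z := by exact_mod_cast hz
  obtain ⟨h0, -, -, -, -, h1, h2⟩ := eta_facts hz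
  have hxz : 0 < xz z := by unfold xz; positivity
  obtain ⟨k1, k2, -⟩ := height hz hp1 hp2 (v := v) (by linarith)
  set Q := ‖gg (Pz z) (1/2 + (p:ℂ) * I)‖ with hQ
  have hQ0 : 0 ≤ Q := norm_nonneg _
  have key : ∀ y : ℝ, 0 ≤ y → y ≤ etaz z → ‖gg (Pz z) (((1/2+y:ℝ):ℂ) + (p+v:ℝ) * I)‖ ≤ 450 * z^2 * Q * Real.exp (2*z*|v|) := by
    intro y hy0 hy
    have e : (((1/2+y:ℝ):ℂ) + (p+v:ℝ) * I) = 1/2 + (p:ℂ) * I + (y + v * I) := by push_cast; ring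
    have a := gg_sup hp (w := (y:ℂ) + v * I) (by simpa using hy0)
    rw [← e, ← hQ] at a
    have n1 : ‖(y:ℂ) + v * I‖ ≤ etaz z + |v| := by
      refine (norm_add_le _ _).trans ?_
      simp only [norm_real, norm_mul, norm_I, mul_one, Real.norm_eq_abs]
      rw [abs_of_nonneg hy0]; linarith
    have n2 : ‖1 + 5 * ((y:ℂ) + v * I)‖ ≤ 12 * z := by
      refine (norm_add_le _ _).trans ?_
      rw [norm_mul]; norm_num; linarith
    have n3 : Real.exp (2 * z * ‖(y:ℂ) + v * I‖) ≤ 3 * Real.exp (2*z*|v|) := by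
      have : Real.exp (2 * z * ‖(y:ℂ) + v * I‖) ≤ Real.exp (1 + 2*z*|v|) := by
        rw [Real.exp_le_exp]; nlinarith
      refine this.trans ?_
      rw [Real.exp_add]
      have := Real.exp_one_lt_d9
      gcongr; linarith
    refine a.trans ?_
    calc _ ≤ 26/25 * Q * (12 * z)^2 * (3 * Real.exp (2*z*|v|)) := by gcongr
      _ = (11232/25) * (z^2 * Q * Real.exp (2*z*|v|)) := by ring
      _ ≤ 450 * (z^2 * Q * Real.exp (2*z*|v|)) := by gcongr; norm_num
      _ = _ := by ring
  have hE : 1 ≤ Real.exp (etaz z * xz z) := Real.one_le_exp (by positivity)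
  have hY : 0 ≤ z^2 * Q * Real.exp (2*z*|v|) := by positivity
  rcases le_total 0 x with h | h
  · refine (key x h (by rwa [abs_of_nonneg h] at hx)).trans ?_
    nlinarith
  · rw [abs_of_nonpos h] at hx
    have a := hC z hz hCz (-x) (p+v) (by linarith) hx k1 k2
    have b := key (-x) (by linarith) hx
    rw [show (1/2 - -x) = 1/2 + x by ring] at a
    have c : Real.exp (-x * xz z) ≤ Real.exp (etaz z * xz z) := by gcongr
    calc _ ≤ _ := a
      _ ≤ 3 * Real.exp (etaz z * xz z) * (450 * z^2 * Q * Real.exp (2*z*|v|)) := by gcongr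
      _ ≤ _ := by nlinarith

lemma step1 : ∃ C : ℝ, 1 ≤ C ∧ ∀ z : ℕ, 1000000 ≤ z → C ≤ z → ∀ p : ℝ, Tz z / 4 ≤ p → p ≤ 2 * Tz z →
    (∀ t : ℝ, ‖ff (Pz z) (-1/2) (1/2 + (t:ℂ) * I)‖ ≤ ‖ff (Pz z) (-1/2) (1/2 + (p:ℂ) * I)‖ * (1 + |t - p|)^2) →
    ‖gg (Pz z) (1/2 + (p:ℂ) * I)‖ ≤ (z:ℝ)^54 * ∫ v in (-(z:ℝ))..z, ‖gg (Pz z) (((1/2+etaz z:ℝ):ℂ) + (p+v:ℝ) * I)‖ * Real.exp (-((z:ℝ)^2*v^2)) := by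
  obtain ⟨C, hC1, hC⟩ := gg_left
  obtain ⟨C', hC1', hC'⟩ := gg_strip
  refine ⟨max C C', hC1.trans (le_max_left _ _), fun z hz hCz p hp1 hp2 hp => ?_⟩
  have hz1 : (1000000:ℝ) ≤ z := by exact_mod_cast hz
  obtain ⟨h0, hex, hl1, hl2, hinv, h1, h2⟩ := eta_facts hz
  have hP2 : ∀ q ∈ Pz z, 17 ≤ q := fun q hq => (Pz_mem hq).2
  have hS := hC' z hz ((le_max_right _ _).trans hCz) p hp1 hp2 hp
  set η := etaz z with hη
  set Q := ‖gg (Pz z) (1/2 + (p:ℂ) * I)‖ with hQ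
  have hQ0 : 0 ≤ Q := norm_nonneg _
  have hgd := gg_diff hP2
  have hR := rectK (H := fun w => gg (Pz z) (1/2 + (p:ℂ) * I + w)) (hgd.comp ((differentiable_const _).add differentiable_id)) h0 h0
    (by linarith : (0:ℝ) < z) (z:ℝ) (ℓ := xz z / 2) (by unfold xz; positivity)
    (Mh := 1400 * z^2 * Real.exp (η * xz z) * Q * Real.exp (2*z*z))
    (fun x hx => by
      have := hS x z (abs_le.mpr ⟨hx.1, hx.2⟩) (by rw [abs_of_nonneg (by linarith)]; linarith)
      rw [abs_of_nonneg (by linarith : (0:ℝ) ≤ z)] at this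
      refine le_of_eq_of_le ?_ this
      congr 2; push_cast; ring)
    (fun x hx => by
      have := hS x (-z) (abs_le.mpr ⟨hx.1, hx.2⟩) (by rw [abs_neg, abs_of_nonneg (by linarith)]; linarith)
      rw [abs_neg, abs_of_nonneg (by linarith : (0:ℝ) ≤ z)] at this
      refine le_of_eq_of_le ?_ this
      congr 2; push_cast; ring)
  simp only [add_zero] at hR
  rw [← hQ] at hR
  set J := ∫ v in (-(z:ℝ))..z, ‖gg (Pz z) (((1/2+η:ℝ):ℂ) + (p+v:ℝ) * I)‖ * Real.exp (-((z:ℝ)^2*v^2)) with hJ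
  have hJ0 : 0 ≤ J := intervalIntegral.integral_nonneg (by linarith) fun v _ => by positivity
  have e1 : (∫ v in (-(z:ℝ))..z, ‖gg (Pz z) (1/2 + (p:ℂ) * I + ((η:ℂ) + v * I))‖ * Real.exp (-((z:ℝ)^2*v^2))) = J := by
    rw [hJ]; congr 1; ext v; congr 3; push_cast; ring
  have cont : ∀ σ : ℝ, Continuous fun v : ℝ => ‖gg (Pz z) (((σ:ℝ):ℂ) + (p+v:ℝ) * I)‖ * Real.exp (-((z:ℝ)^2*v^2)) := fun σ =>
    (hgd.continuous.comp (by fun_prop)).norm.mul (by fun_prop)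
  have e2 : (∫ v in (-(z:ℝ))..z, ‖gg (Pz z) (1/2 + (p:ℂ) * I + (-(η:ℂ) + v * I))‖ * Real.exp (-((z:ℝ)^2*v^2))) ≤ 3 * Real.exp (η * xz z) * J := by
    have : (∫ v in (-(z:ℝ))..z, ‖gg (Pz z) (1/2 + (p:ℂ) * I + (-(η:ℂ) + v * I))‖ * Real.exp (-((z:ℝ)^2*v^2))) =
        ∫ v in (-(z:ℝ))..z, ‖gg (Pz z) (((1/2-η:ℝ):ℂ) + (p+v:ℝ) * I)‖ * Real.exp (-((z:ℝ)^2*v^2)) := by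
      congr 1; ext v; congr 3; push_cast; ring
    rw [this, hJ, ← intervalIntegral.integral_const_mul]
    refine intervalIntegral.integral_mono_on (by linarith) ((cont _).intervalIntegrable _ _) ?_ ?_
    · exact ((cont _).const_mul _).intervalIntegrable _ _
    · intro v hv
      have hv' : |v| ≤ 3 * z := (abs_le.mpr ⟨hv.1, hv.2⟩).trans (by linarith)
      obtain ⟨k1, k2, -⟩ := height hz hp1 hp2 hv'
      have := hC z hz ((le_max_left _ _).trans hCz) η (p+v) h0.le le_rfl k1 k2
      rw [← mul_assoc]
      exact mul_le_mul_of_nonneg_right this (Real.exp_pos _).le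
  rw [e1] at hR
  have hzη : z^2 * η^2 ≤ 1 := by rw [← mul_pow]; exact pow_le_one₀ (by positivity) (by linarith)
  have hexp3 : Real.exp ((z:ℝ)^2*η^2) ≤ 3 := (Real.exp_le_exp.mpr hzη).trans (by linarith [Real.exp_one_lt_d9])
  have hz50 : Real.exp (xz z / 2 * η) = (z:ℝ)^50 := by
    rw [show xz z / 2 * η = (50:ℕ) * Real.log z by push_cast; linarith, Real.exp_nat_mul, Real.exp_log (by linarith)]
  have t1 : Real.exp (xz z / 2 * η + (z:ℝ)^2*η^2) / η ≤ 3 * (z:ℝ)^53 := by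
    rw [Real.exp_add, hz50, div_eq_mul_one_div]
    calc _ ≤ (z:ℝ)^50 * 3 * (z:ℝ)^3 := by gcongr
      _ = _ := by ring
  have t2 : Real.exp (-(xz z / 2 * η) + (z:ℝ)^2*η^2) / η * (3 * Real.exp (η * xz z) * J) = 3 * (Real.exp (xz z / 2 * η + (z:ℝ)^2*η^2) / η) * J := by
    have : Real.exp (-(xz z / 2 * η) + (z:ℝ)^2*η^2) * Real.exp (η * xz z) = Real.exp (xz z / 2 * η + (z:ℝ)^2*η^2) := by
      rw [← Real.exp_add]; congr 1; ring
    rw [← this]; ring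
  have t3 : (η + η)/z * Real.exp (xz z / 2 * η + (z:ℝ)^2*(η+η)^2 - (z:ℝ)^2*(z:ℝ)^2) * (1400 * z^2 * Real.exp (η * xz z) * Q * Real.exp (2*z*z)) ≤ Q/4 := by
    have a1 : (η + η)/z ≤ 1 := by rw [div_le_one (by linarith)]; linarith
    have a2 : 1400 * (z:ℝ)^2 ≤ Real.exp (3 * z) := by
      have : Real.exp (3 * z) = Real.exp z ^3 := by rw [← Real.exp_nat_mul]; norm_num
      rw [this]
      have b := Real.add_one_le_exp (z:ℝ)
      calc 1400 * (z:ℝ)^2 ≤ (z:ℝ) * (z:ℝ)^2 := by gcongr; linarith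
        _ = (z:ℝ)^3 := by ring
        _ ≤ _ := by gcongr; linarith
    calc _ ≤ 1 * Real.exp (xz z / 2 * η + (z:ℝ)^2*(η+η)^2 - (z:ℝ)^2*(z:ℝ)^2) * (Real.exp (3*z) * Real.exp (η * xz z) * Q * Real.exp (2*z*z)) := by gcongr
      _ = Real.exp (xz z / 2 * η + (z:ℝ)^2*(η+η)^2 - (z:ℝ)^2*(z:ℝ)^2 + 3 * z + η * xz z + 2*z*z) * Q := by
          rw [Real.exp_add, Real.exp_add, Real.exp_add]; ring
      _ ≤ (1/4) * Q := by
          gcongr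
          have : xz z / 2 * η + (z:ℝ)^2*(η+η)^2 - (z:ℝ)^2*(z:ℝ)^2 + 3 * z + η * xz z + 2*z*z ≤ -2 := by
            have c1 : (z:ℝ)^2*(η+η)^2 ≤ 4 := by nlinarith
            have c2 : (1000000:ℝ)^2 * (z:ℝ)^2 ≤ (z:ℝ)^2*(z:ℝ)^2 := by gcongr
            nlinarith
          refine (Real.exp_le_exp.mpr this).trans ?_
          rw [Real.exp_neg, inv_le_comm₀ (Real.exp_pos _) (by norm_num)]
          have := Real.quadratic_le_exp_of_nonneg (x := 2) (by norm_num)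
          linarith
      _ = _ := by ring
  have hE0 : 0 ≤ Real.exp (-(xz z / 2 * η) + (z:ℝ)^2*η^2) / η := by positivity
  have t1' := mul_le_mul_of_nonneg_right t1 hJ0
  have t2' := (mul_le_mul_of_nonneg_left e2 hE0).trans (le_of_eq t2)
  have hfin : Q ≤ 3 * (z:ℝ)^53 * J + 3 * (3 * (z:ℝ)^53 * J) + Q/4 := by
    refine hR.trans ?_
    refine add_le_add (add_le_add t1' (t2'.trans ?_)) t3
    rw [mul_assoc]
    exact mul_le_mul_of_nonneg_left t1' (by norm_num)
  have hX0 : 0 ≤ (z:ℝ)^53 * J := mul_nonneg (pow_nonneg (Nat.cast_nonneg _) _) hJ0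
  have e54 : (z:ℝ)^54 * J = z * ((z:ℝ)^53 * J) := by rw [pow_succ' (z:ℝ) 53, mul_assoc]
  rw [e54]
  rw [mul_assoc 3] at hfin
  generalize (z:ℝ)^53 * J = X at hX0 hfin
  clear hR t1 t2 t3 t1' t2' e1 e2 hz50 hex hinv
  nlinarith

end

section

noncomputable def Nz (z : ℕ) : ℕ := ⌈Real.exp (0.92 * xz z)⌉₊

lemma Nz_facts {z : ℕ} (hz : 1000000 ≤ z) : Real.exp (0.92 * xz z) ≤ Nz z ∧ (Nz z : ℝ) ≤ Real.exp (0.93 * xz z) ∧ 1 ≤ Nz z := by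
  have hx := xz_ge (z := z) (by omega)
  have hz1 : (1000000:ℝ) ≤ z := by exact_mod_cast hz
  have h0 := Real.exp_pos (0.92 * xz z)
  have h1 : 1 ≤ Real.exp (0.92 * xz z) := Real.one_le_exp (by linarith)
  refine ⟨Nat.le_ceil _, ?_, Nat.ceil_pos.mpr h0⟩
  have h2 := (Nat.ceil_lt_add_one h0.le).le
  have h3 : Real.exp (0.93 * xz z) = Real.exp (0.92 * xz z) * Real.exp (0.01 * xz z) := by rw [← Real.exp_add]; congr 1; ring
  have h4 : 2 ≤ Real.exp (0.01 * xz z) := by linarith [Real.add_one_le_exp (0.01 * xz z)]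
  rw [h3, Nz]
  nlinarith

lemma int_le_const {f : ℝ → ℝ} (hf : Continuous f) {L K : ℝ} (hL : 0 ≤ L) (h : ∀ v ∈ Icc (-L) L, f v ≤ K) : ∫ v in (-L)..L, f v ≤ 2 * L * K := by
  have := intervalIntegral.integral_mono_on (by linarith : -L ≤ L) (hf.intervalIntegrable _ _) ((continuous_const (y := K)).intervalIntegrable (μ := MeasureTheory.volume) _ _) h
  refine this.trans (le_of_eq ?_)
  rw [intervalIntegral.integral_const, smul_eq_mul]; ring

lemma gg_strip2 : ∃ C : ℝ, 1 ≤ C ∧ ∀ z : ℕ, 1000000 ≤ z → C ≤ z → ∀ p : ℝ, Tz z / 4 ≤ p → p ≤ 2 * Tz z →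
    ∀ σ v : ℝ, 1/2 - etaz z ≤ σ → σ ≤ 102 → |v| ≤ 3 * z → ‖gg (Pz z) ((σ:ℂ) + (p+v:ℝ) * I)‖ ≤ Real.exp (3 * xz z) := by
  obtain ⟨C, hC1, hC⟩ := gg_left
  obtain ⟨C', hC1', hC'⟩ := gg_crude
  refine ⟨max C C', hC1.trans (le_max_left _ _), fun z hz hCz p hp1 hp2 σ v h1 h2 h3 => ?_⟩
  have hz1 : (1000000:ℝ) ≤ z := by exact_mod_cast hz
  obtain ⟨h0, hex, hl1, hl2, hinv, -, h4⟩ := eta_facts hz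
  obtain ⟨k1, k2, k3⟩ := height hz hp1 hp2 h3
  have hx := xz_ge (z := z) (by omega)
  have cr := hC' z hz ((le_max_right _ _).trans hCz)
  rcases le_total (1/2) σ with h | h
  · refine (cr ((σ:ℂ) + (p+v:ℝ) * I) (by simpa using h) (by simpa using h2) (by simpa using k3)).trans ?_
    exact Real.exp_le_exp.mpr (by linarith)
  · have a := hC z hz ((le_max_left _ _).trans hCz) (1/2 - σ) (p+v) (by linarith) (by linarith) k1 k2
    rw [show 1/2 - (1/2 - σ) = σ by ring] at a
    have b := cr (((1/2 + (1/2 - σ):ℝ):ℂ) + (p+v:ℝ) * I) (by simp; linarith) (by simp; linarith) (by simpa using k3)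
    have c : Real.exp ((1/2 - σ) * xz z) ≤ Real.exp (etaz z * xz z) := by
      rw [Real.exp_le_exp]; refine mul_le_mul_of_nonneg_right (by linarith) (by linarith)
    have d : (3:ℝ) ≤ Real.exp 2 := by linarith [Real.add_one_le_exp (2:ℝ)]
    calc _ ≤ _ := a
      _ ≤ Real.exp 2 * Real.exp (etaz z * xz z) * Real.exp (2 * xz z) := by gcongr
      _ = Real.exp (2 + etaz z * xz z + 2 * xz z) := by rw [Real.exp_add, Real.exp_add]
      _ ≤ _ := Real.exp_le_exp.mpr (by nlinarith)

lemma tri_exp (z v : ℝ) : Real.exp (2*z*|v|) * Real.exp (-(z^2*v^2)) ≤ 3 := by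
  rw [← Real.exp_add]
  refine (Real.exp_le_exp.mpr (?_ : _ ≤ (1:ℝ))).trans (by linarith [Real.exp_one_lt_d9])
  rw [← sq_abs v]; nlinarith [sq_nonneg (z * |v| - 1)]

set_option maxHeartbeats 1000000 in
lemma step2 : ∃ C : ℝ, 1 ≤ C ∧ ∀ z : ℕ, 1000000 ≤ z → C ≤ z → ∀ p : ℝ, Tz z / 4 ≤ p → p ≤ 2 * Tz z →
    (∀ t : ℝ, ‖ff (Pz z) (-1/2) (1/2 + (t:ℂ) * I)‖ ≤ ‖ff (Pz z) (-1/2) (1/2 + (p:ℂ) * I)‖ * (1 + |t - p|)^2) →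
    ∀ v : ℝ, |v| ≤ z →
    ‖gg (Pz z) (((1/2+etaz z:ℝ):ℂ) + (p+v:ℝ) * I)‖ ≤ ‖GN (Pz z) (Nz z) (((1/2+etaz z:ℝ):ℂ) + (p+v:ℝ) * I)‖
      + (∫ v' in (-(z:ℝ))..z, ‖GN (Pz z) (Nz z) (((1/2-etaz z:ℝ):ℂ) + (p+(v+v'):ℝ) * I)‖)
      + Real.exp (-62 * Real.log z) * ‖gg (Pz z) (1/2 + (p:ℂ) * I)‖ * Real.exp (2*z*|v|) + Real.exp (-xz z) := by
  obtain ⟨C, hC1, hC⟩ := gg_strip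
  obtain ⟨C', hC1', hC'⟩ := gg_strip2
  obtain ⟨C2, hC2', hC2⟩ := GN_tail
  refine ⟨max (max C C') C2, (hC1.trans (le_max_left _ _)).trans (le_max_left _ _), fun z hz hCz p hp1 hp2 hp v hv => ?_⟩
  have hz1 : (1000000:ℝ) ≤ z := by exact_mod_cast hz
  obtain ⟨h0, hex, hl1, hl2, hinv, h1, h2⟩ := eta_facts hz
  obtain ⟨n1, n2, n3⟩ := Nz_facts hz
  have hxz : xz z = (z:ℝ)^3 := rfl
  have hx0 : 0 < xz z := by rw [hxz]; positivity
  have hx := xz_ge (z := z) (by omega)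
  have hP1 : ∀ q ∈ Pz z, q.Prime ∧ 17 ≤ q := fun q hq => Pz_mem hq
  have hP2 : ∀ q ∈ Pz z, 17 ≤ q := fun q hq => (Pz_mem hq).2
  have hCz2 : C2 ≤ z := (le_max_right _ _).trans hCz
  have hS := hC z hz (((le_max_left _ _).trans (le_max_left _ _)).trans hCz) p hp1 hp2 hp
  have hS2 := hC' z hz (((le_max_right _ _).trans (le_max_left _ _)).trans hCz) p hp1 hp2
  set η := etaz z with hη
  set P := Pz z with hPdef
  set N := Nz z with hN
  set Q := ‖gg P (1/2 + (p:ℂ) * I)‖ with hQ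
  have hQ0 : 0 ≤ Q := norm_nonneg _
  have hN0 : (1:ℝ) ≤ N := by exact_mod_cast n3
  have hgd := gg_diff hP2
  have hGd := GN_diff P N
  set c0 : ℂ := (((1/2+η:ℝ):ℂ) + (p+v:ℝ) * I) with hc0
  have hG2 : ∀ s : ℂ, 0 ≤ s.re → ‖GN P N s‖ ≤ Real.exp (2 * xz z) := fun s hs => by
    refine (GN_norm hP1 N hs).trans ?_
    calc (N:ℝ)^2 ≤ (Real.exp (0.93 * xz z))^2 := by gcongr
      _ = Real.exp (2 * (0.93 * xz z)) := by rw [← Real.exp_nat_mul]; norm_num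
      _ ≤ _ := Real.exp_le_exp.mpr (by linarith)
  have hpt : ∀ x y : ℝ, c0 + ((x:ℂ) + y * I) = ((1/2 + η + x : ℝ):ℂ) + (p + (v+y):ℝ) * I := fun x y => by
    rw [hc0]; push_cast; ring
  have hMh : ∀ x y : ℝ, -(2*η) ≤ x → x ≤ 100 → |y| ≤ z → ‖gg P (c0 + ((x:ℂ) + y * I)) - GN P N (c0 + ((x:ℂ) + y * I))‖ ≤ Real.exp (4 * xz z) := by
    intro x y hx1 hx2 hy
    rw [hpt]
    have a := hS2 (1/2 + η + x) (v+y) (by linarith) (by linarith) ((abs_add_le _ _).trans (by linarith))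
    have b := hG2 (((1/2 + η + x : ℝ):ℂ) + (p + (v+y):ℝ) * I) (by simp; linarith)
    have e4 : Real.exp (4 * xz z) = Real.exp (3 * xz z) * Real.exp (xz z) := by rw [← Real.exp_add]; congr 1; ring
    have e2 : Real.exp (2 * xz z) ≤ Real.exp (3 * xz z) := Real.exp_le_exp.mpr (by linarith)
    have e1 : 2 ≤ Real.exp (xz z) := by linarith [Real.add_one_le_exp (xz z)]
    refine (norm_sub_le _ _).trans ?_
    rw [e4]
    have := mul_le_mul_of_nonneg_left e1 (Real.exp_pos (3 * xz z)).le
    linarith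
  have hHd : Differentiable ℂ fun w => gg P (c0 + w) - GN P N (c0 + w) :=
    (hgd.comp ((differentiable_const _).add differentiable_id)).sub (hGd.comp ((differentiable_const _).add differentiable_id))
  have hzabs : |(z:ℝ)| = z := abs_of_nonneg (by linarith)
  have hR := rectK hHd (a := 2 * η) (b := 100) (by linarith) (by norm_num)
    (by linarith : (0:ℝ) < z) (z:ℝ) (ℓ := 0.85 * xz z) (by positivity)
    (Mh := Real.exp (4 * xz z))
    (fun x hx => by exact hMh x z hx.1 hx.2 hzabs.le)
    (fun x hx => by
      have := hMh x (-z) hx.1 hx.2 (by rw [abs_neg, hzabs])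
      have e : (x:ℂ) + ((-(z:ℝ):ℝ):ℂ) * I = (x:ℂ) - ((z:ℝ):ℂ) * I := by push_cast; ring
      rw [e] at this
      exact this)
  simp only [add_zero] at hR
  -- continuity
  have hHc : ∀ x : ℝ, Continuous fun y : ℝ => ‖gg P (c0 + ((x:ℂ) + y * I)) - GN P N (c0 + ((x:ℂ) + y * I))‖ := fun x =>
    (hHd.continuous.comp (by fun_prop : Continuous fun y : ℝ => (x:ℂ) + y * I)).norm
  have hgauss : Continuous fun y : ℝ => Real.exp (-((z:ℝ)^2*y^2)) := by fun_prop
  have hHg : ∀ x : ℝ, Continuous fun y : ℝ => ‖gg P (c0 + ((x:ℂ) + y * I)) - GN P N (c0 + ((x:ℂ) + y * I))‖ * Real.exp (-((z:ℝ)^2*y^2)) :=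
    fun x => (hHc x).mul hgauss
  -- term 1
  have z2 : (z:ℝ)^2 * 1000000 ≤ xz z := by rw [hxz, pow_succ (z:ℝ) 2]; exact mul_le_mul_of_nonneg_left hz1 (by positivity)
  have T1 : Real.exp (0.85 * xz z * 100 + (z:ℝ)^2*100^2)/100 * (∫ y in (-(z:ℝ))..z, ‖gg P (c0 + (((100:ℝ):ℂ) + y * I)) - GN P N (c0 + (((100:ℝ):ℂ) + y * I))‖ * Real.exp (-((z:ℝ)^2*y^2))) ≤ Real.exp (-xz z)/2 := by
    have hI := int_le_const (hHg 100) (L := z) (K := z * Real.exp (-(90 * xz z))) (by linarith) (fun y hy => by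
      have a := hC2 P N (c0 + (((100:ℝ):ℂ) + y * I)) hP1 n3 (by rw [hpt]; simp; linarith)
      have b : (N:ℝ)^(5/2 - (c0 + (((100:ℝ):ℂ) + y * I)).re) ≤ Real.exp (-(90 * xz z)) := by
        have e : (5/2 - (c0 + (((100:ℝ):ℂ) + y * I)).re) = -98 - η := by rw [hpt]; simp; ring
        rw [e]
        calc (N:ℝ)^(-98-η) ≤ (N:ℝ)^(-98:ℝ) := Real.rpow_le_rpow_of_exponent_le hN0 (by linarith)
          _ ≤ (Real.exp (0.92 * xz z))^(-98:ℝ) := Real.rpow_le_rpow_of_nonpos (Real.exp_pos _) n1 (by norm_num)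
          _ = Real.exp (0.92 * xz z * (-98)) := by rw [← Real.exp_mul]
          _ ≤ _ := Real.exp_le_exp.mpr (by linarith)
      have c : Real.exp (-((z:ℝ)^2*y^2)) ≤ 1 := Real.exp_le_one_iff.mpr (neg_nonpos.mpr (by positivity))
      calc _ ≤ (C2 * (N:ℝ)^(5/2 - (c0 + (((100:ℝ):ℂ) + y * I)).re)) * 1 := mul_le_mul a c (Real.exp_pos _).le (by positivity)
        _ ≤ (z * Real.exp (-(90 * xz z))) * 1 := by gcongr
        _ = _ := mul_one _)
    refine (mul_le_mul_of_nonneg_left hI (by positivity)).trans ?_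
    have q := Real.quadratic_le_exp_of_nonneg (x := (z:ℝ)) (by linarith)
    have q2 : (z:ℝ)*z ≤ 2 * Real.exp z := by rw [← sq]; linarith
    calc _ = Real.exp (0.85 * xz z * 100 + (z:ℝ)^2*100^2) * Real.exp (-(90 * xz z)) * (z*z) / 50 := by ring
      _ ≤ Real.exp (0.85 * xz z * 100 + (z:ℝ)^2*100^2) * Real.exp (-(90 * xz z)) * (2 * Real.exp z) / 50 := by gcongr
      _ = Real.exp (0.85 * xz z * 100 + (z:ℝ)^2*100^2 + -(90 * xz z) + z) / 25 := by rw [Real.exp_add _ (z:ℝ), Real.exp_add _ (-(90 * xz z))]; ring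
      _ ≤ Real.exp (-xz z)/25 := by gcongr; linarith
      _ ≤ _ := by linarith [Real.exp_pos (-xz z)]
  -- term 3
  have T3 : (2 * η + 100)/z * Real.exp (0.85 * xz z * 100 + (z:ℝ)^2*(2 * η + 100)^2 - (z:ℝ)^2*(z:ℝ)^2) * Real.exp (4 * xz z) ≤ Real.exp (-xz z)/2 := by
    have a1 : (2 * η + 100)/z ≤ 1/2 := by rw [div_le_iff₀ (by linarith)]; linarith
    have a2 : (2 * η + 100)^2 ≤ 20000 := by
      calc (2 * η + 100)^2 ≤ (101:ℝ)^2 := by gcongr; linarith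
        _ ≤ _ := by norm_num
    have a3 : (z:ℝ)^2*(2 * η + 100)^2 ≤ (z:ℝ)^2 * 20000 := by gcongr
    have a4 : 1000000 * xz z ≤ (z:ℝ)^2*(z:ℝ)^2 := by
      rw [hxz]; calc _ ≤ (z:ℝ) * (z:ℝ)^3 := by gcongr
        _ = _ := by ring
    rw [mul_assoc, ← Real.exp_add]
    calc _ ≤ 1/2 * Real.exp (-xz z) := by
          refine mul_le_mul a1 (Real.exp_le_exp.mpr (by linarith)) (Real.exp_pos _).le (by norm_num)
      _ = _ := by ring
  -- term 2
  set κ := Real.exp (-(0.85 * xz z * (2 * η)) + (z:ℝ)^2*(2 * η)^2) / (2 * η) with hκ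
  have hzexp : (z:ℝ) = Real.exp (Real.log z) := (Real.exp_log (by linarith)).symm
  set l := Real.log (z:ℝ) with hl
  have hκ0 : 0 ≤ κ := by positivity
  have hκ2 : κ ≤ Real.exp (-166 * l) := by
    have b1 : (z:ℝ)^2*(2 * η)^2 ≤ 1 := by rw [← mul_pow]; exact pow_le_one₀ (by positivity) (by linarith)
    have b2 : 1/(2*η) ≤ Real.exp (3 * l) := by
      have : Real.exp (3 * l) = (z:ℝ)^3 := by rw [hl, show (3:ℝ) = ((3:ℕ):ℝ) by norm_num, Real.exp_nat_mul, Real.exp_log (by linarith)]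
      rw [this]; refine le_trans ?_ hinv
      gcongr; linarith
    rw [hκ, div_eq_mul_one_div]
    calc _ ≤ Real.exp (-(0.85 * xz z * (2 * η)) + (z:ℝ)^2*(2 * η)^2) * Real.exp (3 * l) := by gcongr
      _ = Real.exp (-(0.85 * xz z * (2 * η)) + (z:ℝ)^2*(2 * η)^2 + 3 * l) := by rw [Real.exp_add _ (3*l)]
      _ ≤ _ := Real.exp_le_exp.mpr (by linarith)
  have hκ1 : κ ≤ 1 := hκ2.trans (Real.exp_le_one_iff.mpr (by linarith))
  have ptL : ∀ y : ℝ, c0 + (((-(2*η):ℝ):ℂ) + y * I) = ((1/2 - η : ℝ):ℂ) + (p + (v+y):ℝ) * I := fun y => by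
    rw [hpt]; congr 2; ring
  have T2 : κ * (∫ y in (-(z:ℝ))..z, ‖gg P (c0 + (((-(2*η):ℝ):ℂ) + y * I)) - GN P N (c0 + (((-(2*η):ℝ):ℂ) + y * I))‖ * Real.exp (-((z:ℝ)^2*y^2))) ≤
      Real.exp (-62 * l) * Q * Real.exp (2*z*|v|) + ∫ y in (-(z:ℝ))..z, ‖GN P N (((1/2 - η : ℝ):ℂ) + (p + (v+y):ℝ) * I)‖ := by
    have hGc : Continuous fun y : ℝ => ‖GN P N (((1/2 - η : ℝ):ℂ) + (p + (v+y):ℝ) * I)‖ := (hGd.continuous.comp (by fun_prop)).norm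
    set K0 := 1400 * z^2 * Real.exp (η * xz z) * Q * Real.exp (2*z*|v|) * 3 with hK0
    have hmono := intervalIntegral.integral_mono_on (by linarith : -(z:ℝ) ≤ z) ((hHg (-(2*η))).intervalIntegrable _ _)
      ((continuous_const.add hGc).intervalIntegrable (μ := MeasureTheory.volume) (-(z:ℝ)) z) (g := fun y => K0 + ‖GN P N (((1/2 - η : ℝ):ℂ) + (p + (v+y):ℝ) * I)‖) (fun y hy => by
        rw [ptL]
        have hy' : |y| ≤ z := abs_le.mpr ⟨hy.1, hy.2⟩
        have a := hS (-η) (v+y) (by rw [abs_neg, abs_of_pos h0]) ((abs_add_le _ _).trans (by linarith))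
        rw [show 1/2 + -η = 1/2 - η by ring] at a
        have c : Real.exp (-((z:ℝ)^2*y^2)) ≤ 1 := Real.exp_le_one_iff.mpr (neg_nonpos.mpr (by positivity))
        have d : Real.exp (2*z*|v+y|) ≤ Real.exp (2*z*|v|) * Real.exp (2*z*|y|) := by
          rw [← Real.exp_add, Real.exp_le_exp]
          have := mul_le_mul_of_nonneg_left (abs_add_le v y) (by linarith : (0:ℝ) ≤ 2 * z)
          rw [mul_add] at this; exact this
        have t := tri_exp z y
        calc _ ≤ (‖gg P (((1/2 - η : ℝ):ℂ) + (p + (v+y):ℝ) * I)‖ + ‖GN P N (((1/2 - η : ℝ):ℂ) + (p + (v+y):ℝ) * I)‖) * Real.exp (-((z:ℝ)^2*y^2)) :=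
              mul_le_mul_of_nonneg_right (norm_sub_le _ _) (Real.exp_pos _).le
          _ = ‖gg P (((1/2 - η : ℝ):ℂ) + (p + (v+y):ℝ) * I)‖ * Real.exp (-((z:ℝ)^2*y^2)) + ‖GN P N (((1/2 - η : ℝ):ℂ) + (p + (v+y):ℝ) * I)‖ * Real.exp (-((z:ℝ)^2*y^2)) := add_mul _ _ _
          _ ≤ K0 + ‖GN P N (((1/2 - η : ℝ):ℂ) + (p + (v+y):ℝ) * I)‖ * 1 := by
              refine add_le_add ?_ (by gcongr)
              calc _ ≤ (1400 * z^2 * Real.exp (η * xz z) * Q * (Real.exp (2*z*|v|) * Real.exp (2*z*|y|))) * Real.exp (-((z:ℝ)^2*y^2)) := by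
                    refine mul_le_mul_of_nonneg_right (a.trans ?_) (Real.exp_pos _).le
                    exact mul_le_mul_of_nonneg_left d (by positivity)
                _ = (1400 * z^2 * Real.exp (η * xz z) * Q * Real.exp (2*z*|v|)) * (Real.exp (2*z*|y|) * Real.exp (-((z:ℝ)^2*y^2))) := by ring
                _ ≤ _ := mul_le_mul_of_nonneg_left t (by positivity)
          _ = _ := by rw [mul_one])
    rw [intervalIntegral.integral_add (intervalIntegrable_const) (hGc.intervalIntegrable _ _), intervalIntegral.integral_const, smul_eq_mul] at hmono
    set IG := ∫ y in (-(z:ℝ))..z, ‖GN P N (((1/2 - η : ℝ):ℂ) + (p + (v+y):ℝ) * I)‖ with hIG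
    have hIG0 : 0 ≤ IG := intervalIntegral.integral_nonneg (by linarith) fun v _ => norm_nonneg _
    refine (mul_le_mul_of_nonneg_left hmono hκ0).trans ?_
    rw [mul_add]
    refine add_le_add ?_ (mul_le_of_le_one_left hIG0 hκ1)
    have hxx : Real.exp (η * xz z) = Real.exp (100 * l) := by rw [mul_comm, hex]
    have h84 : (8400:ℝ) ≤ Real.exp l := by rw [← hzexp]; linarith
    have hpw : (z:ℝ)^3 = Real.exp (3 * l) := by rw [hl, show (3:ℝ) = ((3:ℕ):ℝ) by norm_num, Real.exp_nat_mul, Real.exp_log (by linarith)]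
    rw [hK0, hxx]
    calc _ = κ * (8400 * (z:ℝ)^3 * Real.exp (100 * l)) * (Q * Real.exp (2*z*|v|)) := by ring
      _ ≤ Real.exp (-166 * l) * (Real.exp l * Real.exp (3 * l) * Real.exp (100 * l)) * (Q * Real.exp (2*z*|v|)) := by
          rw [hpw]; gcongr
      _ = Real.exp (-62 * l) * (Q * Real.exp (2*z*|v|)) := by
          rw [← Real.exp_add, ← Real.exp_add, ← Real.exp_add]; congr 2; ring
      _ = _ := by ring
  have hgc : ‖gg P c0‖ ≤ ‖GN P N c0‖ + ‖gg P c0 - GN P N c0‖ := by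
    have := norm_add_le (GN P N c0) (gg P c0 - GN P N c0)
    rwa [add_sub_cancel] at this
  have e1 : -((2 * η : ℝ):ℂ) = ((-(2 * η) : ℝ):ℂ) := (Complex.ofReal_neg _).symm
  rw [e1] at hR
  have hR2 := hR.trans (add_le_add (add_le_add T1 T2) T3)
  linarith

end

section

lemma cs_interval {f : ℝ → ℝ} (hf : Continuous f) {L : ℝ} (hL : 0 < L) :
    (∫ v in (-L)..L, f v)^2 ≤ 2 * L * ∫ v in (-L)..L, f v^2 := by
  set A := ∫ v in (-L)..L, f v with hA
  set c := A / (2 * L) with hc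
  have h0 : 0 ≤ ∫ v in (-L)..L, (f v - c)^2 := intervalIntegral.integral_nonneg (by linarith) fun v _ => sq_nonneg _
  have e : (fun v => (f v - c)^2) = fun v => (f v^2 - 2 * c * f v) + c^2 := by ext v; ring
  rw [e, intervalIntegral.integral_add (Continuous.intervalIntegrable (by fun_prop) _ _) intervalIntegrable_const,
    intervalIntegral.integral_sub (Continuous.intervalIntegrable (by fun_prop) _ _) (Continuous.intervalIntegrable (by fun_prop) _ _),
    intervalIntegral.integral_const_mul, intervalIntegral.integral_const, smul_eq_mul, ← hA] at h0
  have hcA : A = c * (2 * L) := by rw [hc]; field_simp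
  have h2 : 0 ≤ (∫ v in (-L)..L, f v^2) - c * A := by
    have : (L - -L) * c^2 = c * A := by rw [hcA]; ring
    linarith
  have h3 : A^2 = 2 * L * (c * A) := by rw [hcA]; ring
  rw [h3]; gcongr; linarith

lemma shift_sub {φ : ℝ → ℝ} (hφ : Continuous φ) (h0 : ∀ t, 0 ≤ φ t) {z v : ℝ} (hz : 0 ≤ z) (hv : |v| ≤ z) (p : ℝ) :
    ∫ v' in (-z)..z, φ (p + (v + v')) ≤ ∫ v' in (-(2*z))..(2*z), φ (p + v') := by
  rw [intervalIntegral.integral_comp_add_left (fun y => φ (p + y)) v]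
  obtain ⟨h1, h2⟩ := abs_le.mp hv
  refine intervalIntegral.integral_mono_interval (by linarith) (by linarith) (by linarith) ?_ (Continuous.intervalIntegrable (hφ.comp (by fun_prop)) _ _)
  exact Filter.Eventually.of_forall fun y => h0 _

noncomputable def phi (z : ℕ) (σ t : ℝ) : ℝ := ‖GN (Pz z) (Nz z) ((σ:ℂ) + (t:ℝ) * I)‖

lemma phi_cont (z : ℕ) (σ : ℝ) : Continuous (phi z σ) := ((GN_diff _ _).continuous.comp (by fun_prop)).norm
lemma phi_nonneg (z : ℕ) (σ t : ℝ) : 0 ≤ phi z σ t := norm_nonneg _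

set_option maxHeartbeats 1000000 in
lemma step3 : ∃ C : ℝ, 1 ≤ C ∧ ∀ z : ℕ, 1000000 ≤ z → C ≤ z → ∀ p : ℝ, Tz z / 4 ≤ p → p ≤ 2 * Tz z →
    (∀ t : ℝ, ‖ff (Pz z) (-1/2) (1/2 + (t:ℂ) * I)‖ ≤ ‖ff (Pz z) (-1/2) (1/2 + (p:ℂ) * I)‖ * (1 + |t - p|)^2) →
    ‖gg (Pz z) (1/2 + (p:ℂ) * I)‖^2 ≤ Real.exp (114 * Real.log z) * (∫ v in (-(2*z:ℝ))..(2*z), (phi z (1/2+etaz z) (p+v)^2 + phi z (1/2-etaz z) (p+v)^2)) + Real.exp (-xz z) := by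
  obtain ⟨C, hC1, hC⟩ := step1
  obtain ⟨C', hC1', hC'⟩ := step2
  refine ⟨max C C', hC1.trans (le_max_left _ _), fun z hz hCz p hp1 hp2 hp => ?_⟩
  have hz1 : (1000000:ℝ) ≤ z := by exact_mod_cast hz
  obtain ⟨h0, hex, hl1, hl2, hinv, h1, h2⟩ := eta_facts hz
  have hx := xz_ge (z := z) (by omega)
  have hP2 : ∀ q ∈ Pz z, 17 ≤ q := fun q hq => (Pz_mem hq).2
  have s1 := hC z hz ((le_max_left _ _).trans hCz) p hp1 hp2 hp
  have s2 := hC' z hz ((le_max_right _ _).trans hCz) p hp1 hp2 hp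
  set η := etaz z with hη
  set Q := ‖gg (Pz z) (1/2 + (p:ℂ) * I)‖ with hQ
  have hQ0 : 0 ≤ Q := norm_nonneg _
  have hzexp : (z:ℝ) = Real.exp (Real.log z) := (Real.exp_log (by linarith)).symm
  have hz54 : (z:ℝ)^54 = Real.exp (54 * Real.log z) := by
    rw [show (54:ℝ) = ((54:ℕ):ℝ) by norm_num, Real.exp_nat_mul, Real.exp_log (by linarith)]
  rw [hz54] at s1
  set l := Real.log (z:ℝ) with hl
  set fp := phi z (1/2+η) with hfp
  set fm := phi z (1/2-η) with hfm
  have cp : Continuous fp := phi_cont _ _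
  have cm : Continuous fm := phi_cont _ _
  set Φp := ∫ v in (-(2*z:ℝ))..(2*z), fp (p+v) with hΦp
  set Φm := ∫ v in (-(2*z:ℝ))..(2*z), fm (p+v) with hΦm
  have cp' : Continuous fun v => fp (p+v) := cp.comp (by fun_prop)
  have cm' : Continuous fun v => fm (p+v) := cm.comp (by fun_prop)
  have hΦp0 : 0 ≤ Φp := intervalIntegral.integral_nonneg (by linarith) fun v _ => phi_nonneg _ _ _
  have hΦm0 : 0 ≤ Φm := intervalIntegral.integral_nonneg (by linarith) fun v _ => phi_nonneg _ _ _
  set K := Φm + Real.exp (-62 * l) * Q * 3 + Real.exp (-xz z) with hK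
  have hmono : (∫ v in (-(z:ℝ))..z, ‖gg (Pz z) (((1/2+η:ℝ):ℂ) + (p+v:ℝ) * I)‖ * Real.exp (-((z:ℝ)^2*v^2))) ≤ ∫ v in (-(z:ℝ))..z, (fp (p+v) + K) := by
    refine intervalIntegral.integral_mono_on (by linarith) (Continuous.intervalIntegrable ?_ _ _) ((cp'.add continuous_const).intervalIntegrable _ _) ?_
    · exact (((gg_diff hP2).continuous.comp (by fun_prop)).norm.mul (by fun_prop))
    · intro v hv
      have hv' : |v| ≤ z := abs_le.mpr ⟨hv.1, hv.2⟩
      have a := s2 v hv'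
      have b := shift_sub cm (phi_nonneg _ _) (by linarith : (0:ℝ) ≤ z) hv' p
      have a' : ‖gg (Pz z) (((1/2+η:ℝ):ℂ) + (p+v:ℝ) * I)‖ ≤ fp (p+v) + Φm + Real.exp (-62 * l) * Q * Real.exp (2*z*|v|) + Real.exp (-xz z) := by
        refine a.trans ?_
        gcongr
        · exact le_of_eq rfl
        · exact b
      have c : Real.exp (-((z:ℝ)^2*v^2)) ≤ 1 := Real.exp_le_one_iff.mpr (neg_nonpos.mpr (by positivity))
      have t := tri_exp z v
      have f0 := phi_nonneg z (1/2+η) (p+v)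
      calc _ ≤ (fp (p+v) + Φm + Real.exp (-62 * l) * Q * Real.exp (2*z*|v|) + Real.exp (-xz z)) * Real.exp (-((z:ℝ)^2*v^2)) :=
            mul_le_mul_of_nonneg_right a' (Real.exp_pos _).le
        _ = (fp (p+v) + Φm + Real.exp (-xz z)) * Real.exp (-((z:ℝ)^2*v^2)) + Real.exp (-62 * l) * Q * (Real.exp (2*z*|v|) * Real.exp (-((z:ℝ)^2*v^2))) := by ring
        _ ≤ (fp (p+v) + Φm + Real.exp (-xz z)) * 1 + Real.exp (-62 * l) * Q * 3 := by gcongr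
        _ = _ := by rw [hK]; ring
  rw [intervalIntegral.integral_add (cp'.intervalIntegrable _ _) intervalIntegrable_const, intervalIntegral.integral_const, smul_eq_mul] at hmono
  have hsub : ∫ v in (-(z:ℝ))..z, fp (p+v) ≤ Φp := by
    have := shift_sub cp (phi_nonneg _ _) (by linarith : (0:ℝ) ≤ z) (v := 0) (by simpa using (by linarith : (0:ℝ) ≤ z)) p
    simp only [zero_add] at this
    exact this
  have e0 := Real.exp_pos (-xz z)
  have s3 : Q ≤ Real.exp (54 * l) * (2 * z * (Φp + Φm + Real.exp (-xz z))) + Q/2 := by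
    have small : Real.exp (54 * l) * (2 * z * (Real.exp (-62 * l) * Q * 3)) ≤ Q/2 := by
      have e : Real.exp (54 * l) * (2 * z * (Real.exp (-62 * l) * Q * 3)) = 6 * Real.exp (-(7 * l)) * Q := by
        have : Real.exp (54 * l) * Real.exp l * Real.exp (-62 * l) = Real.exp (-(7*l)) := by
          rw [← Real.exp_add, ← Real.exp_add]; congr 1; ring
        rw [← this, ← hzexp]; ring
      rw [e]
      have : Real.exp (-(7*l)) ≤ Real.exp (-l) := Real.exp_le_exp.mpr (by linarith)
      have h3 : Real.exp (-l) ≤ 1/12 := by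
        rw [Real.exp_neg, ← hzexp, inv_le_comm₀ (by linarith) (by norm_num)]; linarith
      refine le_trans (mul_le_mul_of_nonneg_right (mul_le_mul_of_nonneg_left (this.trans h3) (by norm_num)) hQ0) (le_of_eq ?_)
      ring
    calc Q ≤ _ := s1
      _ ≤ Real.exp (54 * l) * (Φp + (z - -z) * K) := by gcongr; linarith
      _ ≤ Real.exp (54 * l) * (2 * z * Φp + (z - -z) * K) := by
          have := mul_le_mul_of_nonneg_right (by linarith : (1:ℝ) ≤ 2 * z) hΦp0
          gcongr; linarith
      _ = Real.exp (54 * l) * (2 * z * (Φp + Φm + Real.exp (-xz z))) + Real.exp (54 * l) * (2 * z * (Real.exp (-62 * l) * Q * 3)) := by rw [hK]; ring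
      _ ≤ _ := by linarith
  set Φ := Φp + Φm with hΦ
  have hΦ0 : 0 ≤ Φ := by positivity
  have s4 : Q ≤ 4 * Real.exp (55 * l) * (Φ + Real.exp (-xz z)) := by
    have e : Real.exp (55 * l) = Real.exp (54 * l) * z := by
      rw [show 55 * l = 54 * l + l by ring, Real.exp_add, ← hzexp]
    rw [e]; linarith
  have hΦeq : Φ = ∫ v in (-(2*z:ℝ))..(2*z), (fp (p+v) + fm (p+v)) := by
    rw [hΦ, intervalIntegral.integral_add (cp'.intervalIntegrable _ _) (cm'.intervalIntegrable _ _)]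
  have s5 := cs_interval (cp'.add cm') (L := 2 * z) (by linarith)
  set Ψ := ∫ v in (-(2*z:ℝ))..(2*z), (fp (p+v)^2 + fm (p+v)^2) with hΨ
  have s6 : (∫ v in (-(2*z:ℝ))..(2*z), (fp (p+v) + fm (p+v))^2) ≤ 2 * Ψ := by
    rw [hΨ, ← intervalIntegral.integral_const_mul]
    refine intervalIntegral.integral_mono_on (by linarith) (((cp'.add cm').pow 2).intervalIntegrable _ _) ((((cp'.pow 2).add (cm'.pow 2)).const_mul 2).intervalIntegrable _ _) ?_
    intro v _
    linarith [sq_nonneg (fp (p+v) - fm (p+v)), sub_sq (fp (p+v)) (fm (p+v)), add_sq (fp (p+v)) (fm (p+v))]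
  have s7 : Φ^2 ≤ 8 * z * Ψ := by
    rw [hΦeq]; refine s5.trans ?_
    calc _ ≤ 2 * (2 * z) * (2 * Ψ) := by gcongr; exact s6
      _ = _ := by ring
  have hΨ0 : 0 ≤ Ψ := intervalIntegral.integral_nonneg (by linarith) fun v _ => by positivity
  calc Q^2 ≤ (4 * Real.exp (55 * l) * (Φ + Real.exp (-xz z)))^2 := by gcongr
    _ ≤ (4 * Real.exp (55 * l))^2 * (2 * (Φ^2 + Real.exp (-xz z)^2)) := by
        rw [mul_pow]; gcongr; linarith [sq_nonneg (Φ - Real.exp (-xz z)), add_sq Φ (Real.exp (-xz z)), sub_sq Φ (Real.exp (-xz z))]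
    _ = 32 * Real.exp (110 * l) * (Φ^2 + Real.exp (-xz z)^2) := by
        have : Real.exp (110 * l) = Real.exp (55 * l)^2 := by rw [← Real.exp_nat_mul]; congr 1; push_cast; ring
        rw [this]; ring
    _ ≤ 32 * Real.exp (110 * l) * (8 * z * Ψ + Real.exp (-xz z)^2) := by gcongr
    _ = (256 * z) * Real.exp (110 * l) * Ψ + 32 * Real.exp (110 * l) * Real.exp (-xz z)^2 := by ring
    _ ≤ Real.exp (114 * l) * Ψ + Real.exp (-xz z) := by
        have b1 : (256:ℝ) ≤ Real.exp l := by rw [← hzexp]; linarith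
        refine add_le_add ?_ ?_
        · refine mul_le_mul_of_nonneg_right ?_ hΨ0
          calc 256 * (z:ℝ) * Real.exp (110 * l) ≤ Real.exp l * Real.exp l * Real.exp (110 * l) := by
                rw [← hzexp]; gcongr; linarith
            _ = Real.exp (112 * l) := by rw [← Real.exp_add, ← Real.exp_add]; congr 1; ring
            _ ≤ _ := Real.exp_le_exp.mpr (by linarith)
        · calc 32 * Real.exp (110 * l) * Real.exp (-xz z)^2 ≤ Real.exp l * Real.exp (110 * l) * Real.exp (-xz z)^2 := by gcongr; linarith
            _ = Real.exp (111 * l - xz z) * Real.exp (-xz z) := by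
                rw [← Real.exp_add, sq, ← mul_assoc, ← Real.exp_add]; congr 2; ring
            _ ≤ 1 * Real.exp (-xz z) := by
                gcongr; exact Real.exp_le_one_iff.mpr (by linarith)
            _ = _ := one_mul _

end

section

noncomputable def DD (z : ℕ) : ℝ := ∏ p ∈ Pz z, (5/4 - (p:ℝ)^(-(1/2):ℝ))

lemma DD_one (z : ℕ) : 1 ≤ DD z := by
  rw [DD]
  calc (1:ℝ) = ∏ p ∈ Pz z, (1:ℝ) := by simp
    _ ≤ _ := Finset.prod_le_prod (fun _ _ => zero_le_one) fun p hp => by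
      have := (rpow_p (Pz_mem hp).2).2; linarith

set_option maxHeartbeats 1000000 in
lemma phiMS {z : ℕ} (hz : 1000000 ≤ z) {σ : ℝ} (hσ : |σ - 1/2| ≤ etaz z) (T' : ℝ) :
    ∫ u : ℝ, phi z σ (T' + Dz z * u)^2 * gw u ≤ Real.sqrt Real.pi * (Real.exp (190 * Real.log z) * DD z + 1) := by
  have hz1 : (1000000:ℝ) ≤ z := by exact_mod_cast hz
  obtain ⟨h0, hex, hl1, hl2, hinv, h1, h2⟩ := eta_facts hz
  obtain ⟨hN1, hN2, hN3⟩ := Nz_facts hz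
  have hx := xz_ge (z := z) (by omega)
  obtain ⟨hσ1, hσ2⟩ := abs_le.mp hσ
  set η := etaz z
  set N := Nz z with hN
  set l := Real.log (z:ℝ) with hl
  have hzexp : Real.exp l = z := Real.exp_log (by linarith)
  have hNr : (1:ℝ) ≤ N := by exact_mod_cast hN3
  have hP : ∀ p ∈ Pz z, p.Prime ∧ 17 ≤ p := fun p hp => Pz_mem hp
  set a : ℕ → ℂ := fun n => (cf (Pz z) n : ℂ) * (n:ℂ)^(-(σ:ℂ)) with ha
  have e : ∀ u : ℝ, phi z σ (T' + Dz z * u) = ‖∑ n ∈ Finset.Icc 1 N, a n * (n:ℂ)^(-(((T' + Dz z * u : ℝ):ℂ) * I))‖ := by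
    intro u
    rw [phi, GN]
    congr 1
    refine Finset.sum_congr rfl fun n hn => ?_
    have hn1 : (n:ℂ) ≠ 0 := by
      have := (Finset.mem_Icc.mp hn).1
      exact_mod_cast (by omega : n ≠ 0)
    rw [ha]; simp only
    rw [mul_assoc, ← Complex.cpow_add _ _ hn1]
    congr 2; ring
  simp_rw [e]
  refine (MS N a T' (Dz z)).trans ?_
  have hna : ∀ n ∈ Finset.Icc 1 N, ‖a n‖ = |cf (Pz z) n| * (n:ℝ)^(-σ) := by
    intro n hn
    have := (Finset.mem_Icc.mp hn).1
    rw [ha]; simp only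
    rw [norm_mul, Complex.norm_real, Real.norm_eq_abs, Complex.norm_natCast_cpow_of_pos (by omega)]
    simp
  have hlogN : Real.log N ≤ 0.93 * xz z := by
    rw [Real.log_le_iff_le_exp (by linarith)]; exact hN2
  have hlogN0 : 0 ≤ Real.log N := Real.log_nonneg hNr
  have hNeta : (N:ℝ)^(2*η) ≤ Real.exp (186 * l) := by
    rw [Real.rpow_def_of_pos (by linarith)]
    refine Real.exp_le_exp.mpr ?_
    have : Real.log N * (2*η) ≤ 0.93 * xz z * (2 * η) := by gcongr
    nlinarith
  have hD := DD_one z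
  have hdiag : ∑ n ∈ Finset.Icc 1 N, ‖a n‖^2 ≤ Real.exp (190 * l) * DD z := by
    have hs : ∑ n ∈ Finset.Icc 1 N, ‖a n‖^2 ≤ ∑ n ∈ Finset.Icc 1 N, Real.exp (186 * l) * (wt (Pz z) n^2 / n) := by
      refine Finset.sum_le_sum fun n hn => ?_
      obtain ⟨hn1, hn2⟩ := Finset.mem_Icc.mp hn
      have hnr : (1:ℝ) ≤ n := by exact_mod_cast hn1
      have hnN : (n:ℝ) ≤ N := by exact_mod_cast hn2
      rw [hna n hn, mul_pow, sq_abs, cf_sq]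
      have e1 : ((n:ℝ)^(-σ))^2 = (n:ℝ)^(1 - 2*σ) * (1/n) := by
        rw [← Real.rpow_natCast, ← Real.rpow_mul (by linarith), one_div, ← Real.rpow_neg_one, ← Real.rpow_add (by linarith)]
        congr 1; push_cast; ring
      have e2 : (n:ℝ)^(1 - 2*σ) ≤ Real.exp (186 * l) := by
        calc (n:ℝ)^(1 - 2*σ) ≤ (n:ℝ)^(2*η) := Real.rpow_le_rpow_of_exponent_le hnr (by linarith)
          _ ≤ (N:ℝ)^(2*η) := Real.rpow_le_rpow (by linarith) hnN (by linarith)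
          _ ≤ _ := hNeta
      rw [e1]
      calc _ ≤ wt (Pz z) n^2 * (Real.exp (186 * l) * (1/n)) := by gcongr
        _ = _ := by ring
    refine hs.trans ?_
    rw [← Finset.mul_sum]
    have hd := diag_wt hP N
    rw [← DD] at hd
    have hh : ∑ n ∈ Finset.Icc 1 N, (1:ℝ)/n ≤ Real.exp (4 * l) := by
      refine harm_le.trans ?_
      have : Real.exp (4*l) = (z:ℝ)^4 := by
        rw [← hzexp, ← Real.exp_nat_mul]; norm_num
      rw [this]
      have hxz : xz z = (z:ℝ)^3 := rfl
      have h8 : (1:ℝ) ≤ (z:ℝ)^3 := one_le_pow₀ (by linarith)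
      nlinarith
    calc _ ≤ Real.exp (186 * l) * (DD z * Real.exp (4*l)) := by
          gcongr
          exact hd.trans (mul_le_mul_of_nonneg_left hh (by linarith))
      _ = Real.exp (186*l + 4*l) * DD z := by rw [Real.exp_add]; ring
      _ = _ := by congr 2; ring
  have hoff : Real.exp (-(Dz z*(1/(2*N)))^2/4) * (∑ n ∈ Finset.Icc 1 N, ‖a n‖)^2 ≤ 1 := by
    have hs : ∑ n ∈ Finset.Icc 1 N, ‖a n‖ ≤ (N:ℝ)^2 := by
      calc _ ≤ ∑ n ∈ Finset.Icc 1 N, (N:ℝ) := by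
            refine Finset.sum_le_sum fun n hn => ?_
            obtain ⟨hn1, hn2⟩ := Finset.mem_Icc.mp hn
            have hnr : (1:ℝ) ≤ n := by exact_mod_cast hn1
            have hnN : (n:ℝ) ≤ N := by exact_mod_cast hn2
            rw [hna n hn]
            have b1 := cf_abs hP hn1
            have b2 : (n:ℝ)^(-σ) ≤ 1 := Real.rpow_le_one_of_one_le_of_nonpos hnr (by linarith)
            have b3 : Real.sqrt n ≤ N := by
              rw [Real.sqrt_le_left (by linarith)]; nlinarith
            calc _ ≤ Real.sqrt n * 1 := mul_le_mul b1 b2 (by positivity) (by positivity)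
              _ ≤ _ := by linarith
        _ = _ := by simp; ring
    have hs0 : 0 ≤ ∑ n ∈ Finset.Icc 1 N, ‖a n‖ := Finset.sum_nonneg fun _ _ => norm_nonneg _
    have hs2 : (∑ n ∈ Finset.Icc 1 N, ‖a n‖)^2 ≤ Real.exp (4 * xz z) := by
      calc _ ≤ ((N:ℝ)^2)^2 := by gcongr
        _ ≤ (Real.exp (0.93 * xz z)^2)^2 := by gcongr
        _ = Real.exp (3.72 * xz z) := by
            rw [← Real.exp_nat_mul, ← Real.exp_nat_mul]; congr 1; push_cast; ring
        _ ≤ _ := Real.exp_le_exp.mpr (by linarith)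
    have hr : Real.exp (0.02 * xz z) / 2 ≤ Dz z * (1/(2*N)) := by
      rw [mul_one_div, div_le_div_iff₀ (by norm_num) (by linarith)]
      calc Real.exp (0.02 * xz z) * (2 * N) ≤ Real.exp (0.02 * xz z) * (2 * Real.exp (0.93 * xz z)) := by gcongr
        _ = Real.exp (0.02 * xz z + 0.93 * xz z) * 2 := by rw [Real.exp_add]; ring
        _ = _ := by rw [Dz]; congr 2; ring
    have hq : Real.exp (0.04 * xz z) / 4 ≤ (Dz z * (1/(2*N)))^2 := by
      calc _ = (Real.exp (0.02 * xz z) / 2)^2 := by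
            rw [div_pow, ← Real.exp_nat_mul]; norm_num; ring_nf
        _ ≤ _ := by gcongr
    have hq2 := exp_quad (y := 0.04 * xz z) (by linarith)
    have hbig : 4 * xz z ≤ (Dz z * (1/(2*N)))^2/4 := by nlinarith
    calc _ ≤ Real.exp (-(4 * xz z)) * Real.exp (4 * xz z) := by
          gcongr; linarith
      _ = 1 := by rw [← Real.exp_add]; simp
  gcongr

noncomputable def psi (z : ℕ) (t : ℝ) : ℝ := phi z (1/2 + etaz z) t^2 + phi z (1/2 - etaz z) t^2

lemma psi_cont (z : ℕ) : Continuous (psi z) := ((phi_cont _ _).pow 2).add ((phi_cont _ _).pow 2)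
lemma psi_nonneg (z : ℕ) (t : ℝ) : 0 ≤ psi z t := by rw [psi]; positivity
lemma psi_bd {z : ℕ} (hz : 1000000 ≤ z) (t : ℝ) : psi z t ≤ 2 * (Nz z:ℝ)^4 := by
  obtain ⟨h0, hex, hl1, hl2, hinv, h1, h2⟩ := eta_facts hz
  have hb : ∀ σ : ℝ, 0 ≤ σ → phi z σ t^2 ≤ (Nz z:ℝ)^4 := fun σ hσ => by
    have : phi z σ t ≤ (Nz z:ℝ)^2 := GN_norm (fun p hp => Pz_mem hp) _ (by simpa using hσ)
    calc phi z σ t^2 ≤ ((Nz z:ℝ)^2)^2 := by have := phi_nonneg z σ t; gcongr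
      _ = _ := by ring
  have a := hb (1/2+etaz z) (by linarith)
  have b := hb (1/2-etaz z) (by linarith)
  rw [psi]; linarith

lemma psi_gw_int {z : ℕ} (hz : 1000000 ≤ z) (T' : ℝ) : MeasureTheory.Integrable fun u => psi z (T' + Dz z * u) * gw u := by
  refine gw_growth_int (T := 0) (Δ := 0) (A := 2 * (Nz z:ℝ)^4) (((psi_cont z).comp (by fun_prop)).mul gw_cont) (by positivity) fun u => ?_
  have := psi_nonneg z (T' + Dz z * u)
  rw [Real.norm_of_nonneg (by have := gw_pos u; positivity)]
  simp only [zero_mul, add_zero, abs_zero, mul_one]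
  exact mul_le_mul_of_nonneg_right (psi_bd hz _) (gw_pos u).le

lemma psiMS {z : ℕ} (hz : 1000000 ≤ z) (T' : ℝ) :
    ∫ u : ℝ, psi z (T' + Dz z * u) * gw u ≤ 2 * (Real.sqrt Real.pi * (Real.exp (190 * Real.log z) * DD z + 1)) := by
  obtain ⟨h0, hex, hl1, hl2, hinv, h1, h2⟩ := eta_facts hz
  have hi : ∀ σ : ℝ, 0 ≤ σ → MeasureTheory.Integrable fun u => phi z σ (T' + Dz z * u)^2 * gw u := fun σ hσ => by
    refine gw_growth_int (T := 0) (Δ := 0) (A := (Nz z:ℝ)^4) ((((phi_cont z σ).comp (by fun_prop)).pow 2).mul gw_cont) (by positivity) fun u => ?_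
    rw [Real.norm_of_nonneg (by have := gw_pos u; positivity)]
    simp only [zero_mul, add_zero, abs_zero, mul_one]
    refine mul_le_mul_of_nonneg_right ?_ (gw_pos u).le
    have : phi z σ (T' + Dz z * u) ≤ (Nz z:ℝ)^2 := GN_norm (fun p hp => Pz_mem hp) _ (by simpa using hσ)
    calc phi z σ (T' + Dz z * u)^2 ≤ ((Nz z:ℝ)^2)^2 := by have := phi_nonneg z σ (T' + Dz z * u); gcongr
      _ = _ := by ring
  have a := phiMS hz (σ := 1/2 + etaz z) (by rw [add_sub_cancel_left, abs_of_pos h0]) T'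
  have b := phiMS hz (σ := 1/2 - etaz z) (by rw [sub_sub_cancel_left, abs_neg, abs_of_pos h0]) T'
  simp_rw [psi, add_mul]
  rw [MeasureTheory.integral_add (hi _ (by linarith)) (hi _ (by linarith))]
  linarith

noncomputable def HH (z : ℕ) (t : ℝ) : ℝ := ∫ v : ℝ, psi z (t + v) * (1 + v^2)⁻¹

lemma HH_int0 {z : ℕ} (hz : 1000000 ≤ z) (t : ℝ) : MeasureTheory.Integrable fun v : ℝ => psi z (t + v) * (1 + v^2)⁻¹ := by
  refine (integrable_inv_one_add_sq.const_mul (2 * (Nz z:ℝ)^4)).mono' ?_ (Eventually.of_forall fun v => ?_)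
  · refine Continuous.aestronglyMeasurable (((psi_cont z).comp (by fun_prop)).mul ?_)
    exact Continuous.inv₀ (by fun_prop) fun v => by positivity
  · have := psi_nonneg z (t + v)
    rw [Real.norm_of_nonneg (by positivity)]
    exact mul_le_mul_of_nonneg_right (psi_bd hz _) (by positivity)

lemma HH_nonneg (z : ℕ) (t : ℝ) : 0 ≤ HH z t := MeasureTheory.integral_nonneg fun v => by
  have := psi_nonneg z (t + v); positivity

lemma HH_prod {z : ℕ} (hz : 1000000 ≤ z) (T' : ℝ) :
    MeasureTheory.Integrable (fun w : ℝ × ℝ => (psi z (T' + Dz z * w.1 + w.2) * (1 + w.2^2)⁻¹) * gw w.1) (MeasureTheory.volume.prod MeasureTheory.volume) := by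
  have h1 := (gw_int.mul_prod integrable_inv_one_add_sq).const_mul (2 * (Nz z:ℝ)^4)
  refine h1.mono' ?_ (Eventually.of_forall fun w => ?_)
  · refine Continuous.aestronglyMeasurable ((((psi_cont z).comp (by fun_prop)).mul ?_).mul (gw_cont.comp continuous_fst))
    exact Continuous.inv₀ (by fun_prop) fun v => by positivity
  · have := psi_nonneg z (T' + Dz z * w.1 + w.2)
    have hg := gw_pos w.1
    rw [Real.norm_of_nonneg (by positivity)]
    calc _ ≤ ((2 * (Nz z:ℝ)^4) * (1 + w.2^2)⁻¹) * gw w.1 := by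
          refine mul_le_mul_of_nonneg_right (mul_le_mul_of_nonneg_right (psi_bd hz _) (by positivity)) hg.le
      _ = _ := by ring

lemma HH_gw_int {z : ℕ} (hz : 1000000 ≤ z) (T' : ℝ) : MeasureTheory.Integrable fun u => HH z (T' + Dz z * u) * gw u := by
  have := (HH_prod hz T').integral_prod_left
  simp_rw [MeasureTheory.integral_mul_const] at this
  exact this

lemma HHMS {z : ℕ} (hz : 1000000 ≤ z) (T' : ℝ) :
    ∫ u : ℝ, HH z (T' + Dz z * u) * gw u ≤ Real.pi * (2 * (Real.sqrt Real.pi * (Real.exp (190 * Real.log z) * DD z + 1))) := by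
  have e : ∫ u : ℝ, HH z (T' + Dz z * u) * gw u = ∫ v : ℝ, (1 + v^2)⁻¹ * ∫ u : ℝ, psi z ((T' + v) + Dz z * u) * gw u := by
    calc _ = ∫ u : ℝ, ∫ v : ℝ, (psi z (T' + Dz z * u + v) * (1 + v^2)⁻¹) * gw u := by
          simp_rw [MeasureTheory.integral_mul_const]; rfl
      _ = ∫ v : ℝ, ∫ u : ℝ, (psi z (T' + Dz z * u + v) * (1 + v^2)⁻¹) * gw u := MeasureTheory.integral_integral_swap (HH_prod hz T')
      _ = _ := by
          congr 1; ext v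
          rw [← MeasureTheory.integral_const_mul]
          congr 1; ext u
          rw [show T' + Dz z * u + v = T' + v + Dz z * u by ring]; ring
  rw [e]
  have hb := psiMS hz
  generalize 2 * (Real.sqrt Real.pi * (Real.exp (190 * Real.log z) * DD z + 1)) = B at hb ⊢
  rw [← integral_univ_inv_one_add_sq, ← MeasureTheory.integral_mul_const]
  refine MeasureTheory.integral_mono_of_nonneg (Eventually.of_forall fun v => ?_) (integrable_inv_one_add_sq.mul_const _) (Eventually.of_forall fun v => ?_)
  · refine mul_nonneg (by positivity) (MeasureTheory.integral_nonneg fun u => ?_)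
    exact mul_nonneg (psi_nonneg _ _) (gw_pos u).le
  · exact mul_le_mul_of_nonneg_left (hb _) (by positivity)

end

section

lemma psi_HH {z : ℕ} (hz : 1000000 ≤ z) (p t : ℝ) :
    (∫ v in (-(2*z:ℝ))..(2*z), psi z (p+v)) ≤ ((1 + |t - p|) * (1 + 2*z))^2 * HH z t := by
  have hz1 : (1000000:ℝ) ≤ z := by exact_mod_cast hz
  have hH : HH z t = ∫ v : ℝ, psi z (p + v) * (1 + (v + (p - t))^2)⁻¹ := by
    rw [HH, ← MeasureTheory.integral_add_right_eq_self _ (p - t)]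
    congr 1; ext v
    rw [show t + (v + (p - t)) = p + v by ring]
  have hI : MeasureTheory.Integrable fun v : ℝ => psi z (p + v) * (1 + (v + (p - t))^2)⁻¹ := by
    have := (HH_int0 hz t).comp_add_right (p - t)
    refine this.congr (Eventually.of_forall fun v => ?_)
    simp only
    rw [show t + (v + (p - t)) = p + v by ring]
  rw [hH, ← MeasureTheory.integral_const_mul, intervalIntegral.integral_of_le (by linarith)]
  refine le_trans ?_ (MeasureTheory.setIntegral_le_integral (s := Ioc (-(2*z:ℝ)) (2*z)) (hI.const_mul _) (Eventually.of_forall fun v => ?_))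
  · refine MeasureTheory.setIntegral_mono_on ?_ (hI.const_mul _).integrableOn measurableSet_Ioc fun v hv => ?_
    · exact (Continuous.integrableOn_Icc ((psi_cont z).comp (by fun_prop))).mono_set Ioc_subset_Icc_self
    · have h0 := psi_nonneg z (p+v)
      have hv' : |v| ≤ 2*z := abs_le.mpr ⟨hv.1.le, hv.2⟩
      have h1 : |v + (p - t)| ≤ 2*z + |t - p| := by
        refine (abs_add_le _ _).trans ?_
        rw [abs_sub_comm p t]; linarith
      have h2 : 1 + (v + (p-t))^2 ≤ ((1 + |t - p|) * (1 + 2*z))^2 := by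
        have h3 := abs_nonneg (v + (p-t))
        have h4 := abs_nonneg (t-p)
        rw [← sq_abs (v + (p-t))]
        have h5 : 1 + |v + (p-t)| ≤ (1 + |t - p|) * (1 + 2*z) := by nlinarith
        calc 1 + |v + (p-t)|^2 ≤ (1 + |v + (p-t)|)^2 := by nlinarith
          _ ≤ _ := by gcongr
      have hpos : 0 < 1 + (v + (p-t))^2 := by positivity
      calc psi z (p+v) = (1 + (v + (p-t))^2) * (psi z (p+v) * (1 + (v + (p-t))^2)⁻¹) := by field_simp
        _ ≤ _ := by gcongr
  · have h0 := psi_nonneg z (p+v)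
    simp only [Pi.zero_apply]; positivity

set_option maxHeartbeats 1000000 in
lemma pointwise : ∃ C : ℝ, 1 ≤ C ∧ ∀ z : ℕ, 1000000 ≤ z → C ≤ z → ∀ ε : ℝ, 0 < ε →
    (∀ p : ℝ, Tz z / 4 ≤ p → p ≤ 2 * Tz z → ff (Pz z) (-1/2) (1/2 + (p:ℂ) * I) ≠ 0 →
      (∀ t : ℝ, ‖ff (Pz z) (-1/2) (1/2 + (t:ℂ) * I)‖ ≤ ‖ff (Pz z) (-1/2) (1/2 + (p:ℂ) * I)‖ * (1 + |t - p|)^2) →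
      ε ≤ ‖eZ (1/2 + (p:ℂ) * I)‖) →
    ∀ t : ℝ, Tz z / 2 ≤ t → t ≤ 3 * Tz z / 2 → ‖ff (Pz z) (-1/2) (1/2 + (t:ℂ) * I)‖ ≤
      1/ε * (Real.exp (114 * Real.log z) * (1+2*z)^2 * HH z t + Real.exp (-xz z)) + 32 * C * Real.exp z / Tz z := by
  obtain ⟨C, hC1, hC⟩ := step3
  obtain ⟨C', hC1', hC'⟩ := ff_growth
  refine ⟨max C C', hC1.trans (le_max_left _ _), fun z hz hCz ε hε hcon t ht1 ht2 => ?_⟩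
  have hCz1 := (le_max_left _ _).trans hCz
  have hC'm : C' ≤ max C C' := le_max_right _ _
  set Cm := max C C'
  have hCm1 : 1 ≤ Cm := hC1'.trans hC'm
  have hz1 : (1000000:ℝ) ≤ z := by exact_mod_cast hz
  have hP2 : ∀ q ∈ Pz z, 17 ≤ q := fun q hq => (Pz_mem hq).2
  have hT : 0 < Tz z := Real.exp_pos _
  have hHH := HH_nonneg z t
  by_cases h0 : ff (Pz z) (-1/2) (1/2 + (t:ℂ) * I) = 0
  · rw [h0, norm_zero]; positivity
  have hgr : ∀ s : ℂ, 1/2 ≤ s.re → ‖ff (Pz z) (-1/2) s‖ ≤ (Cm * Real.exp z) * ‖s‖ := fun s hs => by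
    refine (hC' _ _ hP2 hm2 s hs).trans ?_
    have := card_pow z
    gcongr
  obtain ⟨p, hp1, hp2⟩ := peak_exists (ff_diff hP2 (-1/2)).continuous (by positivity) hgr t h0
  have hd0 := abs_nonneg (t - p)
  set d := |t - p| with hd
  set F := ‖ff (Pz z) (-1/2) (1/2 + (t:ℂ) * I)‖ with hF
  have hF0 : 0 < F := norm_pos_iff.mpr h0
  set M := ‖ff (Pz z) (-1/2) (1/2 + (p:ℂ) * I)‖ with hM
  obtain ⟨a1, a2⟩ := abs_le.mp (le_refl |t - p|)
  rw [← hd] at a1 a2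
  have hpart2 : 0 ≤ 32 * Cm * Real.exp z / Tz z := by positivity
  have hpart1 : 0 ≤ 1/ε * (Real.exp (114 * Real.log z) * (1+2*z)^2 * HH z t + Real.exp (-xz z)) := by positivity
  by_cases hdT : Tz z / 4 < d
  · have h1 : M ≤ (Cm * Real.exp z) * (1 + |p|) := (hgr _ (by simp)).trans (mul_le_mul_of_nonneg_left (norm_half_add p) (by positivity))
    have h2 : 1 + |p| ≤ 8 * (1 + d) := by
      have : |p| ≤ t + d := abs_le.mpr ⟨by linarith, by linarith⟩
      linarith
    have h3 : (F * (1 + d)) * (1+d) ≤ (8 * Cm * Real.exp z) * (1+d) := by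
      calc _ = F * (1+d)^2 := by ring
        _ ≤ _ := hp2
        _ ≤ _ := h1
        _ ≤ (Cm * Real.exp z) * (8 * (1+d)) := by gcongr
        _ = _ := by ring
    have h4 := le_of_mul_le_mul_right h3 (by linarith)
    have h5 : F ≤ 32 * Cm * Real.exp z / Tz z := by
      rw [le_div_iff₀ hT]; nlinarith
    linarith
  · push Not at hdT
    have hpa : Tz z / 4 ≤ p := by linarith
    have hpb : p ≤ 2 * Tz z := by linarith
    have hs := hC z hz hCz1 p hpa hpb hp1
    have hM0 : 0 < M := by
      have : 0 < F * (1+d)^2 := by positivity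
      linarith
    have he := hcon p hpa hpb (norm_pos_iff.mp hM0) hp1
    have hQ : ε * M ≤ ‖gg (Pz z) (1/2 + (p:ℂ) * I)‖^2 := by
      have e : ‖gg (Pz z) (1/2 + (p:ℂ) * I)‖^2 = ‖eZ (1/2 + (p:ℂ) * I)‖ * M := by
        rw [hM, gg, ff, norm_mul, norm_mul, norm_pow]
        norm_num
        ring
      rw [e]; gcongr
    have hps := psi_HH hz p t
    rw [← hd] at hps
    have hs' : ‖gg (Pz z) (1/2 + (p:ℂ) * I)‖^2 ≤ Real.exp (114 * Real.log z) * (∫ v in (-(2*z:ℝ))..(2*z), psi z (p+v)) + Real.exp (-xz z) := hs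
    have h1d : 1 ≤ (1+d)^2 := one_le_pow₀ (by linarith)
    have e0 := Real.exp_pos (-xz z)
    have hfin : (ε * F) * (1+d)^2 ≤ (Real.exp (114 * Real.log z) * (1+2*z)^2 * HH z t + Real.exp (-xz z)) * (1+d)^2 := by
      calc _ = ε * (F * (1+d)^2) := by ring
        _ ≤ ε * M := by gcongr
        _ ≤ _ := hQ
        _ ≤ _ := hs'
        _ ≤ Real.exp (114 * Real.log z) * (((1 + d) * (1 + 2*z))^2 * HH z t) + Real.exp (-xz z) * (1+d)^2 := by
            gcongr
            nlinarith
        _ = _ := by ring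
    have h6 := le_of_mul_le_mul_right hfin (by positivity)
    have h7 : F ≤ 1/ε * (Real.exp (114 * Real.log z) * (1+2*z)^2 * HH z t + Real.exp (-xz z)) := by
      rw [one_div, ← div_eq_inv_mul, le_div_iff₀ hε]; linarith
    linarith

end

section

noncomputable def EE (z : ℕ) : ℝ := ∏ p ∈ Pz z, (1 + (-1/2:ℝ) * (-1/2 + (p:ℝ)^(-(1/2):ℝ)))

lemma EE_DD (z : ℕ) : DD z * Real.exp (0.4 * PS z) ≤ EE z := by
  rw [DD, EE, PS, Finset.mul_sum, Real.exp_sum, ← Finset.prod_mul_distrib]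
  refine Finset.prod_le_prod (fun p hp => ?_) fun p hp => ?_
  · have := (rpow_p (Pz_mem hp).2).2
    exact mul_nonneg (by linarith) (Real.exp_pos _).le
  · obtain ⟨h1, h2⟩ := rpow_p (Pz_mem hp).2
    set y := (p:ℝ)^(-(1/2):ℝ)
    have h3 := Real.add_one_le_exp (-(0.4*y))
    have h4 : Real.exp (-(0.4*y)) * Real.exp (0.4*y) = 1 := by rw [← Real.exp_add]; simp
    have h5 := Real.exp_pos (0.4*y)
    have h6 : 5/4 - y ≤ Real.exp (-(0.4*y)) * (5/4 - y/2) := by nlinarith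
    calc (5/4 - y) * Real.exp (0.4*y) ≤ (Real.exp (-(0.4*y)) * (5/4 - y/2)) * Real.exp (0.4*y) := by gcongr
      _ = (Real.exp (-(0.4*y)) * Real.exp (0.4*y)) * (5/4 - y/2) := by ring
      _ = _ := by rw [h4]; ring

set_option maxHeartbeats 1000000 in
lemma small_peak {ε : ℝ} (hε : 0 < ε) : ∃ z₀ : ℕ, ∀ z ≥ z₀, ∃ p : ℝ, Tz z / 4 ≤ p ∧ p ≤ 2 * Tz z ∧
    ff (Pz z) (-1/2) (1/2 + (p:ℂ) * I) ≠ 0 ∧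
    (∀ t : ℝ, ‖ff (Pz z) (-1/2) (1/2 + (t:ℂ) * I)‖ ≤ ‖ff (Pz z) (-1/2) (1/2 + (p:ℂ) * I)‖ * (1 + |t - p|)^2) ∧
    ‖eZ (1/2 + (p:ℂ) * I)‖ < ε := by
  obtain ⟨C, hC1, hpt⟩ := pointwise
  obtain ⟨C', hC1', hgr⟩ := ff_growth
  obtain ⟨z₁, h1⟩ := M1z
  obtain ⟨z₂, h2⟩ := tailz (A := C') (by linarith)
  obtain ⟨z₃, h3⟩ := PS_large 1000
  obtain ⟨z₄, h4⟩ := exists_nat_ge C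
  obtain ⟨z₅, h5⟩ := exists_nat_ge (160 * (1/ε) + 20)
  refine ⟨max (max (max z₁ z₂) (max z₃ z₄)) (max z₅ 1000000), fun z hz => ?_⟩
  have hz1 : z₁ ≤ z := by omega
  have hz2 : z₂ ≤ z := by omega
  have hz3 : z₃ ≤ z := by omega
  have hz4 : z₄ ≤ z := by omega
  have hz5 : z₅ ≤ z := by omega
  have hz6 : 1000000 ≤ z := by omega
  have hCz : C ≤ z := h4.trans (by exact_mod_cast hz4)
  have hεz : 160 * (1/ε) + 20 ≤ z := h5.trans (by exact_mod_cast hz5)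
  clear h4 h5 hz
  by_contra! hcon
  have hp := hpt z hz6 hCz ε hε hcon
  have hm := h1 z hz1 (-1/2) (Or.inr rfl)
  have ht := h2 z hz2
  have hPS := (h3 z hz3).1
  clear h1 h2 h3 hpt hcon
  rw [← EE] at hm
  have hz0 : (1000000:ℝ) ≤ z := by exact_mod_cast hz6
  have hx := xz_ge (z := z) (by omega)
  have hP2 : ∀ q ∈ Pz z, 17 ≤ q := fun q hq => (Pz_mem hq).2
  have hT : 0 < Tz z := Real.exp_pos _
  have hD : 0 < Dz z := Real.exp_pos _
  have hff : ∀ t : ℝ, ‖eZ (1/2 + (t:ℂ) * I)‖ * ‖RR (Pz z) (-1/2) (1/2 + (t:ℂ) * I)‖^2 = ‖ff (Pz z) (-1/2) (1/2 + (t:ℂ) * I)‖ := fun t => by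
    rw [ff, norm_mul, norm_pow]
  simp_rw [hff] at hm
  have hfc : Continuous fun u : ℝ => ‖ff (Pz z) (-1/2) (1/2 + ((Tz z + Dz z * u : ℝ):ℂ) * I)‖ := ((ff_diff hP2 (-1/2)).continuous.comp (by fun_prop)).norm
  have hF : ∀ t : ℝ, ‖ff (Pz z) (-1/2) (1/2 + (t:ℂ) * I)‖ ≤ C' * ((3/2:ℝ)^(Pz z).card)^2 * (1 + |t|) := fun t =>
    (hgr _ _ hP2 hm2 _ (by simp)).trans (mul_le_mul_of_nonneg_left (norm_half_add t) (by positivity))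
  set K₁ := 1/ε * (Real.exp (114 * Real.log z) * (1+2*z)^2) with hK₁
  set K₀ := 1/ε * Real.exp (-xz z) + 32 * C * Real.exp z / Tz z with hK₀
  have hK₁0 : 0 ≤ K₁ := by positivity
  have hK₀0 : 0 ≤ K₀ := by positivity
  have hHi : MeasureTheory.Integrable fun u => K₁ * (HH z (Tz z + Dz z * u) * gw u) := (HH_gw_int hz6 (Tz z)).const_mul K₁
  have hGi : MeasureTheory.Integrable fun u => K₀ * gw u := gw_int.const_mul K₀
  have hsum : (fun u => (K₁ * HH z (Tz z + Dz z * u) + K₀) * gw u) = fun u => K₁ * (HH z (Tz z + Dz z * u) * gw u) + K₀ * gw u := by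
    ext u; ring
  have hcen := central (F := fun u => ‖ff (Pz z) (-1/2) (1/2 + ((Tz z + Dz z * u : ℝ):ℂ) * I)‖)
    (H := fun u => K₁ * HH z (Tz z + Dz z * u) + K₀)
    (A := C' * ((3/2:ℝ)^(Pz z).card)^2) (T := Tz z) (Δ := Dz z) (U := Tz z / (2 * Dz z)) (by positivity) (by positivity)
    (fun u _ => hF _) (fun u => by have := HH_nonneg z (Tz z + Dz z * u); positivity) (fun u hu => by
      have h5 : Dz z * |u| ≤ Tz z / 2 := by
        calc Dz z * |u| ≤ Dz z * (Tz z / (2 * Dz z)) := by gcongr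
          _ = _ := by field_simp
      have h6 := mul_le_mul_of_nonneg_left (neg_abs_le u) hD.le
      have h7 := mul_le_mul_of_nonneg_left (le_abs_self u) hD.le
      rw [mul_neg] at h6
      refine (hp (Tz z + Dz z * u) (by linarith) (by linarith)).trans (le_of_eq ?_)
      rw [hK₁, hK₀]; ring)
    (by
      refine gw_growth_int (T := Tz z) (Δ := Dz z) (A := C' * ((3/2:ℝ)^(Pz z).card)^2) (hfc.mul gw_cont) (by positivity) fun u => ?_
      rw [Real.norm_of_nonneg (by have := gw_pos u; positivity)]
      exact mul_le_mul_of_nonneg_right (hF _) (gw_pos u).le)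
    (by rw [hsum]; exact hHi.add hGi)
  rw [hsum, MeasureTheory.integral_add hHi hGi, MeasureTheory.integral_const_mul, MeasureTheory.integral_const_mul, gw_integral] at hcen
  have hHM := HHMS hz6 (Tz z)
  have hpi : 1 ≤ Real.sqrt Real.pi := Real.one_le_sqrt.mpr (by linarith [Real.pi_gt_three])
  have hexp : Real.exp (-xz z) ≤ 1 := Real.exp_le_one_iff.mpr (by linarith)
  have hDD := DD_one z
  have hED := EE_DD z
  set l := Real.log (z:ℝ) with hl
  have hl1 : 1 ≤ l := (eta_facts hz6).2.2.1
  have hzexp : Real.exp l = z := Real.exp_log (by linarith)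
  have hε0 : 0 < 1/ε := by positivity
  have hK0b : K₀ ≤ 1/ε + 1 := by
    have a : 1/ε * Real.exp (-xz z) ≤ 1/ε := mul_le_of_le_one_right hε0.le hexp
    have b : 32 * C * Real.exp z / Tz z ≤ 1 := by
      rw [div_le_one hT, Tz]
      have e1 := Real.add_one_le_exp (z:ℝ)
      calc 32 * C * Real.exp z ≤ Real.exp z * Real.exp z * Real.exp z := by gcongr <;> linarith
        _ = Real.exp (3 * z) := by rw [← Real.exp_add, ← Real.exp_add]; congr 1; ring
        _ ≤ _ := Real.exp_le_exp.mpr (by linarith)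
    linarith
  have hK1b : K₁ ≤ 1/ε * Real.exp (117 * l) := by
    rw [hK₁]; gcongr
    calc Real.exp (114 * l) * (1+2*z)^2 ≤ Real.exp (114*l) * (z:ℝ)^3 := by
          gcongr
          calc (1 + 2*(z:ℝ))^2 ≤ (3 * z)^2 := by gcongr; linarith
            _ = 9 * (z:ℝ)^2 := by ring
            _ ≤ z * (z:ℝ)^2 := by gcongr; linarith
            _ = _ := by ring
      _ = Real.exp (114*l + 3 * l) := by
          rw [Real.exp_add, show Real.exp (3*l) = Real.exp l^3 by rw [← Real.exp_nat_mul]; norm_num, hzexp]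
      _ = _ := by congr 1; ring
  have hE1 : Real.exp (400 * l) * DD z ≤ EE z := by
    refine le_trans ?_ hED
    have h9 : Real.exp (400 * l) ≤ Real.exp (0.4 * PS z) := Real.exp_le_exp.mpr (by linarith)
    exact (mul_le_mul_of_nonneg_right h9 (by linarith)).trans (le_of_eq (mul_comm _ _))
  have hDE : DD z ≤ Real.exp (-(400*l)) * EE z := by
    rw [Real.exp_neg, ← div_eq_inv_mul, le_div_iff₀ (Real.exp_pos _)]; linarith
  have hEz : (z:ℝ) ≤ EE z := by
    calc (z:ℝ) = Real.exp l := hzexp.symm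
      _ ≤ Real.exp (400 * l) := Real.exp_le_exp.mpr (by linarith)
      _ ≤ Real.exp (400 * l) * DD z := le_mul_of_one_le_right (Real.exp_pos _).le hDD
      _ ≤ _ := hE1
  set r := Real.sqrt Real.pi with hr
  have hmain : r / 2 * EE z ≤ K₁ * (Real.pi * (2 * (r * (Real.exp (190 * l) * DD z + 1)))) + K₀ * r + 1 := by
    have := mul_le_mul_of_nonneg_left hHM hK₁0
    linarith
  have hmain2 : EE z / 2 ≤ K₁ * (Real.pi * (2 * (Real.exp (190 * l) * DD z + 1))) + K₀ + 1 := by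
    have h : r * (EE z / 2) ≤ r * (K₁ * (Real.pi * (2 * (Real.exp (190 * l) * DD z + 1))) + K₀ + 1) := by linarith
    exact le_of_mul_le_mul_left h (by linarith)
  have he190 : 1 ≤ Real.exp (190 * l) := Real.one_le_exp (by linarith)
  have hbig : K₁ * (Real.pi * (2 * (Real.exp (190 * l) * DD z + 1))) ≤ 16 * (1/ε) * (1/z) * EE z := by
    have a : Real.exp (190 * l) * DD z + 1 ≤ 2 * (Real.exp (190 * l) * DD z) := by
      have := one_le_mul_of_one_le_of_one_le he190 hDD
      linarith
    calc _ ≤ (1/ε * Real.exp (117 * l)) * (4 * (2 * (2 * (Real.exp (190 * l) * (Real.exp (-(400*l)) * EE z))))) := by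
          have hpi4 := Real.pi_le_four
          refine mul_le_mul hK1b (mul_le_mul hpi4 ?_ (by positivity) (by norm_num)) (by positivity) (by positivity)
          have : Real.exp (190 * l) * DD z ≤ Real.exp (190 * l) * (Real.exp (-(400*l)) * EE z) := by gcongr
          linarith
      _ = 16 * (1/ε) * (Real.exp (117*l) * Real.exp (190*l) * Real.exp (-(400*l))) * EE z := by ring
      _ ≤ _ := by
          gcongr
          · linarith
          · rw [← Real.exp_add, ← Real.exp_add, one_div, ← hzexp, ← Real.exp_neg]
            refine Real.exp_le_exp.mpr ?_
            linarith
  have hs : 16 * (1/ε) * (1/z) ≤ 1/10 := by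
    rw [mul_one_div, div_le_iff₀ (by linarith)]; linarith
  have hs2 := mul_le_mul_of_nonneg_right hs (by linarith : (0:ℝ) ≤ EE z)
  linarith

lemma part_a (n : ℕ) : ∃ α ∈ Icc (-Real.pi) Real.pi, ∀ θ : ℝ, |θ - α| < Real.pi/8 →
    ∃ t r : ℝ, (n:ℝ) + 2 ≤ t ∧ 0 < r ∧ r ≤ 1/((n:ℝ)+1) ∧ riemannZeta (1/2 + (t:ℂ) * I) = r * cexp (I * θ) := by
  obtain ⟨C₀, hC₀, hpa⟩ := peak_arc
  have hn0 : (0:ℝ) ≤ n := by positivity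
  obtain ⟨z₀, hz₀⟩ := small_peak (ε := 1/(60*((n:ℝ)+1))) (by positivity)
  obtain ⟨z₁, h1⟩ := exists_nat_ge C₀
  set z := max (max z₀ z₁) (max n 30) with hz
  have hz1 : z₁ ≤ z := by omega
  have hz2 : n ≤ z := by omega
  have hz3 : 30 ≤ z := by omega
  obtain ⟨p, hp1, hp2, hp3, hp4, hp5⟩ := hz₀ z (by omega)
  clear_value z
  have hC : C₀ ≤ z := h1.trans (by exact_mod_cast hz1)
  have hnz : (n:ℝ) ≤ z := by exact_mod_cast hz2
  have hzr : (30:ℝ) ≤ z := by exact_mod_cast hz3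
  have hx := xz_ge hz3
  have hxz : xz z = (z:ℝ)^3 := rfl
  have hT : Tz z = Real.exp (xz z) := rfl
  have he := Real.add_one_le_exp (xz z)
  have hpz : (z:ℝ) + 10 ≤ p := by linarith
  have hZ := ZP_Pz z
  have hZ0 := ZP_nonneg (Pz z)
  refine ⟨arg (riemannZeta (1/2 + (p:ℂ) * I)), ⟨(neg_pi_lt_arg _).le, arg_le_pi _⟩, fun θ hθ => ?_⟩
  obtain ⟨t, r, a1, a2, -, a4, a5⟩ := hpa (Pz z) (-1/2) p (fun q hq => (Pz_mem hq).2) hm2 (by linarith) (by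
      rw [Real.le_log_iff_exp_le (by linarith)]
      have b1 : C₀ * (1 + ZP (Pz z)) ≤ xz z - 2 := by
        calc C₀ * (1 + ZP (Pz z)) ≤ z * (1 + 2 * z) := by gcongr
          _ ≤ _ := by rw [hxz]; nlinarith
      have b2 : Real.exp (xz z - 2) ≤ Tz z / 4 := by
        rw [Real.exp_sub, hT]
        have : (4:ℝ) ≤ Real.exp 2 := by
          have := Real.quadratic_le_exp_of_nonneg (x := 2) (by norm_num); linarith
        gcongr
      exact ((Real.exp_le_exp.mpr b1).trans b2).trans hp1)
    hp3 hp4 θ hθ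
  refine ⟨t, r, ?_, a2, ?_, a5⟩
  · have := (abs_le.mp a1).1; linarith
  · refine a4.trans ?_
    calc _ ≤ 60 * (1/(60*((n:ℝ)+1))) := by gcongr
      _ = _ := by field_simp

end

theorem stmt14 :
    ∃ θ₀ ∈ Set.Ico (0 : ℝ) (2 * Real.pi), ∃ θinf ∈ Set.Ico (0 : ℝ) (2 * Real.pi),
      (∀ θ ∈ Set.Ioo (θ₀ - Real.pi / 8) (θ₀ + Real.pi / 8),
        ∃ t : ℕ → ℝ, ∃ r : ℕ → ℝ, (∀ n, 2 ≤ t n) ∧ Tendsto t atTop atTop ∧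
          (∀ n, 0 < r n) ∧ Tendsto r atTop (𝓝 0) ∧
          ∀ n : ℕ, riemannZeta ((1 / 2 : ℂ) + (t n : ℝ) * Complex.I) =
            (r n : ℝ) * Complex.exp (Complex.I * (θ : ℝ))) ∧
      (∀ θ ∈ Set.Ioo (θinf - Real.pi / 8) (θinf + Real.pi / 8),
        ∃ t : ℕ → ℝ, ∃ r : ℕ → ℝ, (∀ n, 2 ≤ t n) ∧ Tendsto t atTop atTop ∧
          (∀ n, 0 < r n) ∧ Tendsto r atTop atTop ∧
          ∀ n : ℕ, riemannZeta ((1 / 2 : ℂ) + (t n : ℝ) * Complex.I) =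
            (r n : ℝ) * Complex.exp (Complex.I * (θ : ℝ))) := by
  exact stmt_of part_a part_b
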